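/- (Lund–Petridis) There exist absolute constants C, c > 0 such that the following holds. Let p be a prime and let E ⊆ F_p² with |E| ≤ c·p^{8/5}. Then T(E) ≤ C·( |E|²·log|E| + |E|^{5/3}·Q(E)^{4/15} ). -/

import Mathlib

open Finset

namespace FpDist

/-- Points of `𝔽_p²`. -/
abbrev Pt (p : ℕ) := ZMod p × ZMod p

/-- The "distance" `‖x - y‖ = (x₁-y₁)² + (x₂-y₂)²` in `𝔽_p²`. -/
def dist2 {p : ℕ} (x y : Pt p) : ZMod p := (x.1 - y.1)^2 + (x.2 - y.2)^2

/-- `‖x‖ = x₁² + x₂²`. -/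
def norm2 {p : ℕ} (x : Pt p) : ZMod p := x.1^2 + x.2^2

/-- The distance set `Δ(E) = {‖x - y‖ : x, y ∈ E}`. -/
def distSet {p : ℕ} (E : Finset (Pt p)) : Finset (ZMod p) :=
  (E ×ˢ E).image fun q => dist2 q.1 q.2

/-- `(a, b, c)` is a corner if `(b - a) · (c - a) = 0`. -/
def IsCorner {p : ℕ} (a b c : Pt p) : Prop :=
  (b.1 - a.1) * (c.1 - a.1) + (b.2 - a.2) * (c.2 - a.2) = 0

/-- `(a, b, c, d)` forms a rectangle if `(a,b,d), (b,a,c), (c,b,d), (d,a,c)` are corners. -/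
def IsRectangle {p : ℕ} (a b c d : Pt p) : Prop :=
  IsCorner a b d ∧ IsCorner b a c ∧ IsCorner c b d ∧ IsCorner d a c

/-- `□(E)`: the number of non-degenerate rectangles `(a,b,c,d) ∈ E⁴`
(non-degenerate: not all four vertices lie on one line). -/
noncomputable def rectCount (p : ℕ) [Fact p.Prime] (E : Finset (Pt p)) : ℕ :=
  Set.ncard {q : Pt p × Pt p × Pt p × Pt p |
    q.1 ∈ E ∧ q.2.1 ∈ E ∧ q.2.2.1 ∈ E ∧ q.2.2.2 ∈ E ∧
    IsRectangle q.1 q.2.1 q.2.2.1 q.2.2.2 ∧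
    ¬ Collinear (ZMod p) ({q.1, q.2.1, q.2.2.1, q.2.2.2} : Set (Pt p))}

/-- `T(E)`: the number of isosceles triangles, i.e. triples `(a,b,c) ∈ E³`
with `‖a - c‖ = ‖b - c‖ ≠ 0`. -/
def triCount {p : ℕ} (E : Finset (Pt p)) : ℕ :=
  ((E ×ˢ E ×ˢ E).filter fun q =>
    dist2 q.1 q.2.2 = dist2 q.2.1 q.2.2 ∧ dist2 q.1 q.2.2 ≠ 0).card

/-- The perpendicular bisector line `l_{ab} = {x : ‖x - a‖ = ‖x - b‖}`. -/
def bisector {p : ℕ} (a b : Pt p) : Set (Pt p) := {x | dist2 x a = dist2 x b}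

/-- `Q(E)`: the number of quadruples `(a,b,c,d) ∈ E⁴` with `‖a-b‖ ≠ 0`, `‖c-d‖ ≠ 0`
and `l_{ab} = l_{cd}`. -/
noncomputable def Qcount {p : ℕ} (E : Finset (Pt p)) : ℕ :=
  Set.ncard {q : Pt p × Pt p × Pt p × Pt p |
    q.1 ∈ E ∧ q.2.1 ∈ E ∧ q.2.2.1 ∈ E ∧ q.2.2.2 ∈ E ∧
    dist2 q.1 q.2.1 ≠ 0 ∧ dist2 q.2.2.1 q.2.2.2 ≠ 0 ∧
    bisector q.1 q.2.1 = bisector q.2.2.1 q.2.2.2}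

section Lines

open Polynomial

variable {K : Type*} [Field K]

/-- The coordinates of the line with parameters `l = (c, m, b)` in direction `i`: coordinate `i` is
free, the remaining horizontal coordinate equals `c`, and the last one is `m * X + b`. -/
noncomputable def lineCoord (i : Fin 3) (l : K × K × K) (j : Fin 3) : K[X] :=
  if j = i then X else if j = 2 then C l.2.1 * X + C l.2.2 else C l.1

/-- Restriction of a trivariate polynomial to a line. -/
noncomputable def restr (i : Fin 3) (l : K × K × K) : MvPolynomial (Fin 3) K →ₐ[K] K[X] :=
  MvPolynomial.aeval (lineCoord i l)

lemma natDegree_restr_le (i : Fin 3) (l : K × K × K) (F : MvPolynomial (Fin 3) K) :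
    (restr i l F).natDegree ≤ F.totalDegree := by
  have := MvPolynomial.aeval_natDegree_le F le_rfl (lineCoord i l) (n := 1) (fun j => by
    unfold lineCoord
    split_ifs
    · simp
    · compute_degree
    · simp)
  simpa [restr] using this

lemma derivative_restr {i : Fin 3} (hi : i ≠ 2) (l : K × K × K) (F : MvPolynomial (Fin 3) K) :
    derivative (restr i l F) =
      restr i l (MvPolynomial.pderiv i F) + C l.2.1 * restr i l (MvPolynomial.pderiv 2 F) := by
  induction F using MvPolynomial.induction_on with
  | C a => simp [restr, Polynomial.algebraMap_eq]
  | add p q hp hq => simp only [map_add, hp, hq]; ring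
  | mul_X p j hp =>
    simp only [map_mul, derivative_mul, hp, MvPolynomial.pderiv_mul, map_add]
    have hX : derivative (restr i l (MvPolynomial.X j)) =
        restr i l (MvPolynomial.pderiv i (MvPolynomial.X j)) +
          C l.2.1 * restr i l (MvPolynomial.pderiv 2 (MvPolynomial.X j)) := by
      by_cases h1 : j = i
      · subst h1
        simp [restr, lineCoord, MvPolynomial.pderiv_X_of_ne hi]
      · by_cases h2 : j = 2
        · subst h2
          simp [restr, lineCoord, h1, MvPolynomial.pderiv_X_of_ne h1]
        · simp [restr, lineCoord, h1, h2, MvPolynomial.pderiv_X_of_ne h1,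
            MvPolynomial.pderiv_X_of_ne h2]
    rw [hX]; ring

/-- The polynomial expressing that the second derivative in direction `i` vanishes on the implicit
surface `F = 0`, viewed as a graph over the first two coordinates. -/
noncomputable def ruling (i : Fin 3) (F : MvPolynomial (Fin 3) K) : MvPolynomial (Fin 3) K :=
  MvPolynomial.pderiv i (MvPolynomial.pderiv i F) * MvPolynomial.pderiv 2 F ^ 2
    - 2 * MvPolynomial.pderiv i (MvPolynomial.pderiv 2 F) * MvPolynomial.pderiv i F *
      MvPolynomial.pderiv 2 F
    + MvPolynomial.pderiv 2 (MvPolynomial.pderiv 2 F) * MvPolynomial.pderiv i F ^ 2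

lemma pderiv_comm (i j : Fin 3) (F : MvPolynomial (Fin 3) K) :
    MvPolynomial.pderiv i (MvPolynomial.pderiv j F) =
      MvPolynomial.pderiv j (MvPolynomial.pderiv i F) := by
  have h : ⁅(MvPolynomial.pderiv i : Derivation K (MvPolynomial (Fin 3) K) (MvPolynomial (Fin 3) K)),
      (MvPolynomial.pderiv j : Derivation K (MvPolynomial (Fin 3) K) (MvPolynomial (Fin 3) K))⁆ =
      0 := by
    apply MvPolynomial.derivation_ext
    intro k
    rw [Derivation.commutator_apply]
    simp only [MvPolynomial.pderiv_X, Pi.single_apply]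
    split_ifs <;> simp
  have := congrArg (fun D => D F) h
  simpa [Derivation.commutator_apply, sub_eq_zero] using this

lemma exists_restr_ruling {i : Fin 3} (hi : i ≠ 2) (l : K × K × K)
    (F : MvPolynomial (Fin 3) K) :
    ∃ E : K[X], restr i l (ruling i F) =
      restr i l (MvPolynomial.pderiv 2 F) ^ 2 * derivative (derivative (restr i l F)) +
        derivative (restr i l F) * E := by
  refine ⟨-2 * restr i l (MvPolynomial.pderiv 2 F) *
      restr i l (MvPolynomial.pderiv i (MvPolynomial.pderiv 2 F)) -
    2 * C l.2.1 * restr i l (MvPolynomial.pderiv 2 F) *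
      restr i l (MvPolynomial.pderiv 2 (MvPolynomial.pderiv 2 F)) +
    restr i l (MvPolynomial.pderiv 2 (MvPolynomial.pderiv 2 F)) *
      (restr i l (MvPolynomial.pderiv i F) + C l.2.1 * restr i l (MvPolynomial.pderiv 2 F)), ?_⟩
  simp only [derivative_restr hi, derivative_mul, derivative_C, ruling, map_add,
    map_sub, map_mul, map_pow, map_ofNat, pderiv_comm 2 i]
  ring

lemma restr_ruling_eq_zero {i : Fin 3} (hi : i ≠ 2) (l : K × K × K)
    {F : MvPolynomial (Fin 3) K} (h : restr i l F = 0) : restr i l (ruling i F) = 0 := by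
  obtain ⟨E, hE⟩ := exists_restr_ruling hi l F
  rw [hE, h]; simp

lemma totalDegree_pderiv_le (i : Fin 3) (F : MvPolynomial (Fin 3) K) :
    (MvPolynomial.pderiv i F).totalDegree ≤ F.totalDegree - 1 := by
  rw [MvPolynomial.totalDegree]
  apply Finset.sup_le
  intro m hm
  rw [MvPolynomial.mem_support_iff, MvPolynomial.coeff_pderiv] at hm
  have h1 : m + Finsupp.single i 1 ∈ F.support := by
    rw [MvPolynomial.mem_support_iff]
    exact left_ne_zero_of_mul hm
  have := MvPolynomial.le_totalDegree h1
  rw [Finsupp.sum_add_index' (by simp) (by simp), Finsupp.sum_single_index (by simp)] at this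
  omega

lemma totalDegree_ruling_le (i : Fin 3) (F : MvPolynomial (Fin 3) K) :
    (ruling i F).totalDegree ≤ 3 * F.totalDegree := by
  have h1 : ∀ j, (MvPolynomial.pderiv j F).totalDegree ≤ F.totalDegree :=
    fun j => (totalDegree_pderiv_le j F).trans (Nat.sub_le _ _)
  have h2 : ∀ j k, (MvPolynomial.pderiv j (MvPolynomial.pderiv k F)).totalDegree ≤ F.totalDegree :=
    fun j k => ((totalDegree_pderiv_le j _).trans (Nat.sub_le _ _)).trans (h1 k)
  have hm : ∀ (a b : MvPolynomial (Fin 3) K) (x y : ℕ), a.totalDegree ≤ x → b.totalDegree ≤ y →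
      (a * b).totalDegree ≤ x + y := fun a b x y ha hb =>
    (MvPolynomial.totalDegree_mul a b).trans (add_le_add ha hb)
  have two : (2 : MvPolynomial (Fin 3) K).totalDegree ≤ 0 := by
    have : (2 : MvPolynomial (Fin 3) K) = MvPolynomial.C 2 := (map_ofNat MvPolynomial.C 2).symm
    rw [this, MvPolynomial.totalDegree_C]
  unfold ruling
  refine (MvPolynomial.totalDegree_add _ _).trans (max_le
    ((MvPolynomial.totalDegree_sub _ _).trans (max_le ?_ ?_)) ?_)
  · rw [pow_two]
    exact (hm _ _ _ _ (h2 _ _) (hm _ _ _ _ (h1 _) (h1 _))).trans (by omega)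
  · exact (hm _ _ _ _ (hm _ _ _ _ (hm _ _ _ _ two (h2 _ _)) (h1 _)) (h1 _)).trans (by omega)
  · rw [pow_two]
    exact (hm _ _ _ _ (h2 _ _) (hm _ _ _ _ (h1 _) (h1 _))).trans (by omega)

/-- A surface of degree `< p` dividing its ruling polynomial contains the tangent lines in the
corresponding direction. -/
lemma restr_eq_zero_of_dvd_ruling {p : ℕ} [CharP K p] {i : Fin 3} (hi : i ≠ 2) (l : K × K × K)
    {F : MvPolynomial (Fin 3) K} (hp : F.totalDegree < p) (hF : F ∣ ruling i F) (t : K)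
    (h0 : (restr i l F).eval t = 0) (h1 : (derivative (restr i l F)).eval t = 0)
    (hb : (restr i l (MvPolynomial.pderiv 2 F)).eval t ≠ 0) : restr i l F = 0 := by
  classical
  obtain ⟨E, hE⟩ := exists_restr_ruling hi l F
  obtain ⟨G, hG⟩ := hF
  rw [hG, map_mul] at hE
  set ψ := restr i l F with hψ
  set b := restr i l (MvPolynomial.pderiv 2 F)
  by_contra hne
  have hmul : ψ.rootMultiplicity t < p := by
    have := (count_roots ψ (a := t)) ▸ (Multiset.count_le_card t ψ.roots).trans (card_roots' ψ)
    have : ψ.natDegree ≤ F.totalDegree := natDegree_restr_le i l F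
    omega
  obtain ⟨k, hk⟩ : ∃ k, ψ.rootMultiplicity t = k + 2 := by
    have : 1 < ψ.rootMultiplicity t :=
      (one_lt_rootMultiplicity_iff_isRoot hne).2 ⟨h0, h1⟩
    exact ⟨ψ.rootMultiplicity t - 2, by omega⟩
  obtain ⟨φ, hφ, hnd⟩ := exists_eq_pow_rootMultiplicity_mul_and_not_dvd ψ hne t
  rw [hk] at hφ hmul
  rw [dvd_iff_isRoot, IsRoot.def] at hnd
  have hkne : ((k + 2 : ℕ) : K) ≠ 0 := by
    rw [Ne, CharP.cast_eq_zero_iff K p]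
    exact fun h => by have := Nat.le_of_dvd (by omega) h; omega
  have hkne' : ((k + 1 : ℕ) : K) ≠ 0 := by
    rw [Ne, CharP.cast_eq_zero_iff K p]
    exact fun h => by have := Nat.le_of_dvd (by omega) h; omega
  have hd1 : derivative ψ = (X - C t) ^ (k + 1) *
      (((k + 2 : ℕ) : K[X]) * φ + (X - C t) * derivative φ) := by
    rw [hφ, derivative_mul, derivative_X_sub_C_pow]
    simp only [Nat.cast_add, Nat.cast_ofNat, show k + 2 - 1 = k + 1 from rfl, map_add,
       map_natCast, map_ofNat]
    ring
  have hd2 : derivative (derivative ψ) = (X - C t) ^ k *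
      (((k + 1 : ℕ) : K[X]) * ((k + 2 : ℕ) : K[X]) * φ + (X - C t) *
        (((k + 1 : ℕ) : K[X]) * derivative φ + derivative (((k + 2 : ℕ) : K[X]) * φ +
          (X - C t) * derivative φ))) := by
    rw [hd1, derivative_mul, derivative_X_sub_C_pow]
    simp only [Nat.cast_add, Nat.cast_one, Nat.cast_ofNat, show k + 1 - 1 = k from rfl, map_add,
       map_natCast, map_one]
    ring
  have key : (X - C t) ^ k * (b ^ 2 * (((k + 1 : ℕ) : K[X]) * ((k + 2 : ℕ) : K[X]) * φ)) =
      (X - C t) ^ k * ((X - C t) * ((X - C t) * φ * restr i l G - b ^ 2 *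
        (((k + 1 : ℕ) : K[X]) * derivative φ + derivative (((k + 2 : ℕ) : K[X]) * φ +
          (X - C t) * derivative φ)) -
        (((k + 2 : ℕ) : K[X]) * φ + (X - C t) * derivative φ) * E)) := by
    rw [hd2, hd1] at hE
    nth_rewrite 1 [hφ] at hE
    linear_combination (-1 : K[X]) * hE
  have key2 := mul_left_cancel₀ (pow_ne_zero k (X_sub_C_ne_zero t)) key
  have key3 := congrArg (Polynomial.eval t) key2
  simp only [eval_mul, eval_pow, eval_natCast, eval_sub, eval_X, eval_C, sub_self, zero_mul]
    at key3
  exact mul_ne_zero (pow_ne_zero 2 hb) (mul_ne_zero (mul_ne_zero hkne' hkne) hnd) key3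

end Lines

section Box

variable {K : Type*} [Field K]

/-- Trivariate polynomials whose degree in the variable `j` is less than `e j`. -/
noncomputable def degBox (K : Type*) [Field K] (e : Fin 3 → ℕ) :
    Submodule K (MvPolynomial (Fin 3) K) :=
  MvPolynomial.restrictSupport K {m | ∀ j, m j < e j}

lemma mem_degBox {e : Fin 3 → ℕ} (he : ∀ j, 0 < e j) {g : MvPolynomial (Fin 3) K} :
    g ∈ degBox K e ↔ ∀ j, g.degreeOf j < e j := by
  rw [degBox, MvPolynomial.mem_restrictSupport_iff]
  constructor
  · intro h j
    rw [MvPolynomial.degreeOf_lt_iff (he j)]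
    exact fun m hm => h hm j
  · intro h m hm j
    exact (MvPolynomial.degreeOf_lt_iff (he j)).1 (h j) m hm

/-- The exponents of the monomials in `degBox K e`. -/
noncomputable def boxEquiv (e : Fin 3 → ℕ) : {m : Fin 3 →₀ ℕ | ∀ j, m j < e j} ≃ ((j : Fin 3) → Fin (e j)) where
  toFun m j := ⟨m.1 j, m.2 j⟩
  invFun f := ⟨Finsupp.equivFunOnFinite.symm fun j => (f j : ℕ), fun j => (f j).2⟩
  left_inv m := by ext j; simp
  right_inv f := by ext j; simp

instance degBox_finite (e : Fin 3 → ℕ) : Module.Finite K (degBox K e) := by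
  have : Finite {m : Fin 3 →₀ ℕ | ∀ j, m j < e j} := Finite.of_equiv _ (boxEquiv e).symm
  exact Module.Finite.of_basis (MvPolynomial.basisRestrictSupport K _)

lemma finrank_degBox (e : Fin 3 → ℕ) : Module.finrank K (degBox K e) = e 0 * e 1 * e 2 := by
  rw [degBox, Module.finrank_eq_nat_card_basis
    (MvPolynomial.basisRestrictSupport K {m : Fin 3 →₀ ℕ | ∀ j, m j < e j}),
    Nat.card_congr (boxEquiv e)]
  simp [Fin.prod_univ_three, Nat.card_eq_fintype_card]

/-- The multiples of `F` by polynomials in `degBox K e`. -/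
noncomputable def mulBox (F : MvPolynomial (Fin 3) K) (e : Fin 3 → ℕ) :
    Submodule K (MvPolynomial (Fin 3) K) :=
  (degBox K e).map (LinearMap.mulLeft K F)

lemma finrank_mulBox {F : MvPolynomial (Fin 3) K} (hF : F ≠ 0) (e : Fin 3 → ℕ) :
    Module.finrank K (mulBox F e) = e 0 * e 1 * e 2 := by
  rw [← finrank_degBox (K := K) e]
  exact (LinearEquiv.finrank_eq (Submodule.equivMapOfInjective (LinearMap.mulLeft K F)
    (fun a b h => mul_left_cancel₀ hF h) (degBox K e))).symm

lemma mem_mulBox {F : MvPolynomial (Fin 3) K} (hF : F ≠ 0) {e : Fin 3 → ℕ}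
    (he : ∀ j, F.degreeOf j < e j) {g : MvPolynomial (Fin 3) K} :
    g ∈ mulBox F (fun j => e j - F.degreeOf j) ↔ g ∈ degBox K e ∧ F ∣ g := by
  have he0 : ∀ j, 0 < e j := fun j => (Nat.zero_le _).trans_lt (he j)
  have he1 : ∀ j, 0 < e j - F.degreeOf j := fun j => Nat.sub_pos_of_lt (he j)
  rw [mulBox, Submodule.mem_map]
  constructor
  · rintro ⟨q, hq, rfl⟩
    refine ⟨?_, Dvd.intro _ rfl⟩
    rw [mem_degBox he1] at hq
    rw [mem_degBox he0]
    intro j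
    have := MvPolynomial.degreeOf_mul_le j F q
    have := hq j
    have := he j
    simp only [LinearMap.mulLeft_apply]
    omega
  · rintro ⟨h, q, rfl⟩
    refine ⟨q, ?_, rfl⟩
    by_cases hq : q = 0
    · rw [hq]; exact zero_mem _
    rw [mem_degBox he0] at h
    rw [mem_degBox he1]
    intro j
    have := h j
    rw [MvPolynomial.degreeOf_mul_eq hF hq] at this
    omega

lemma card_le_of_box_count {N M E : ℤ} {d h : Fin 3 → ℤ} (hd : ∀ j, 0 ≤ d j)
    (hh : ∀ j, 0 ≤ h j) (hE : N ^ 2 < E)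
    (hM : d 0 * h 1 + d 1 * h 0 + d 0 * h 2 + d 2 * h 0 + d 1 * h 2 + d 2 * h 1 ≤ M)
    (H : N * (E - N) + (E - d 0) * (E - d 1) * (E - d 2) + (E - h 0) * (E - h 1) * (E - h 2) ≤
      E * E * E + (E - d 0 - h 0) * (E - d 1 - h 1) * (E - d 2 - h 2)) : N ≤ M := by
  by_contra hlt
  push Not at hlt
  have h3 : 0 ≤ (d 0 + h 0) * (d 1 + h 1) * (d 2 + h 2) - d 0 * d 1 * d 2 - h 0 * h 1 * h 2 := by
    have := hd 0; have := hd 1; have := hd 2; have := hh 0; have := hh 1; have := hh 2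
    have e : (d 0 + h 0) * (d 1 + h 1) * (d 2 + h 2) - d 0 * d 1 * d 2 - h 0 * h 1 * h 2 =
      d 0 * d 1 * h 2 + d 0 * h 1 * d 2 + h 0 * d 1 * d 2 + d 0 * h 1 * h 2 + h 0 * d 1 * h 2 +
        h 0 * h 1 * d 2 := by ring
    rw [e]; positivity
  have hE0 : 0 < E := lt_of_le_of_lt (sq_nonneg N) hE
  have key : N * E - N ^ 2 ≤ E * M := by
    have := mul_le_mul_of_nonneg_left hM hE0.le
    nlinarith
  nlinarith

end Box

section Bezout

open Polynomial

variable {K : Type*} [Field K]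

/-- No two different lines of the family have a common point at infinity unless they are parallel:
lines with equal first coordinate have equal slopes. -/
def ParallelFibers (S : Finset (K × K × K)) : Prop :=
  ∀ q ∈ S, ∀ r ∈ S, q.1 = r.1 → q.2.1 = r.2.1

/-- A linear form vanishing on the line `l'` but not meeting a different line `l`. -/
noncomputable def separatingForm [DecidableEq K] (i : Fin 3) (l l' : K × K × K) :
    MvPolynomial (Fin 3) K :=
  if l'.1 = l.1 then MvPolynomial.X 2 - MvPolynomial.C l'.2.1 * MvPolynomial.X i -
    MvPolynomial.C l'.2.2 else MvPolynomial.X (1 - i) - MvPolynomial.C l'.1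

lemma restr_separatingForm_self [DecidableEq K] {i : Fin 3} (hi : i ≠ 2) (l l' : K × K × K) :
    restr i l' (separatingForm i l l') = 0 := by
  fin_cases i
  · unfold separatingForm restr lineCoord
    split_ifs <;> simp [Polynomial.algebraMap_eq]
  · unfold separatingForm restr lineCoord
    split_ifs <;> simp [Polynomial.algebraMap_eq]
  · exact absurd rfl hi

lemma restr_separatingForm [DecidableEq K] {i : Fin 3} (hi : i ≠ 2) {l l' : K × K × K}
    (hne : l ≠ l') (hp : l'.1 = l.1 → l'.2.1 = l.2.1) :
    ∃ a : K, a ≠ 0 ∧ restr i l (separatingForm i l l') = C a := by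
  obtain ⟨c, m, b⟩ := l
  obtain ⟨c', m', b'⟩ := l'
  simp only at hp
  by_cases h : c' = c
  · have hm := hp h
    subst h hm
    refine ⟨b - b', fun h => hne ?_, ?_⟩
    · rw [sub_eq_zero.1 h]
    · fin_cases i
      · simp [separatingForm, restr, lineCoord, Polynomial.algebraMap_eq]
      · simp [separatingForm, restr, lineCoord, Polynomial.algebraMap_eq]
      · exact absurd rfl hi
  · refine ⟨c - c', fun h' => h (sub_eq_zero.1 h').symm, ?_⟩
    fin_cases i
    · simp [separatingForm, restr, lineCoord, Polynomial.algebraMap_eq, h]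
    · simp [separatingForm, restr, lineCoord, Polynomial.algebraMap_eq, h]
    · exact absurd rfl hi

lemma totalDegree_separatingForm_le [DecidableEq K] (i : Fin 3) (l l' : K × K × K) :
    (separatingForm i l l').totalDegree ≤ 1 := by
  unfold separatingForm
  split_ifs
  · refine (MvPolynomial.totalDegree_sub_C_le _ _).trans
      ((MvPolynomial.totalDegree_sub _ _).trans (max_le (by simp) ?_))
    exact (MvPolynomial.totalDegree_mul _ _).trans (by simp)
  · exact (MvPolynomial.totalDegree_sub_C_le _ _).trans (by simp)

lemma degreeOf_aeval_X_lt {i : Fin 3} {n : ℕ} {f : K[X]} (hf : f ∈ degreeLT K n) (j : Fin 3)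
    (hn : 0 < n) :
    (aeval (MvPolynomial.X i : MvPolynomial (Fin 3) K) f).degreeOf j < n := by
  have hnd : f.natDegree < n := by
    rw [mem_degreeLT] at hf
    by_cases h : f = 0
    · simpa [h] using hn
    · exact (natDegree_lt_iff_degree_lt h).2 hf
  refine lt_of_le_of_lt ((MvPolynomial.degreeOf_le_totalDegree _ _).trans ?_) hnd
  rw [aeval_eq_sum_range]
  refine MvPolynomial.totalDegree_finsetSum_le fun k hk => ?_
  refine (MvPolynomial.totalDegree_smul_le _ _).trans ((MvPolynomial.totalDegree_pow _ _).trans ?_)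
  rw [MvPolynomial.totalDegree_X, mul_one]
  exact Nat.lt_succ_iff.1 (Finset.mem_range.1 hk)

/-- Two surfaces with no common component share few lines of a common ruling direction. -/
theorem card_common_lines_le {i : Fin 3} (hi : i ≠ 2) {F H : MvPolynomial (Fin 3) K}
    (hF : Irreducible F) (hH : H ≠ 0) (hFH : ¬ F ∣ H) {Λ : Finset (K × K × K)}
    (hΛ : ParallelFibers Λ) (hΛF : ∀ l ∈ Λ, restr i l F = 0) (hΛH : ∀ l ∈ Λ, restr i l H = 0) :
    Λ.card ≤ 6 * F.totalDegree * H.totalDegree := by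
  classical
  set N := Λ.card with hN
  set d : Fin 3 → ℕ := fun j => F.degreeOf j with hd
  set h : Fin 3 → ℕ := fun j => H.degreeOf j with hh
  set E : ℕ := N ^ 2 + N + 1 + F.totalDegree + H.totalDegree with hE
  have hdle : ∀ j, d j ≤ F.totalDegree := fun j => MvPolynomial.degreeOf_le_totalDegree F j
  have hhle : ∀ j, h j ≤ H.totalDegree := fun j => MvPolynomial.degreeOf_le_totalDegree H j
  have hF0 : F ≠ 0 := hF.ne_zero
  have hFH0 : F * H ≠ 0 := mul_ne_zero hF0 hH
  have hdFH : ∀ j, (F * H).degreeOf j = d j + h j := fun j =>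
    MvPolynomial.degreeOf_mul_eq hF0 hH
  set e : Fin 3 → ℕ := fun _ => E with he
  have heF : ∀ j, F.degreeOf j < e j := fun j => by have := hdle j; simp only [hd, he] at *; omega
  have heH : ∀ j, H.degreeOf j < e j := fun j => by have := hhle j; simp only [hh, he] at *; omega
  have heFH : ∀ j, (F * H).degreeOf j < e j := fun j => by
    have := hdle j; have := hhle j; rw [hdFH]; simp only [he] at *; omega
  have hee : ∀ j, 0 < e j := fun j => by simp only [he]; omega
  set WF := mulBox F (fun j => e j - F.degreeOf j) with hWF
  set WH := mulBox H (fun j => e j - H.degreeOf j) with hWH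
  set WFH := mulBox (F * H) (fun j => e j - (F * H).degreeOf j) with hWFH
  have : Module.Finite K WF := by rw [hWF, mulBox]; infer_instance
  have : Module.Finite K WH := by rw [hWH, mulBox]; infer_instance
  have : Module.Finite K WFH := by rw [hWFH, mulBox]; infer_instance
  have hinf : WF ⊓ WH ≤ WFH := by
    intro g hg
    rw [Submodule.mem_inf, hWF, hWH, mem_mulBox hF0 heF, mem_mulBox hH heH] at hg
    obtain ⟨⟨hgE, hFg⟩, _, r, rfl⟩ := hg
    rw [hWFH, mem_mulBox hFH0 heFH]
    refine ⟨hgE, ?_⟩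
    rw [mul_comm F H]
    exact mul_dvd_mul_left H ((hF.prime.dvd_or_dvd hFg).resolve_left hFH)
  -- the auxiliary polynomials
  let P : K × K × K → MvPolynomial (Fin 3) K := fun l => ∏ l' ∈ Λ.erase l, separatingForm i l l'
  have hPdeg : ∀ l ∈ Λ, ∀ j, (P l).degreeOf j ≤ N := by
    intro l hl j
    refine (MvPolynomial.degreeOf_le_totalDegree _ _).trans
      ((MvPolynomial.totalDegree_finsetProd _ _).trans
      ((Finset.sum_le_card_nsmul _ _ 1 fun l' _ => totalDegree_separatingForm_le i l l').trans ?_))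
    rw [smul_eq_mul, mul_one, hN]
    exact Finset.card_le_card (Finset.erase_subset _ _)
  have hPself : ∀ l ∈ Λ, ∃ a : K, a ≠ 0 ∧ restr i l (P l) = C a := by
    intro l hl
    have : ∀ l' ∈ Λ.erase l, ∃ a : K, a ≠ 0 ∧ restr i l (separatingForm i l l') = C a := by
      intro l' hl'
      rw [Finset.mem_erase] at hl'
      exact restr_separatingForm hi hl'.1.symm (hΛ l' hl'.2 l hl)
    choose! a ha0 ha using this
    refine ⟨∏ l' ∈ Λ.erase l, a l', Finset.prod_ne_zero_iff.2 ha0, ?_⟩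
    simp only [P, map_prod]
    exact Finset.prod_congr rfl ha
  have hPother : ∀ l ∈ Λ, ∀ l' ∈ Λ, l' ≠ l → restr i l' (P l) = 0 := by
    intro l _ l' hl' hne
    simp only [P, map_prod]
    exact Finset.prod_eq_zero (Finset.mem_erase.2 ⟨hne, hl'⟩) (restr_separatingForm_self hi l l')
  let n := E - N
  have hn : 0 < n := by simp only [n]; omega
  let Φ : (Λ → degreeLT K n) →ₗ[K] MvPolynomial (Fin 3) K :=
    ∑ l : Λ, (LinearMap.mulLeft K (P l)) ∘ₗ (aeval (MvPolynomial.X i)).toLinearMap ∘ₗ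
      (degreeLT K n).subtype ∘ₗ LinearMap.proj l
  have hΦ : ∀ f, Φ f = ∑ l : Λ, P l * aeval (MvPolynomial.X i) (f l : K[X]) := by
    intro f; simp [Φ, LinearMap.sum_apply]
  have hΦE : ∀ f, Φ f ∈ degBox K e := by
    intro f
    rw [hΦ]
    refine Submodule.sum_mem _ fun l _ => ?_
    rw [mem_degBox hee]
    intro j
    have h1 := MvPolynomial.degreeOf_mul_le j (P l)
      (aeval (MvPolynomial.X i : MvPolynomial (Fin 3) K) (f l : K[X]))
    have h2 := hPdeg l l.2 j
    have h3 := degreeOf_aeval_X_lt (i := i) (f l).2 j hn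
    simp only [he, n] at *
    omega
  have hΦr : ∀ f, ∀ l : Λ, restr i l (Φ f) = 0 → f l = 0 := by
    intro f l h0
    rw [hΦ, map_sum, Finset.sum_eq_single l] at h0
    · obtain ⟨a, ha0, ha⟩ := hPself l l.2
      rw [map_mul, ha] at h0
      have h1 : restr i (l : K × K × K) (aeval (MvPolynomial.X i) (f l : K[X])) = (f l : K[X]) := by
        rw [← Polynomial.aeval_algHom_apply]
        simp [restr, lineCoord]
      rw [h1] at h0
      exact Subtype.ext ((mul_eq_zero.1 h0).resolve_left (C_ne_zero.2 ha0))
    · intro l' _ hne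
      rw [map_mul, hPother l' l'.2 l l.2 (fun h => hne (Subtype.ext h.symm)), zero_mul]
    · simp
  have hinj : Function.Injective Φ := by
    rw [injective_iff_map_eq_zero]
    intro f hf
    funext l
    exact hΦr f l (by rw [hf, map_zero])
  have hWvan : ∀ g ∈ WF ⊔ WH, ∀ l ∈ Λ, restr i l g = 0 := by
    intro g hg l hl
    obtain ⟨a, ha, b, hb, rfl⟩ := Submodule.mem_sup.1 hg
    obtain ⟨r, rfl⟩ := ((mem_mulBox hF0 heF).1 ha).2
    obtain ⟨s, rfl⟩ := ((mem_mulBox hH heH).1 hb).2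
    simp [hΛF l hl, hΛH l hl]
  set U := LinearMap.range Φ with hU
  have hdisj : U ⊓ (WF ⊔ WH) = ⊥ := by
    rw [eq_bot_iff]
    rintro g ⟨⟨f, rfl⟩, hg⟩
    have : f = 0 := funext fun l => hΦr f l (hWvan _ hg l l.2)
    simp [this]
  have hUrank : Module.finrank K U = N * n := by
    rw [hU, LinearMap.finrank_range_of_inj hinj, Module.finrank_pi_fintype,
      Finset.sum_const, Finset.card_univ, Fintype.card_coe, smul_eq_mul,
      (degreeLTEquiv K n).finrank_eq, Module.finrank_fin_fun]
  have : Module.Finite K U := by rw [hU]; infer_instance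
  have r1 := Submodule.finrank_sup_add_finrank_inf_eq U (WF ⊔ WH)
  have r2 := Submodule.finrank_sup_add_finrank_inf_eq WF WH
  have r3 : Module.finrank K ↥(WF ⊓ WH) ≤ Module.finrank K WFH := Submodule.finrank_mono hinf
  have r4 : Module.finrank K ↥(U ⊔ (WF ⊔ WH)) ≤ Module.finrank K (degBox K e) := by
    refine Submodule.finrank_mono (sup_le ?_ (sup_le ?_ ?_))
    · rintro _ ⟨f, rfl⟩; exact hΦE f
    · exact fun g hg => ((mem_mulBox hF0 heF).1 hg).1
    · exact fun g hg => ((mem_mulBox hH heH).1 hg).1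
  rw [hdisj, finrank_bot, add_zero, hUrank] at r1
  rw [hWF, hWH, finrank_mulBox hF0, finrank_mulBox hH] at r2
  rw [finrank_degBox] at r4
  rw [hWFH, finrank_mulBox hFH0] at r3
  simp only [hdFH] at r3
  have heqF : ∀ j, ((e j - F.degreeOf j : ℕ) : ℤ) = E - d j := fun j =>
    Nat.cast_sub (heF j).le
  have heqH : ∀ j, ((e j - H.degreeOf j : ℕ) : ℤ) = E - h j := fun j =>
    Nat.cast_sub (heH j).le
  have heqFH : ∀ j, ((e j - (d j + h j) : ℕ) : ℤ) = E - d j - h j := fun j => by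
    rw [Nat.cast_sub (by rw [← hdFH]; exact (heFH j).le)]; push_cast; ring
  have hnE : (n : ℤ) = E - N := Nat.cast_sub (by omega)
  zify at r1 r2 r3 r4
  rw [heqF, heqF, heqF, heqH, heqH, heqH] at r2
  rw [heqFH, heqFH, heqFH] at r3
  rw [hnE] at r1
  have hfin := card_le_of_box_count (N := N) (M := 6 * F.totalDegree * H.totalDegree) (E := E)
    (d := fun j => d j) (h := fun j => h j) (fun j => by positivity)
    (fun j => by positivity) (by rw [hE]; push_cast; nlinarith [Nat.zero_le N]) ?_ ?_
  · exact_mod_cast hfin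
  · have hm : ∀ j k, d j * h k ≤ F.totalDegree * H.totalDegree := fun j k =>
      Nat.mul_le_mul (hdle j) (hhle k)
    have h1 := hm 0 1; have h2 := hm 1 0; have h3 := hm 0 2
    have h4 := hm 2 0; have h5 := hm 1 2; have h6 := hm 2 1
    zify at h1 h2 h3 h4 h5 h6
    linarith
  · simp only [he] at r4
    linarith

end Bezout

section Interpolation

open Polynomial

variable {K : Type*} [Field K]

lemma totalDegree_le_of_mem_degBox {D : ℕ} {F : MvPolynomial (Fin 3) K}
    (hF : F ∈ degBox K fun _ => D + 1) : F.totalDegree ≤ 3 * D := by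
  rw [degBox, MvPolynomial.mem_restrictSupport_iff] at hF
  rw [MvPolynomial.totalDegree]
  refine Finset.sup_le fun m hm => ?_
  have h := hF hm
  have h0 := h 0
  have h1 := h 1
  have h2 := h 2
  rw [Finsupp.sum_fintype _ _ (by simp), Fin.sum_univ_three]
  omega

/-- A set of lines in a common ruling direction lies on a surface of degree at most a multiple of
the square root of the number of lines. -/
theorem exists_surface_through {i : Fin 3} (S : Finset (K × K × K)) :
    ∃ F : MvPolynomial (Fin 3) K, F ≠ 0 ∧ F.totalDegree ^ 2 ≤ 27 * S.card ∧
      ∀ l ∈ S, restr i l F = 0 := by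
  classical
  set D := Nat.sqrt (3 * S.card) with hD
  have hD1 : D * D ≤ 3 * S.card := Nat.sqrt_le _
  have hD2 : 3 * S.card < (D + 1) * (D + 1) := Nat.lt_succ_sqrt _
  have hmem : ∀ (F : degBox K fun _ => D + 1) (l : S),
      restr i l (F : MvPolynomial (Fin 3) K) ∈ degreeLT K (3 * D + 1) := by
    intro F l
    rw [mem_degreeLT]
    refine lt_of_le_of_lt degree_le_natDegree ?_
    have h1 := natDegree_restr_le i (l : K × K × K) (F : MvPolynomial (Fin 3) K)
    have h2 := totalDegree_le_of_mem_degBox F.2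
    exact_mod_cast Nat.lt_succ_of_le (h1.trans h2)
  let Ψ : (degBox K fun _ => D + 1) →ₗ[K] (S → degreeLT K (3 * D + 1)) :=
    LinearMap.pi fun l => LinearMap.codRestrict (degreeLT K (3 * D + 1))
      ((restr i (l : K × K × K)).toLinearMap ∘ₗ (degBox K fun _ => D + 1).subtype)
      (fun F => hmem F l)
  have hlt : Module.finrank K (S → degreeLT K (3 * D + 1)) <
      Module.finrank K (degBox K fun _ => D + 1) := by
    rw [finrank_degBox, Module.finrank_pi_fintype, Finset.sum_const, Finset.card_univ,
      Fintype.card_coe, smul_eq_mul, (degreeLTEquiv K _).finrank_eq, Module.finrank_fin_fun]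
    nlinarith
  have : Module.Finite K (degreeLT K (3 * D + 1)) :=
    Module.Finite.equiv (degreeLTEquiv K (3 * D + 1)).symm
  obtain ⟨F, hFk, hF0⟩ := Submodule.exists_mem_ne_zero_of_ne_bot
    (LinearMap.ker_ne_bot_of_finrank_lt (f := Ψ) hlt)
  refine ⟨F, fun h => hF0 (Subtype.ext h), ?_, fun l hl => ?_⟩
  · have := totalDegree_le_of_mem_degBox F.2
    nlinarith
  · have h1 : Ψ F ⟨l, hl⟩ = 0 := by rw [LinearMap.mem_ker.1 hFk]; rfl
    exact congrArg Subtype.val h1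

end Interpolation

section Quadric

open Polynomial

variable {K : Type*} [Field K]

lemma eval_restr_zero (l : K × K × K) (G : MvPolynomial (Fin 3) K) (t : K) :
    (restr 0 l G).eval t = MvPolynomial.eval ![t, l.1, l.2.1 * t + l.2.2] G := by
  induction G using MvPolynomial.induction_on with
  | C a => simp [restr, Polynomial.algebraMap_eq]
  | add p q hp hq => simp [hp, hq]
  | mul_X p j hp =>
    rw [map_mul, eval_mul, hp, map_mul]
    congr 1
    fin_cases j <;> simp [restr, lineCoord]

lemma eval_restr_one (l : K × K × K) (G : MvPolynomial (Fin 3) K) (t : K) :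
    (restr 1 l G).eval t = MvPolynomial.eval ![l.1, t, l.2.1 * t + l.2.2] G := by
  induction G using MvPolynomial.induction_on with
  | C a => simp [restr, Polynomial.algebraMap_eq]
  | add p q hp hq => simp [hp, hq]
  | mul_X p j hp =>
    rw [map_mul, eval_mul, hp, map_mul]
    congr 1
    fin_cases j <;> simp [restr, lineCoord]

lemma exists_line_zero {p : ℕ} [CharP K p] {F : MvPolynomial (Fin 3) K} (hp : F.totalDegree < p)
    (hF : F ∣ ruling 0 F) {x x' y : K} (h0 : MvPolynomial.eval ![x, x', y] F = 0)
    (h1 : MvPolynomial.eval ![x, x', y] (MvPolynomial.pderiv 2 F) ≠ 0) :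
    ∃ m b, m * x + b = y ∧ restr 0 (x', m, b) F = 0 := by
  set v := -(MvPolynomial.eval ![x, x', y] (MvPolynomial.pderiv 0 F)) /
    MvPolynomial.eval ![x, x', y] (MvPolynomial.pderiv 2 F) with hv
  refine ⟨v, y - v * x, by ring, ?_⟩
  have hpt : v * x + (y - v * x) = y := by ring
  refine restr_eq_zero_of_dvd_ruling (by decide) _ hp hF x ?_ ?_ ?_
  · rw [eval_restr_zero]; simpa only [hpt] using h0
  · rw [derivative_restr (by decide), eval_add, eval_mul, eval_restr_zero, eval_restr_zero, eval_C]
    simp only [hpt]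
    rw [hv]; field_simp; ring
  · rw [eval_restr_zero]; simpa only [hpt] using h1

lemma exists_line_one {p : ℕ} [CharP K p] {F : MvPolynomial (Fin 3) K} (hp : F.totalDegree < p)
    (hF : F ∣ ruling 1 F) {x x' y : K} (h0 : MvPolynomial.eval ![x, x', y] F = 0)
    (h1 : MvPolynomial.eval ![x, x', y] (MvPolynomial.pderiv 2 F) ≠ 0) :
    ∃ m b, m * x' + b = y ∧ restr 1 (x, m, b) F = 0 := by
  set v := -(MvPolynomial.eval ![x, x', y] (MvPolynomial.pderiv 1 F)) /
    MvPolynomial.eval ![x, x', y] (MvPolynomial.pderiv 2 F) with hv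
  refine ⟨v, y - v * x', by ring, ?_⟩
  have hpt : v * x' + (y - v * x') = y := by ring
  refine restr_eq_zero_of_dvd_ruling (by decide) _ hp hF x' ?_ ?_ ?_
  · rw [eval_restr_one]; simpa only [hpt] using h0
  · rw [derivative_restr (by decide), eval_add, eval_mul, eval_restr_one, eval_restr_one, eval_C]
    simp only [hpt]
    rw [hv]; field_simp; ring
  · rw [eval_restr_one]; simpa only [hpt] using h1

lemma not_dvd_X_sub_C_of_restr {F : MvPolynomial (Fin 3) K} {c m b c' : K}
    (h : restr 0 (c, m, b) F = 0) (hc : c ≠ c') :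
    ¬ F ∣ MvPolynomial.X 1 - MvPolynomial.C c' := by
  rintro ⟨k, hk⟩
  have := congrArg (restr 0 (c, m, b)) hk
  rw [map_mul, h, zero_mul] at this
  have := congrArg (Polynomial.eval 0) this
  rw [eval_restr_zero] at this
  simp [sub_eq_zero, hc] at this

/-- Lines of a surface in a plane `x' = c'` which is not a component. -/
lemma exists_finset_lines_in_plane [Infinite K] {F : MvPolynomial (Fin 3) K} (hF : Irreducible F)
    {c' : K} (hdvd : ¬ F ∣ MvPolynomial.X 1 - MvPolynomial.C c') :
    ∃ T : Finset (K × K), T.card ≤ F.totalDegree ∧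
      ∀ m b, restr 0 (c', m, b) F = 0 → (m, b) ∈ T := by
  classical
  let φ : MvPolynomial (Fin 3) K →ₐ[K] K[X][X] := MvPolynomial.aeval ![C X, C (C c'), X]
  have hφ : ∀ m b, ∀ G, (φ G).eval (C m * X + C b) = restr 0 (c', m, b) G := by
    intro m b G
    induction G using MvPolynomial.induction_on with
    | C a =>
      simp only [φ, restr, MvPolynomial.algHom_C]
      rw [Polynomial.algebraMap_apply, Polynomial.algebraMap_eq, eval_C]
    | add p q hp hq => simp [hp, hq]
    | mul_X p j hp =>
      rw [map_mul, eval_mul, hp, map_mul]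
      congr 1
      fin_cases j <;> simp [φ, restr, lineCoord]
  have hdeg : (φ F).natDegree ≤ F.totalDegree := by
    have := MvPolynomial.aeval_natDegree_le (R := K[X]) (F.map (algebraMap K K[X]))
      (Finset.sup_mono (MvPolynomial.support_map_subset _ _)) ![C X, C (C c'), X] (n := 1) (fun j => by
        fin_cases j <;> simp)
    rw [mul_one] at this
    rwa [MvPolynomial.aeval_map_algebraMap] at this
  have hne : φ F ≠ 0 := by
    intro h0
    obtain ⟨B, hB⟩ := Infinite.exists_subset_card_eq K (6 * F.totalDegree + 1)
    have hinj : Function.Injective (fun b : K => (c', (0 : K), b)) := fun a b h => by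
      simpa using h
    have hH : (MvPolynomial.X 1 - MvPolynomial.C c' : MvPolynomial (Fin 3) K) ≠ 0 := by
      intro h; rw [h] at hdvd; exact hdvd (dvd_zero _)
    have := card_common_lines_le (i := 0) (by decide) hF hH hdvd
      (Λ := B.image fun b => (c', 0, b)) ?_ ?_ ?_
    · rw [Finset.card_image_of_injective _ hinj, hB] at this
      have h1 : (MvPolynomial.X 1 - MvPolynomial.C c' : MvPolynomial (Fin 3) K).totalDegree ≤ 1 :=
        (MvPolynomial.totalDegree_sub_C_le _ _).trans (by simp)
      nlinarith
    · intro q hq r hr _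
      simp only [Finset.mem_image] at hq hr
      obtain ⟨_, _, rfl⟩ := hq
      obtain ⟨_, _, rfl⟩ := hr
      rfl
    · intro l hl
      simp only [Finset.mem_image] at hl
      obtain ⟨b, _, rfl⟩ := hl
      rw [← hφ, h0, eval_zero]
    · intro l hl
      simp only [Finset.mem_image] at hl
      obtain ⟨b, _, rfl⟩ := hl
      simp [restr, lineCoord, Polynomial.algebraMap_eq]
  refine ⟨(φ F).roots.toFinset.image fun r => (r.coeff 1, r.coeff 0),
    Finset.card_image_le.trans ((Multiset.toFinset_card_le _).trans
      ((card_roots' _).trans hdeg)), fun m b h => ?_⟩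
  rw [Finset.mem_image]
  refine ⟨C m * X + C b, ?_, by simp⟩
  rw [Multiset.mem_toFinset, mem_roots hne, IsRoot.def, hφ, h]

lemma exists_eval_ne_zero_finset [Infinite K] {ι : Type*} (s : Finset ι) (f : ι → K[X])
    (hf : ∀ x ∈ s, f x ≠ 0) : ∃ t, ∀ x ∈ s, (f x).eval t ≠ 0 := by
  have h : ∏ x ∈ s, f x ≠ 0 := Finset.prod_ne_zero_iff.2 hf
  obtain ⟨t, ht⟩ : ∃ t, (∏ x ∈ s, f x).eval t ≠ 0 := by
    by_contra! h'
    exact h (Polynomial.funext fun t => by simpa using h' t)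
  exact ⟨t, fun x hx h0 => ht (by rw [eval_prod]; exact Finset.prod_eq_zero hx h0)⟩

/-- A doubly ruled irreducible surface of small degree is a quadric `y = α x x' + β x + γ x' + δ`,
provided it contains a line along which it is a graph. -/
theorem exists_quadric_of_dvd_ruling [Infinite K] {p : ℕ} [CharP K p]
    {F : MvPolynomial (Fin 3) K} (hF : Irreducible F) (hp : F.totalDegree < p)
    (h0 : F ∣ ruling 0 F) (h1 : F ∣ ruling 1 F) {l₀ : K × K × K} (hl₀ : restr 0 l₀ F = 0)
    (hl₀' : restr 0 l₀ (MvPolynomial.pderiv 2 F) ≠ 0) :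
    ∃ α β γ δ : K, ∀ l : K × K × K, restr 0 l F = 0 →
      l.2.1 = α * l.1 + β ∧ l.2.2 = γ * l.1 + δ := by
  classical
  obtain ⟨c₀, m₀, b₀⟩ := l₀
  set d := F.totalDegree
  -- many starting points
  obtain ⟨X₀, hX₀, hX₀card⟩ : ∃ X₀ : Finset K, (∀ x ∈ X₀,
      (restr 0 (c₀, m₀, b₀) (MvPolynomial.pderiv 2 F)).eval x ≠ 0) ∧ d * (12 * d) < X₀.card := by
    have hinf : ({x | (restr 0 (c₀, m₀, b₀) (MvPolynomial.pderiv 2 F)).eval x ≠ 0} :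
        Set K).Infinite := by
      have hfin := (restr 0 (c₀, m₀, b₀) (MvPolynomial.pderiv 2 F)).roots.toFinset.finite_toSet
      refine hfin.infinite_compl.mono fun x hx => ?_
      simp only [Set.mem_compl_iff, Finset.mem_coe, Multiset.mem_toFinset, mem_roots hl₀'] at hx
      exact hx
    obtain ⟨X₀, hsub, hcard⟩ := hinf.exists_subset_card_eq (d * (12 * d) + 1)
    exact ⟨X₀, fun x hx => hsub hx, by omega⟩
  have hq : ∀ x ∈ X₀, ∃ v b, v * c₀ + b = m₀ * x + b₀ ∧ restr 1 (x, v, b) F = 0 ∧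
      restr 1 (x, v, b) (MvPolynomial.pderiv 2 F) ≠ 0 := by
    intro x hx
    have hy := hX₀ x hx
    rw [eval_restr_zero] at hy
    have hz : MvPolynomial.eval ![x, c₀, m₀ * x + b₀] F = 0 := by
      have := eval_restr_zero (c₀, m₀, b₀) F x
      rw [hl₀, eval_zero] at this
      exact this.symm
    obtain ⟨v, b, hvb, hv⟩ := exists_line_one hp h1 hz hy
    refine ⟨v, b, hvb, hv, fun h => hy ?_⟩
    have := eval_restr_one (x, v, b) (MvPolynomial.pderiv 2 F) c₀
    rw [h, eval_zero] at this
    simp only [hvb] at this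
    exact this.symm
  choose! v w hvw hvF hvy using hq
  obtain ⟨c₁, hc₁⟩ := exists_eval_ne_zero_finset (insertNone X₀)
    (fun o => o.elim (X - C c₀) fun x => restr 1 (x, v x, w x) (MvPolynomial.pderiv 2 F)) (by
      intro o ho
      cases o with
      | none => exact X_sub_C_ne_zero c₀
      | some x => exact hvy x (by simpa using ho))
  have hc : c₀ ≠ c₁ := by
    have := hc₁ none (by simp)
    simp only [Option.elim_none, eval_sub, eval_X, eval_C] at this
    exact fun h => this (by rw [h, sub_self])
  have hu : ∀ x ∈ X₀, ∃ u b, u * x + b = v x * c₁ + w x ∧ restr 0 (c₁, u, b) F = 0 := by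
    intro x hx
    have hy := hc₁ (some x) (by simpa using hx)
    simp only [Option.elim_some] at hy
    rw [eval_restr_one] at hy
    refine exists_line_zero hp h0 ?_ hy
    have := eval_restr_one (x, v x, w x) F c₁
    rw [hvF x hx, eval_zero] at this
    exact this.symm
  choose! u z huz huF using hu
  obtain ⟨T, hTcard, hT⟩ := exists_finset_lines_in_plane hF (not_dvd_X_sub_C_of_restr hl₀ hc)
  obtain ⟨⟨u₁, b₁⟩, _, hfib⟩ := Finset.exists_lt_card_fiber_of_mul_lt_card_of_maps_to
    (s := X₀) (t := T) (f := fun x => (u x, z x)) (n := 12 * d)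
    (fun x hx => hT _ _ (huF x hx)) (lt_of_le_of_lt (Nat.mul_le_mul_right _ hTcard) hX₀card)
  set X₁ := X₀.filter fun x => (u x, z x) = (u₁, b₁) with hX₁
  set Δ := c₁ - c₀ with hΔ
  have hΔ0 : Δ ≠ 0 := sub_ne_zero.2 hc.symm
  set α := (u₁ - m₀) / Δ with hα
  set β := (c₁ * m₀ - c₀ * u₁) / Δ with hβ
  set γ := (b₁ - b₀) / Δ with hγ
  set δ := (c₁ * b₀ - c₀ * b₁) / Δ with hδ
  set H : MvPolynomial (Fin 3) K := MvPolynomial.X 2 - (MvPolynomial.C α * MvPolynomial.X 0 *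
    MvPolynomial.X 1 + MvPolynomial.C β * MvPolynomial.X 0 + MvPolynomial.C γ * MvPolynomial.X 1 +
    MvPolynomial.C δ) with hH
  have hHr : ∀ c m b, restr 0 (c, m, b) H = C (m - (α * c + β)) * X + C (b - (γ * c + δ)) := by
    intro c m b
    simp only [hH, restr, lineCoord, map_sub, map_add, map_mul, MvPolynomial.aeval_X,
      MvPolynomial.algHom_C, Polynomial.algebraMap_eq]
    simp
    ring
  have hHr1 : ∀ c m b, restr 1 (c, m, b) H = C (m - (α * c + γ)) * X + C (b - (β * c + δ)) := by
    intro c m b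
    simp only [hH, restr, lineCoord, map_sub, map_add, map_mul, MvPolynomial.aeval_X,
      MvPolynomial.algHom_C, Polynomial.algebraMap_eq]
    simp
    ring
  have hH0 : H ≠ 0 := by
    intro h
    have := hHr 0 (α * 0 + β + 1) (γ * 0 + δ)
    rw [h, map_zero] at this
    simp at this
    exact X_ne_zero this.symm
  have hHdeg : H.totalDegree ≤ 2 := by
    have hCX : ∀ a : K, ∀ j : Fin 3, (MvPolynomial.C a * MvPolynomial.X j :
        MvPolynomial (Fin 3) K).totalDegree ≤ 1 := fun a j =>
      (MvPolynomial.totalDegree_mul _ _).trans (by simp)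
    refine (MvPolynomial.totalDegree_sub _ _).trans (max_le (by simp) ?_)
    refine (MvPolynomial.totalDegree_add _ _).trans (max_le ?_ (by simp))
    refine (MvPolynomial.totalDegree_add _ _).trans (max_le ?_ ((hCX _ _).trans (by simp)))
    refine (MvPolynomial.totalDegree_add _ _).trans (max_le ?_ ((hCX _ _).trans (by simp)))
    refine (MvPolynomial.totalDegree_mul _ _).trans ?_
    have := hCX α 0
    simp only [MvPolynomial.totalDegree_X]
    omega
  have hdvd : F ∣ H := by
    by_contra hnd
    have hinj : Function.Injective fun x => (x, v x, w x) := fun a b h => congrArg Prod.fst h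
    have := card_common_lines_le (i := 1) (by decide) hF hH0 hnd
      (Λ := X₁.image fun x => (x, v x, w x)) ?_ ?_ ?_
    · rw [Finset.card_image_of_injective _ hinj] at this
      have : 6 * F.totalDegree * H.totalDegree ≤ 6 * d * 2 := Nat.mul_le_mul le_rfl hHdeg
      omega
    · intro q hq r hr hqr
      simp only [Finset.mem_image] at hq hr
      obtain ⟨a, _, rfl⟩ := hq
      obtain ⟨b, _, rfl⟩ := hr
      simp only at hqr
      rw [hqr]
    · intro l hl
      simp only [Finset.mem_image] at hl
      obtain ⟨x, hx, rfl⟩ := hl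
      exact hvF x (Finset.mem_filter.1 hx).1
    · intro l hl
      simp only [Finset.mem_image] at hl
      obtain ⟨x, hx, rfl⟩ := hl
      rw [hX₁, Finset.mem_filter, Prod.mk.injEq] at hx
      obtain ⟨hx, hux, hzx⟩ := hx
      have e0 := hvw x hx
      have e1 := huz x hx
      rw [hux, hzx] at e1
      have hv : v x = α * x + γ := by
        rw [hα, hγ]; field_simp; rw [hΔ]; linear_combination -e0 - e1
      have hw : w x = β * x + δ := by
        rw [hβ, hδ]; field_simp; rw [hΔ]; linear_combination c₁ * e0 + c₀ * e1
      rw [hHr1, hv, hw]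
      simp
  refine ⟨α, β, γ, δ, ?_⟩
  rintro ⟨c, m, b⟩ hl
  obtain ⟨k, hk⟩ := hdvd
  have h2 := hHr c m b
  rw [hk, map_mul, hl, zero_mul] at h2
  have e1 := congrArg (fun f => Polynomial.coeff f 1) h2
  have e0 := congrArg (fun f => Polynomial.coeff f 0) h2
  simp at e1 e0
  exact ⟨sub_eq_zero.1 e1.symm, sub_eq_zero.1 e0.symm⟩

end Quadric

section Incidence

open Classical in
/-- The number of incident pairs between two finite sets, for a relation `I`. -/
noncomputable def inc {α β : Type*} (I : α → β → Prop) (S : Finset α) (R : Finset β) : ℕ :=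
  ∑ q ∈ S, (R.filter (I q)).card

open Classical in
lemma inc_comm {α β : Type*} (I : α → β → Prop) (S : Finset α) (R : Finset β) :
    inc I S R = ∑ l ∈ R, (S.filter fun q => I q l).card :=
  Finset.sum_card_bipartiteAbove_eq_sum_card_bipartiteBelow I

lemma inc_union_left [DecidableEq α] {β : Type*} (I : α → β → Prop) (S T : Finset α)
    (R : Finset β) : inc I (S ∪ T) R ≤ inc I S R + inc I T R := by
  classical
  have := Finset.sum_union_inter (s₁ := S) (s₂ := T) (f := fun q => (R.filter (I q)).card)
  unfold inc
  omega

lemma inc_union_right {α : Type*} [DecidableEq β] (I : α → β → Prop) (S : Finset α)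
    (R T : Finset β) : inc I S (R ∪ T) ≤ inc I S R + inc I S T := by
  classical
  rw [inc_comm, inc_comm, inc_comm]
  have := Finset.sum_union_inter (s₁ := R) (s₂ := T) (f := fun l => (S.filter fun q => I q l).card)
  omega

lemma inc_le_mul {α β : Type*} (I : α → β → Prop) (S : Finset α) (R : Finset β) :
    inc I S R ≤ S.card * R.card := by
  classical
  unfold inc
  rw [← smul_eq_mul]
  exact Finset.sum_le_card_nsmul _ _ _ fun q _ => Finset.card_filter_le _ _

open Classical in
lemma inc_le_of_dichotomy {α β : Type*} {I : α → β → Prop} {S : Finset α} {T : Finset β}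
    (P : β → Prop) {m k : ℕ} (h1 : ∀ l ∈ T, ¬ P l → (S.filter fun q => I q l).card ≤ m)
    (h2 : ∀ q ∈ S, ∀ U ⊆ T, (∀ l ∈ U, I q l ∧ P l) → U.card ≤ k) :
    inc I S T ≤ m * T.card + k * S.card := by
  have hsplit : inc I S T ≤ inc I S (T.filter P) + inc I S (T.filter fun l => ¬ P l) := by
    have := inc_union_right I S (T.filter P) (T.filter fun l => ¬ P l)
    rwa [Finset.filter_union_filter_not_eq] at this
  have e1 : inc I S (T.filter P) ≤ k * S.card := by
    unfold inc
    rw [mul_comm, ← smul_eq_mul]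
    refine Finset.sum_le_card_nsmul _ _ _ fun q hq => ?_
    rw [Finset.filter_filter]
    exact h2 q hq _ (Finset.filter_subset _ _) fun l hl => (Finset.mem_filter.1 hl).2.symm
  have e2 : inc I S (T.filter fun l => ¬ P l) ≤ m * T.card := by
    rw [inc_comm]
    refine (Finset.sum_le_card_nsmul _ _ m fun l hl => ?_).trans ?_
    · exact h1 l (Finset.mem_filter.1 hl).1 (Finset.mem_filter.1 hl).2
    · rw [smul_eq_mul, mul_comm]
      exact Nat.mul_le_mul_left _ (Finset.card_filter_le _ _)
  omega

end Incidence

section Surface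

open Polynomial

variable {K : Type*} [Field K]

/-- The line with parameters `q` in direction `1` meets the line with parameters `l` in
direction `0`. -/
def Meet (q l : K × K × K) : Prop := l.2.1 * q.1 + l.2.2 = q.2.1 * l.1 + q.2.2

/-- No line `q ∈ S` is incident with more than `k` lines `l ∈ R` from any quadric
`y = α x x' + β x + γ x' + δ`. -/
def QuadricBound (I : K × K × K → K × K × K → Prop) (S R : Finset (K × K × K)) (k : ℕ) : Prop :=
  ∀ α β γ δ : K, ∀ q ∈ S, ∀ T ⊆ R,
    (∀ l ∈ T, I q l ∧ l.2.1 = α * l.1 + β ∧ l.2.2 = γ * l.1 + δ) → T.card ≤ k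

lemma QuadricBound.mono {I : K × K × K → K × K × K → Prop} {S S' R R' : Finset (K × K × K)}
    {k : ℕ} (h : QuadricBound I S R k) (hS : S' ⊆ S) (hR : R' ⊆ R) : QuadricBound I S' R' k :=
  fun α β γ δ q hq T hT => h α β γ δ q (hS hq) T (hT.trans hR)

lemma ParallelFibers.mono {L : Type*} {S S' : Finset (L × L × L)} (h : ParallelFibers S) (hS : S' ⊆ S) :
    ParallelFibers S' := fun q hq r hr => h q (hS hq) r (hS hr)

open Classical in
/-- A line outside a surface meets few lines of the surface. -/
lemma card_meet_le {I : K × K × K → K × K × K → Prop} (hI : ∀ q l, I q l → Meet q l)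
    {S : Finset (K × K × K)} (hS : ParallelFibers S) {G : MvPolynomial (Fin 3) K}
    (hG : ∀ q ∈ S, restr 1 q G = 0) {l : K × K × K} (hl : restr 0 l G ≠ 0) :
    (S.filter fun q => I q l).card ≤ G.totalDegree := by
  refine le_trans ?_ ((Multiset.toFinset_card_le _).trans ((card_roots' (restr 0 l G)).trans
    (natDegree_restr_le 0 l G)))
  refine Finset.card_le_card_of_injOn (fun q => q.1) ?_ ?_
  · intro q hq
    obtain ⟨hqS, hql⟩ := Finset.mem_filter.1 hq
    have hm := hI q l hql
    rw [Meet] at hm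
    simp only [Finset.mem_coe, Multiset.mem_toFinset, mem_roots hl, IsRoot.def]
    rw [eval_restr_zero, hm, ← eval_restr_one, hG q hqS, eval_zero]
  · intro q hq r hr hqr
    obtain ⟨hqS, hql⟩ := Finset.mem_filter.1 hq
    obtain ⟨hrS, hrl⟩ := Finset.mem_filter.1 hr
    have h1 := hI q l hql
    have h2 := hI r l hrl
    have h3 := hS q hqS r hrS hqr
    rw [Meet] at h1 h2
    simp only at hqr
    rw [hqr, h3] at h1
    exact Prod.ext hqr (Prod.ext h3 (by linear_combination h2 - h1))

/-- A surface independent of `y` which contains a line in each direction cannot be irreducible. -/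
lemma restr_zero_ne_zero_of_pderiv_eq_zero [Infinite K] {p : ℕ} [CharP K p]
    {F : MvPolynomial (Fin 3) K} (hF : Irreducible F) (hp : F.totalDegree < p)
    (hy : MvPolynomial.pderiv 2 F = 0) {q : K × K × K} (hq : restr 1 q F = 0) (l : K × K × K) :
    restr 0 l F ≠ 0 := by
  classical
  intro hl
  obtain ⟨c, m, b⟩ := l
  have hvars : (2 : Fin 3) ∉ F.vars := by
    rw [MvPolynomial.mem_vars_iff_mem_support]
    rintro ⟨e, he, he2⟩
    rw [Finsupp.mem_support_iff] at he2
    have hle : e 2 ≤ F.totalDegree := by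
      refine le_trans ?_ (MvPolynomial.degreeOf_le_totalDegree F 2)
      exact MvPolynomial.monomial_le_degreeOf 2 he
    have hc := congrArg (MvPolynomial.coeff (e - Finsupp.single 2 1)) hy
    rw [MvPolynomial.coeff_pderiv, MvPolynomial.coeff_zero, tsub_add_cancel_of_le (by
      rw [Finsupp.single_le_iff]; omega)] at hc
    refine (mul_eq_zero.1 hc).elim (MvPolynomial.mem_support_iff.1 he) fun h => ?_
    have h2 : (((e 2 : ℕ)) : K) = 0 := by
      rw [← h]
      simp only [Finsupp.coe_tsub, Pi.sub_apply, Finsupp.single_eq_same]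
      rw [← Nat.cast_succ]
      congr 1
      omega
    rw [CharP.cast_eq_zero_iff K p] at h2
    have := Nat.le_of_dvd (by omega) h2
    omega
  have hall : ∀ t, restr 0 (c, 0, t) F = 0 := by
    intro t
    rw [← hl]
    refine MvPolynomial.hom_congr_vars (f₁ := (restr 0 (c, 0, t)).toRingHom)
      (f₂ := (restr 0 (c, m, b)).toRingHom) ?_ ?_ rfl
    · ext; simp
    · intro i hi _
      have hi2 : i ≠ 2 := fun h => hvars (h ▸ hi)
      fin_cases i
      · simp [restr, lineCoord]
      · simp [restr, lineCoord]
      · exact absurd rfl hi2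
  obtain ⟨B, hB⟩ := Infinite.exists_subset_card_eq K (6 * F.totalDegree + 1)
  have hrestr : restr 1 q (MvPolynomial.X 1 - MvPolynomial.C c) = X - C c := by
    simp [restr, lineCoord, Polynomial.algebraMap_eq]
  have hH : (MvPolynomial.X 1 - MvPolynomial.C c : MvPolynomial (Fin 3) K) ≠ 0 := by
    intro h
    rw [h, map_zero] at hrestr
    exact X_sub_C_ne_zero c hrestr.symm
  have hnd : ¬ F ∣ MvPolynomial.X 1 - MvPolynomial.C c := by
    rintro ⟨k, hk⟩
    rw [hk, map_mul, hq, zero_mul] at hrestr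
    exact X_sub_C_ne_zero c hrestr.symm
  have hinj : Function.Injective (fun b : K => (c, (0 : K), b)) := fun a b h => by
    simpa using h
  have := card_common_lines_le (i := 0) (by decide) hF hH hnd
    (Λ := B.image fun b => (c, 0, b)) ?_ ?_ ?_
  · rw [Finset.card_image_of_injective _ hinj, hB] at this
    have h1 : (MvPolynomial.X 1 - MvPolynomial.C c : MvPolynomial (Fin 3) K).totalDegree ≤ 1 :=
      (MvPolynomial.totalDegree_sub_C_le _ _).trans (by simp)
    nlinarith
  · intro q hq r hr _
    simp only [Finset.mem_image] at hq hr
    obtain ⟨_, _, rfl⟩ := hq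
    obtain ⟨_, _, rfl⟩ := hr
    rfl
  · intro l hl
    simp only [Finset.mem_image] at hl
    obtain ⟨b, _, rfl⟩ := hl
    exact hall b
  · intro l hl
    simp only [Finset.mem_image] at hl
    obtain ⟨b, _, rfl⟩ := hl
    simp [restr, lineCoord, Polynomial.algebraMap_eq]

lemma exists_exceptional_lines_of_irreducible [Infinite K] {p : ℕ} [CharP K p]
    {F : MvPolynomial (Fin 3) K} (hF : Irreducible F) (hp : F.totalDegree < p)
    {I : K × K × K → K × K × K → Prop} (hI : ∀ q l, I q l → Meet q l)
    {S R : Finset (K × K × K)} (hS : ParallelFibers S) (hR : ParallelFibers R) {k : ℕ}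
    (hk : QuadricBound I S R k) (hSF : ∀ q ∈ S, restr 1 q F = 0) :
    ∃ R' ⊆ R, R'.card ≤ 18 * F.totalDegree ^ 2 ∧
      ∀ T ⊆ R, Disjoint T R' → inc I S T ≤ 3 * F.totalDegree * R.card + k * S.card := by
  classical
  set d := F.totalDegree
  have hout : ∀ l, restr 0 l F ≠ 0 → (S.filter fun q => I q l).card ≤ 3 * d := fun l hl =>
    (card_meet_le hI hS hSF hl).trans (by omega)
  have hfinal : ∀ T ⊆ R, inc I S T ≤ 3 * d * T.card + k * S.card →
      inc I S T ≤ 3 * d * R.card + k * S.card := fun T hT h =>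
    h.trans (Nat.add_le_add_right (Nat.mul_le_mul_left _ (Finset.card_le_card hT)) _)
  have hfinal' : ∀ T ⊆ R, (∀ l ∈ T, (S.filter fun q => I q l).card ≤ 3 * d) →
      inc I S T ≤ 3 * d * R.card + k * S.card := fun T hT h =>
    hfinal T hT (inc_le_of_dichotomy (fun _ => False) (fun l hl _ => h l hl)
      fun q _ U _ hU => by
        rw [Finset.eq_empty_of_forall_notMem fun l hl => (hU l hl).2]
        exact Nat.zero_le _)
  have hirr : ∀ T ⊆ R, (∀ l ∈ T, restr 0 l F = 0) → ∀ G, ¬ F ∣ G → G.totalDegree ≤ 3 * d →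
      (∀ l ∈ T, restr 0 l G = 0) → T.card ≤ 18 * d ^ 2 := by
    intro T hT hTF G hG hGd hTG
    have hG0 : G ≠ 0 := by rintro rfl; exact hG (dvd_zero _)
    have := card_common_lines_le (by decide) hF hG0 hG (hR.mono hT) hTF hTG
    calc _ ≤ _ := this
      _ ≤ 6 * d * (3 * d) := Nat.mul_le_mul_left _ hGd
      _ = _ := by ring
  by_cases h0 : F ∣ ruling 0 F
  swap
  · refine ⟨R.filter fun l => restr 0 l F = 0, Finset.filter_subset _ _, ?_, ?_⟩
    · refine hirr _ (Finset.filter_subset _ _) (fun l hl => (Finset.mem_filter.1 hl).2)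
        (ruling 0 F) h0 (totalDegree_ruling_le 0 F) fun l hl => ?_
      exact restr_ruling_eq_zero (by decide) l (Finset.mem_filter.1 hl).2
    · intro T hT hdisj
      refine hfinal' T hT fun l hl => hout l fun h => ?_
      exact Finset.disjoint_left.1 hdisj hl (Finset.mem_filter.2 ⟨hT hl, h⟩)
  by_cases h1 : F ∣ ruling 1 F
  swap
  · refine ⟨R.filter fun l => restr 0 l F = 0 ∧ restr 0 l (ruling 1 F) = 0,
      Finset.filter_subset _ _, ?_, ?_⟩
    · exact hirr _ (Finset.filter_subset _ _) (fun l hl => (Finset.mem_filter.1 hl).2.1)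
        (ruling 1 F) h1 (totalDegree_ruling_le 1 F) fun l hl => (Finset.mem_filter.1 hl).2.2
    · intro T hT hdisj
      refine hfinal' T hT fun l hl => ?_
      by_cases hlF : restr 0 l F = 0
      · have : restr 0 l (ruling 1 F) ≠ 0 := fun h =>
          Finset.disjoint_left.1 hdisj hl (Finset.mem_filter.2 ⟨hT hl, hlF, h⟩)
        exact (card_meet_le hI hS
          (fun q hq => restr_ruling_eq_zero (by decide) q (hSF q hq)) this).trans
          (totalDegree_ruling_le 1 F)
      · exact hout l hlF
  have hdy := totalDegree_pderiv_le 2 F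
  by_cases hy : F ∣ MvPolynomial.pderiv 2 F
  · have hy0 : MvPolynomial.pderiv 2 F = 0 := by
      by_contra hne
      have hle := MvPolynomial.totalDegree_le_of_dvd_of_isDomain hy hne
      have hd : F.totalDegree = 0 := by omega
      rw [MvPolynomial.totalDegree_eq_zero_iff_eq_C] at hd
      rw [hd, MvPolynomial.pderiv_C] at hne
      exact hne rfl
    refine ⟨∅, Finset.empty_subset _, by simp, fun T hT _ => ?_⟩
    rcases S.eq_empty_or_nonempty with rfl | ⟨q, hq⟩
    · simp [inc]
    · exact hfinal' T hT fun l _ => hout l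
        (restr_zero_ne_zero_of_pderiv_eq_zero hF hp hy0 (hSF q hq) l)
  · refine ⟨R.filter fun l => restr 0 l F = 0 ∧ restr 0 l (MvPolynomial.pderiv 2 F) = 0,
      Finset.filter_subset _ _, ?_, ?_⟩
    · exact hirr _ (Finset.filter_subset _ _) (fun l hl => (Finset.mem_filter.1 hl).2.1)
        _ hy (by omega) fun l hl => (Finset.mem_filter.1 hl).2.2
    · intro T hT hdisj
      by_cases hex : ∃ l ∈ T, restr 0 l F = 0
      · obtain ⟨l₀, hl₀, hl₀F⟩ := hex
        have hl₀y : restr 0 l₀ (MvPolynomial.pderiv 2 F) ≠ 0 := fun h =>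
          Finset.disjoint_left.1 hdisj hl₀ (Finset.mem_filter.2 ⟨hT hl₀, hl₀F, h⟩)
        obtain ⟨α, β, γ, δ, hquad⟩ := exists_quadric_of_dvd_ruling hF hp h0 h1 hl₀F hl₀y
        refine hfinal T hT (inc_le_of_dichotomy (fun l => restr 0 l F = 0)
          (fun l _ hl => hout l hl) fun q hq U hU hlU => ?_)
        exact hk α β γ δ q hq U (hU.trans hT) fun l hl => ⟨(hlU l hl).1, hquad l (hlU l hl).2⟩
      · push Not at hex
        exact hfinal' T hT fun l hl => hout l (hex l hl)

/-- For lines `S` on a surface `F = 0` all but few lines of `R` have few incidences with `S`. -/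
theorem exists_exceptional_lines [Infinite K] {p : ℕ} [CharP K p]
    {I : K × K × K → K × K × K → Prop} (hI : ∀ q l, I q l → Meet q l)
    {R : Finset (K × K × K)} (hR : ParallelFibers R) {k : ℕ}
    {F : MvPolynomial (Fin 3) K} (hF : F ≠ 0) (hp : F.totalDegree < p)
    {S : Finset (K × K × K)} (hS : ParallelFibers S)
    (hk : QuadricBound I S R k) (hSF : ∀ q ∈ S, restr 1 q F = 0) :
    ∃ R' ⊆ R, R'.card ≤ 18 * F.totalDegree ^ 2 ∧
      ∀ T ⊆ R, Disjoint T R' → inc I S T ≤ 3 * F.totalDegree * R.card + k * S.card := by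
  classical
  induction F using WfDvdMonoid.induction_on_irreducible generalizing S with
  | zero => exact absurd rfl hF
  | unit u hu =>
    have : S = ∅ := by
      rw [Finset.eq_empty_iff_forall_notMem]
      intro q hq
      exact (hu.map (restr 1 q)).ne_zero (hSF q hq)
    subst this
    exact ⟨∅, Finset.empty_subset _, by simp, fun T _ _ => by simp [inc]⟩
  | mul f g hf hg ih =>
    have hdeg : (g * f).totalDegree = g.totalDegree + f.totalDegree :=
      MvPolynomial.totalDegree_mul_of_isDomain hg.ne_zero hf
    rw [hdeg] at hp ⊢
    set S₁ := S.filter fun q => restr 1 q g = 0 with hS₁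
    set S₂ := S.filter fun q => ¬ restr 1 q g = 0 with hS₂
    have hsub₁ : S₁ ⊆ S := Finset.filter_subset _ _
    have hsub₂ : S₂ ⊆ S := Finset.filter_subset _ _
    obtain ⟨R₁, hR₁, hc₁, hi₁⟩ := exists_exceptional_lines_of_irreducible hg
      (lt_of_le_of_lt (Nat.le_add_right _ _) hp) hI (hS.mono hsub₁) hR
      (hk.mono hsub₁ subset_rfl) fun q hq => (Finset.mem_filter.1 hq).2
    obtain ⟨R₂, hR₂, hc₂, hi₂⟩ := ih hf (lt_of_le_of_lt (Nat.le_add_left _ _) hp)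
      (hS.mono hsub₂) (hk.mono hsub₂ subset_rfl) fun q hq => by
        obtain ⟨hqS, hqg⟩ := Finset.mem_filter.1 hq
        have := hSF q hqS
        rw [map_mul] at this
        exact (mul_eq_zero.1 this).resolve_left hqg
    refine ⟨R₁ ∪ R₂, Finset.union_subset hR₁ hR₂, ?_, fun T hT hdisj => ?_⟩
    · have := Finset.card_union_le R₁ R₂
      nlinarith [Nat.zero_le (g.totalDegree * f.totalDegree)]
    · rw [Finset.disjoint_union_right] at hdisj
      have e1 := hi₁ T hT hdisj.1
      have e2 := hi₂ T hT hdisj.2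
      have e3 : S₁ ∪ S₂ = S := Finset.filter_union_filter_not_eq _ _
      have e4 := inc_union_left I S₁ S₂ T
      rw [e3] at e4
      have e5 : S₁.card + S₂.card = S.card := Finset.card_filter_add_card_filter_not _
      rw [← e5]
      calc _ ≤ _ := e4
        _ ≤ _ := add_le_add e1 e2
        _ = _ := by ring

end Surface

section Recursion

lemma le_mul_of_subadditive {α : Type*} [DecidableEq α] {g : Finset α → ℝ} {B : ℝ} {s : ℕ}
    (g0 : g ∅ = 0) (hg : ∀ S T, g (S ∪ T) ≤ g S + g T) (M : ℕ) (S : Finset α)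
    (hB : ∀ T ⊆ S, T.card ≤ s → g T ≤ B) (hS : S.card ≤ M * s) : g S ≤ M * B := by
  induction M generalizing S with
  | zero =>
    have : S = ∅ := by simpa using hS
    simp [this, g0]
  | succ M ih =>
    obtain ⟨T, hTS, hT⟩ := Finset.exists_subset_card_eq (min_le_right s S.card)
    have h1 := hB T hTS (by omega)
    have h2 : (S \ T).card ≤ M * s := by
      rw [Finset.card_sdiff_of_subset hTS, hT]
      rw [Nat.succ_mul] at hS
      omega
    have h3 := ih (S \ T) (fun U hU => hB U (hU.trans Finset.sdiff_subset)) h2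
    have h4 := hg T (S \ T)
    rw [Finset.union_sdiff_of_subset hTS] at h4
    push_cast
    linarith

variable {K : Type*} [Field K]

lemma inc_le_of_small_scale [Infinite K] {p : ℕ} [CharP K p]
    {I : K × K × K → K × K × K → Prop} (hI : ∀ q l, I q l → Meet q l) {k M s N : ℕ} {B : ℝ}
    {S R : Finset (K × K × K)} (hS : ParallelFibers S) (hR : ParallelFibers R)
    (hk : QuadricBound I S R k) (hSc : S.card ≤ M * s) (hRc : R.card ≤ N)
    (hp : 27 * s < p ^ 2)
    (hB : ∀ S' ⊆ S, ∀ R' ⊆ R, S'.card ≤ s → R'.card ≤ s → (inc I S' R' : ℝ) ≤ B) {D : ℕ}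
    (hD : 27 * s ≤ D ^ 2) :
    (inc I S R : ℝ) ≤ M * (3 * D * N + k * s + 486 * B) := by
  classical
  refine le_mul_of_subadditive (g := fun S => (inc I S R : ℝ)) (s := s) (by simp [inc])
    (fun S T => by exact_mod_cast inc_union_left I S T R) M S (fun T hTS hT => ?_) hSc
  obtain ⟨F, hF, hFd, hTF⟩ := exists_surface_through (i := 1) T
  have hFp : F.totalDegree < p := by
    refine lt_of_pow_lt_pow_left₀ 2 (Nat.zero_le _) ?_
    omega
  have hFD : F.totalDegree ≤ D := by
    refine (Nat.pow_le_pow_iff_left two_ne_zero).1 ?_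
    omega
  obtain ⟨R', hR', hR'c, hinc⟩ := exists_exceptional_lines hI hR hF hFp (hS.mono hTS)
    (hk.mono hTS subset_rfl) hTF
  have h1 := hinc (R \ R') Finset.sdiff_subset Finset.sdiff_disjoint
  have h2 : (inc I T R' : ℝ) ≤ (486 : ℕ) * B := by
    refine le_mul_of_subadditive (g := fun R => (inc I T R : ℝ)) (s := s) ?_
      (fun S U => by exact_mod_cast inc_union_right I T S U) 486 R' (fun U hU hUc => ?_) (by omega)
    · simp [inc]
    · exact hB T hTS U (hU.trans hR') hT hUc
  have h3 : inc I T R ≤ inc I T (R \ R') + inc I T R' := by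
    have := inc_union_right I T (R \ R') R'
    rwa [Finset.sdiff_union_of_subset hR'] at this
  have h4 : 3 * F.totalDegree * R.card + k * T.card ≤ 3 * D * N + k * s := by gcongr
  have h5 : (inc I T R : ℝ) ≤ inc I T (R \ R') + inc I T R' := by exact_mod_cast h3
  have h6 : (inc I T (R \ R') : ℝ) ≤ 3 * D * N + k * s := by exact_mod_cast h1.trans h4
  push_cast at h2
  linarith

/-- Incidence bound at the scales `972 ^ (4 * j)`. -/
lemma inc_le_of_pow_scale [Infinite K] {p : ℕ} [CharP K p]
    {I : K × K × K → K × K × K → Prop} (hI : ∀ q l, I q l → Meet q l) {k : ℕ} {κ : ℝ}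
    (hκ : 0 ≤ κ) (hkκ : κ ^ 4 = k) (j : ℕ) (hp : 27 * (972 ^ (4 * j) : ℕ) < 972 ^ 4 * p ^ 2)
    {S R : Finset (K × K × K)} (hS : ParallelFibers S) (hR : ParallelFibers R)
    (hk : QuadricBound I S R k) (hSc : S.card ≤ 972 ^ (4 * j)) (hRc : R.card ≤ 972 ^ (4 * j)) :
    (inc I S R : ℝ) ≤ 36 * 972 ^ 2 * (972 ^ (6 * j) + κ ^ 3 * 972 ^ (5 * j)) := by
  induction j generalizing S R with
  | zero =>
    have h1 := inc_le_mul I S R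
    simp only [mul_zero, pow_zero] at hSc hRc ⊢
    have h2 : inc I S R ≤ 1 := h1.trans (by nlinarith)
    have h3 : (inc I S R : ℝ) ≤ 1 := by exact_mod_cast h2
    have : 0 ≤ κ ^ 3 := by positivity
    nlinarith
  | succ j ih =>
    set t : ℝ := 972 ^ j with ht
    have ht0 : 0 < t := by positivity
    have e4 : (972 : ℝ) ^ (4 * j) = t ^ 4 := by rw [ht, ← pow_mul, mul_comm]
    have e5 : (972 : ℝ) ^ (5 * j) = t ^ 5 := by rw [ht, ← pow_mul, mul_comm]
    have e6 : (972 : ℝ) ^ (6 * j) = t ^ 6 := by rw [ht, ← pow_mul, mul_comm]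
    have e4' : (972 : ℝ) ^ (4 * (j + 1)) = 972 ^ 4 * t ^ 4 := by rw [mul_add, pow_add, e4]; ring
    have e5' : (972 : ℝ) ^ (5 * (j + 1)) = 972 ^ 5 * t ^ 5 := by rw [mul_add, pow_add, e5]; ring
    have e6' : (972 : ℝ) ^ (6 * (j + 1)) = 972 ^ 6 * t ^ 6 := by rw [mul_add, pow_add, e6]; ring
    rw [e5', e6']
    rcases le_total κ (972 * t) with hle | hge
    · have hp' : 27 * 972 ^ (4 * j) < p ^ 2 := by
        rw [mul_add, pow_add] at hp
        have : 972 ^ 4 * (27 * 972 ^ (4 * j)) < 972 ^ 4 * p ^ 2 := by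
          calc _ = 27 * (972 ^ (4 * j) * 972 ^ (4 * 1)) := by ring
            _ < _ := hp
        exact lt_of_mul_lt_mul_left this (Nat.zero_le _)
      have hp'' : 27 * (972 ^ (4 * j) : ℕ) < 972 ^ 4 * p ^ 2 := by
        nlinarith [Nat.zero_le (p ^ 2)]
      have hstep := inc_le_of_small_scale (p := p) hI (k := k) (M := 972 ^ 4) (s := 972 ^ (4 * j))
        (N := 972 ^ (4 * (j + 1))) (B := 36 * 972 ^ 2 * (t ^ 6 + κ ^ 3 * t ^ 5))
        hS hR hk (by rw [← pow_add]; convert hSc using 2; ring) hRc hp' (by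
          intro S' hS' R' hR' hc hc'
          have := ih hp'' (hS.mono hS') (hR.mono hR') (hk.mono hS' hR') hc hc'
          rwa [e5, e6] at this) (D := 6 * 972 ^ (2 * j)) (by
            have : (972 : ℕ) ^ (4 * j) = (972 ^ (2 * j)) ^ 2 := by rw [← pow_mul]; congr 1; ring
            rw [this, mul_pow]
            exact Nat.mul_le_mul_right _ (by norm_num))
      refine hstep.trans ?_
      have e2 : (972 : ℝ) ^ (2 * j) = t ^ 2 := by rw [ht, ← pow_mul, mul_comm]
      push_cast
      rw [e4, e4', e2, ← hkκ]
      have hκ4 : κ ^ 4 ≤ κ ^ 3 * (972 * t) := by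
        rw [pow_succ]; exact mul_le_mul_of_nonneg_left hle (by positivity)
      have h7 : κ ^ 4 * t ^ 4 ≤ κ ^ 3 * (972 * t) * t ^ 4 :=
        mul_le_mul_of_nonneg_right hκ4 (by positivity)
      have h8 : 0 ≤ κ ^ 3 * t ^ 5 := by positivity
      have h9 : 0 < t ^ 6 := by positivity
      ring_nf at h7 ⊢
      nlinarith
    · have h1 : (inc I S R : ℝ) ≤ 972 ^ (4 * (j + 1)) * 972 ^ (4 * (j + 1)) := by
        exact_mod_cast (inc_le_mul I S R).trans (Nat.mul_le_mul hSc hRc)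
      rw [e4'] at h1
      refine h1.trans ?_
      have h2 : (972 * t) ^ 3 ≤ κ ^ 3 := pow_le_pow_left₀ (by positivity) hge 3
      have h3 : (972 * t) ^ 3 * (972 ^ 5 * t ^ 5) ≤ κ ^ 3 * (972 ^ 5 * t ^ 5) :=
        mul_le_mul_of_nonneg_right h2 (by positivity)
      have h4 : 0 ≤ 972 ^ 6 * t ^ 6 := by positivity
      have h5 : 0 ≤ κ ^ 3 * (972 ^ 5 * t ^ 5) := by positivity
      nlinarith

/-- Incidences between two families of lines in three-space, one in each ruling direction, with
few incidences on any quadric. -/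
theorem inc_le_of_quadricBound [Infinite K] {p : ℕ} [CharP K p]
    {I : K × K × K → K × K × K → Prop} (hI : ∀ q l, I q l → Meet q l) {k : ℕ} {κ ν : ℝ}
    (hκ : 0 ≤ κ) (hkκ : κ ^ 4 = k) (hν : 1 ≤ ν)
    {S R : Finset (K × K × K)} (hS : ParallelFibers S) (hR : ParallelFibers R)
    (hk : QuadricBound I S R k) (hp : 27 * ν ^ 4 < p ^ 2) (hSc : (S.card : ℝ) ≤ ν ^ 4)
    (hRc : (R.card : ℝ) ≤ ν ^ 4) :
    (inc I S R : ℝ) ≤ 36 * 972 ^ 8 * (ν ^ 6 + κ ^ 3 * ν ^ 5) := by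
  obtain ⟨j, hj1, hj2⟩ : ∃ j : ℕ, ν ≤ 972 ^ j ∧ (972 : ℝ) ^ j ≤ 972 * ν := by
    obtain ⟨j, hj1, hj2⟩ := exists_nat_pow_near hν (by norm_num : (1 : ℝ) < 972)
    exact ⟨j + 1, hj2.le, by rw [pow_succ]; linarith⟩
  set t : ℝ := 972 ^ j with ht
  have ht0 : 0 < t := by positivity
  have e4 : (972 : ℝ) ^ (4 * j) = t ^ 4 := by rw [ht, ← pow_mul, mul_comm]
  have e5 : (972 : ℝ) ^ (5 * j) = t ^ 5 := by rw [ht, ← pow_mul, mul_comm]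
  have e6 : (972 : ℝ) ^ (6 * j) = t ^ 6 := by rw [ht, ← pow_mul, mul_comm]
  have hν4 : ν ^ 4 ≤ t ^ 4 := pow_le_pow_left₀ (by linarith) hj1 4
  have ht4 : t ^ 4 ≤ (972 * ν) ^ 4 := pow_le_pow_left₀ ht0.le hj2 4
  have ht5 : t ^ 5 ≤ (972 * ν) ^ 5 := pow_le_pow_left₀ ht0.le hj2 5
  have ht6 : t ^ 6 ≤ (972 * ν) ^ 6 := pow_le_pow_left₀ ht0.le hj2 6
  have key := inc_le_of_pow_scale (p := p) hI hκ hkκ j ?_ hS hR hk ?_ ?_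
  · rw [e5, e6] at key
    refine key.trans ?_
    have h1 : κ ^ 3 * t ^ 5 ≤ κ ^ 3 * (972 * ν) ^ 5 :=
      mul_le_mul_of_nonneg_left ht5 (by positivity)
    have h2 : 0 ≤ κ ^ 3 * ν ^ 5 := by positivity
    calc (36 * 972 ^ 2 * (t ^ 6 + κ ^ 3 * t ^ 5) : ℝ)
        ≤ 36 * 972 ^ 2 * ((972 * ν) ^ 6 + κ ^ 3 * (972 * ν) ^ 5) := by gcongr
      _ ≤ _ := by ring_nf at h2 ⊢; nlinarith
  · have : (27 * 972 ^ (4 * j) : ℝ) < 972 ^ 4 * p ^ 2 := by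
      rw [e4]
      have : (972 * ν) ^ 4 = 972 ^ 4 * ν ^ 4 := by ring
      linarith
    exact_mod_cast this
  · have : (S.card : ℝ) ≤ 972 ^ (4 * j) := by rw [e4]; linarith
    exact_mod_cast this
  · have : (R.card : ℝ) ≤ 972 ^ (4 * j) := by rw [e4]; linarith
    exact_mod_cast this

end Recursion

section Cartesian

variable {p : ℕ} [Fact p.Prime]

/-- The point `z` lies on the line `y = m x + b` with parameters `l = (m, b)`. -/
def OnGraph (z l : ZMod p × ZMod p) : Prop := l.1 * z.1 + l.2 = z.2

lemma eq_and_eq_of_add_mul_eq {F K : Type*} [Field F] [Field K] [Algebra F K] {s : K}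
    (hs : s ∉ Set.range (algebraMap F K)) {a a' m m' : F}
    (h : algebraMap F K a + s * algebraMap F K m = algebraMap F K a' + s * algebraMap F K m') :
    a = a' ∧ m = m' := by
  have hm : m = m' := by
    by_contra hm
    have hm' : algebraMap F K (m - m') ≠ 0 := by simpa [sub_eq_zero] using hm
    refine hs ⟨(a' - a) / (m - m'), ?_⟩
    rw [map_div₀, div_eq_iff hm', map_sub, map_sub]
    linear_combination -h
  subst hm
  exact ⟨(algebraMap F K).injective (by linear_combination h), rfl⟩

lemma exists_infinite_extension (p : ℕ) [Fact p.Prime] :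
    ∃ (K : Type) (_ : Field K) (_ : Algebra (ZMod p) K) (_ : Infinite K) (_ : CharP K p) (s : K),
      s ∉ Set.range (algebraMap (ZMod p) K) := by
  refine ⟨AlgebraicClosure (ZMod p), inferInstance, inferInstance, inferInstance,
    charP_of_injective_algebraMap (algebraMap (ZMod p) _).injective p, ?_⟩
  by_contra! h
  have hfin : (Set.univ : Set (AlgebraicClosure (ZMod p))).Finite :=
    (Set.finite_range _).subset fun x _ => h x
  exact Set.infinite_univ hfin

open Classical in
/-- The square of the number of incidences is bounded by the number of pairs of incidences at
the same height. -/
lemma inc_sq_le_card_image_snd (P L : Finset (ZMod p × ZMod p)) :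
    inc OnGraph P L ^ 2 ≤ (P.image Prod.snd).card *
      (((P ×ˢ L) ×ˢ (P ×ˢ L)).filter fun e => OnGraph e.1.1 e.1.2 ∧ OnGraph e.2.1 e.2.2 ∧
        e.1.1.2 = e.2.1.2).card := by
  set D := (P ×ˢ L).filter fun d => OnGraph d.1 d.2 with hD
  have h1 : inc OnGraph P L = D.card := by
    rw [hD, Finset.card_filter, Finset.sum_product, inc]
    simp only [Finset.card_filter]
  have h2 : D.card = ∑ y ∈ P.image Prod.snd, (D.filter fun d => d.1.2 = y).card := by
    refine Finset.card_eq_sum_card_fiberwise fun d hd => ?_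
    have := (Finset.mem_product.1 (Finset.mem_filter.1 hd).1).1
    exact Finset.mem_coe.2 (Finset.mem_image_of_mem _ this)
  rw [h1, h2]
  refine sq_sum_le_card_mul_sum_sq.trans (Nat.mul_le_mul_left _ ?_)
  rw [Finset.card_eq_sum_card_fiberwise (f := fun e => e.1.1.2) (t := P.image Prod.snd)]
  · refine Finset.sum_le_sum fun y _ => ?_
    rw [sq, ← Finset.card_product]
    refine Finset.card_le_card fun e he => ?_
    simp only [hD, Finset.mem_product, Finset.mem_filter] at he ⊢
    obtain ⟨⟨⟨h1, h2⟩, h3⟩, ⟨h4, h5⟩, h6⟩ := he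
    exact ⟨⟨⟨h1, h4⟩, h2, h5, h3.trans h6.symm⟩, h3⟩
  · intro e he
    have := (Finset.mem_product.1 (Finset.mem_product.1 (Finset.mem_filter.1 he).1).1).1
    exact Finset.mem_coe.2 (Finset.mem_image_of_mem _ this)

open Classical in
/-- Incidences between lines and a point set with few distinct coordinates. -/
theorem inc_onGraph_sq_le {P L : Finset (ZMod p × ZMod p)} {k : ℕ} {κ ν : ℝ}
    (hA : (P.image Prod.fst).card ≤ k) (hdeg : ∀ z ∈ P, (L.filter (OnGraph z)).card ≤ k)
    (hκ : 0 ≤ κ) (hkκ : κ ^ 4 = k) (hν : 1 ≤ ν) (hkL : (k * L.card : ℝ) ≤ ν ^ 4)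
    (hp : 27 * ν ^ 4 < p ^ 2) :
    (inc OnGraph P L : ℝ) ^ 2 ≤
      (P.image Prod.snd).card * (36 * 972 ^ 8 * (ν ^ 6 + κ ^ 3 * ν ^ 5)) := by
  obtain ⟨K, _, _, _, _, s, hs⟩ := exists_infinite_extension p
  let i : ZMod p →+* K := algebraMap (ZMod p) K
  have hinj : Function.Injective i := i.injective
  let φ : ZMod p × (ZMod p × ZMod p) → K × K × K := fun e => (i e.1 + s * i e.2.1, i e.2.1, i e.2.2)
  have hφ : Function.Injective φ := by
    rintro ⟨a, m, b⟩ ⟨a', m', b'⟩ h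
    simp only [φ, Prod.mk.injEq] at h
    obtain ⟨h1, h2⟩ := eq_and_eq_of_add_mul_eq hs h.1
    rw [h1, h2, hinj h.2.2]
  set S : Finset (K × K × K) := (P.image Prod.fst ×ˢ L).image φ with hS
  have hSP : ParallelFibers S := by
    intro q hq r hr hqr
    obtain ⟨⟨a, m, b⟩, -, rfl⟩ := Finset.mem_image.1 hq
    obtain ⟨⟨a', m', b'⟩, -, rfl⟩ := Finset.mem_image.1 hr
    exact congrArg i (eq_and_eq_of_add_mul_eq hs hqr).2
  let I : K × K × K → K × K × K → Prop := fun q l => ∃ z ∈ P, ∃ w ∈ P, ∃ u ∈ L, ∃ v ∈ L,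
    q = φ (z.1, v) ∧ l = φ (w.1, u) ∧ OnGraph z u ∧ OnGraph w v ∧ z.2 = w.2
  have hI : ∀ q l, I q l → Meet q l := by
    rintro q l ⟨z, -, w, -, u, -, v, -, rfl, rfl, h1, h2, h3⟩
    have : u.1 * z.1 + u.2 = v.1 * w.1 + v.2 := h1.trans (h3.trans h2.symm)
    have : i (u.1 * z.1 + u.2) = i (v.1 * w.1 + v.2) := by rw [this]
    simp only [map_add, map_mul] at this
    simp only [Meet, φ]
    linear_combination this
  have hQ : QuadricBound I S S k := by
    intro α β γ δ q hq T hT hl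
    by_cases hαs : α * s = 1
    · rcases T.eq_empty_or_nonempty with rfl | ⟨l₀, hl₀⟩
      · simp
      obtain ⟨⟨z, hz, w, hw, u, hu, v, hv, hqe, rfl, hzu, hwv, hzw⟩, hl1, -⟩ := hl l₀ hl₀
      refine le_trans ?_ (hdeg z hz)
      rw [← Finset.card_image_of_injective (L.filter (OnGraph z))
        (f := fun u => φ (w.1, u)) (fun u u' h => (Prod.mk.inj (hφ h)).2)]
      refine Finset.card_le_card fun l hlT => ?_
      obtain ⟨⟨z', hz', w', hw', u', hu', v', hv', hqe', rfl, hzu', hwv', hzw'⟩, hl1', -⟩ := hl l hlT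
      have e1 := hφ (hqe.symm.trans hqe')
      obtain ⟨e1, e2⟩ := Prod.mk.inj e1
      have e3 : w'.1 = w.1 := by
        apply hinj
        have hα : α ≠ 0 := by rintro rfl; simp at hαs
        simp only [φ] at hl1 hl1'
        apply mul_left_cancel₀ hα
        linear_combination hl1 - hl1' + (i u.1 - i u'.1) * hαs
      have e4 : z' = z := by
        refine Prod.ext e1.symm ?_
        rw [hzw', hzw, ← hwv', ← hwv, e2, e3]
      refine Finset.mem_image.2 ⟨u', Finset.mem_filter.2 ⟨hu', e4 ▸ hzu'⟩, ?_⟩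
      simp only [e3]
    · refine le_trans ?_ hA
      have hne : (1 - α * s) ≠ 0 := fun h => hαs (by linear_combination -h)
      refine le_trans (Finset.card_le_card (t := (P.image Prod.fst).image fun a =>
        ((i a + s * ((α * i a + β) / (1 - α * s)), (α * i a + β) / (1 - α * s),
          γ * (i a + s * ((α * i a + β) / (1 - α * s))) + δ) : K × K × K)) ?_)
        Finset.card_image_le
      intro l hlT
      obtain ⟨⟨z, hz, w, hw, u, hu, v, hv, hqe, rfl, hzu, hwv, hzw⟩, hl1, hl2⟩ := hl l hlT
      refine Finset.mem_image.2 ⟨w.1, Finset.mem_image_of_mem _ hw, ?_⟩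
      simp only [φ] at hl1 hl2 ⊢
      have e1 : (α * i w.1 + β) / (1 - α * s) = i u.1 := by
        rw [div_eq_iff hne]
        linear_combination -hl1
      rw [e1, hl2]
  have hSc : (S.card : ℝ) ≤ ν ^ 4 := by
    refine le_trans ?_ hkL
    rw [hS, Finset.card_image_of_injective _ hφ, Finset.card_product]
    push_cast
    gcongr
  have key := inc_le_of_quadricBound (p := p) hI hκ hkκ hν hSP hSP hQ hp hSc hSc
  have h1 : (((P ×ˢ L) ×ˢ (P ×ˢ L)).filter fun e => OnGraph e.1.1 e.1.2 ∧ OnGraph e.2.1 e.2.2 ∧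
        e.1.1.2 = e.2.1.2).card ≤ inc I S S := by
    have h2 : inc I S S = ((S ×ˢ S).filter fun e => I e.1 e.2).card := by
      rw [Finset.card_filter, Finset.sum_product, inc]
      simp only [Finset.card_filter]
      exact Finset.sum_congr rfl fun _ _ => Finset.sum_congr rfl fun _ _ => by congr
    rw [h2]
    refine Finset.card_le_card_of_injOn
      (fun e => (φ (e.1.1.1, e.2.2), φ (e.2.1.1, e.1.2))) ?_ ?_
    · rintro ⟨⟨z, u⟩, w, v⟩ he
      simp only [Finset.coe_filter, Finset.mem_product, Set.mem_ofPred_eq] at he ⊢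
      obtain ⟨⟨⟨hz, hu⟩, hw, hv⟩, h1, h2, h3⟩ := he
      refine ⟨⟨Finset.mem_image_of_mem _ (Finset.mem_product.2 ⟨Finset.mem_image_of_mem _ hz, hv⟩),
        Finset.mem_image_of_mem _ (Finset.mem_product.2 ⟨Finset.mem_image_of_mem _ hw, hu⟩)⟩,
        z, hz, w, hw, u, hu, v, hv, rfl, rfl, h1, h2, h3⟩
    · rintro ⟨⟨z, u⟩, w, v⟩ he ⟨⟨z', u'⟩, w', v'⟩ he' h
      simp only [Finset.coe_filter, Finset.mem_product, Set.mem_ofPred_eq] at he he'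
      obtain ⟨-, h1, h2, h3⟩ := he
      obtain ⟨-, h1', h2', h3'⟩ := he'
      obtain ⟨f1, f2⟩ := Prod.mk.inj h
      obtain ⟨e1, e3⟩ := Prod.mk.inj (hφ f1)
      obtain ⟨e2, e4⟩ := Prod.mk.inj (hφ f2)
      simp only at e1 e2 e3 e4
      subst e3 e4
      have e5 : z = z' := Prod.ext e1 (by rw [← h1, ← h1', e1])
      have e6 : w = w' := Prod.ext e2 (by rw [← h2, ← h2', e2])
      rw [e5, e6]
  have h3 := inc_sq_le_card_image_snd P L
  have h4 : (inc OnGraph P L : ℝ) ^ 2 ≤ (P.image Prod.snd).card * (inc I S S : ℝ) := by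
    exact_mod_cast h3.trans (Nat.mul_le_mul_left _ h1)
  exact h4.trans (mul_le_mul_of_nonneg_left key (Nat.cast_nonneg _))

end Cartesian

section LinearSpace

variable {α β : Type*} {I : α → β → Prop}

open Classical in
lemma sum_sq_card_le {S : Finset α} {R : Finset β}
    (hI : ∀ a ∈ S, ∀ a' ∈ S, a ≠ a' → ∀ b ∈ R, ∀ b' ∈ R, I a b → I a' b → I a b' → I a' b' →
      b = b') :
    ∑ b ∈ R, (S.filter fun a => I a b).card ^ 2 ≤ inc I S R + S.card ^ 2 := by
  have h1 : ∀ b ∈ R, (S.filter fun a => I a b).card ^ 2 =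
      ((S ×ˢ S).filter fun e => I e.1 b ∧ I e.2 b).card := by
    intro b _
    rw [sq, ← Finset.card_product]
    congr 1
    ext e
    simp only [Finset.mem_product, Finset.mem_filter]
    tauto
  rw [Finset.sum_congr rfl h1]
  have h2 := Finset.sum_card_bipartiteAbove_eq_sum_card_bipartiteBelow (s := S ×ˢ S) (t := R)
    (fun (e : α × α) b => I e.1 b ∧ I e.2 b)
  simp only [Finset.bipartiteAbove, Finset.bipartiteBelow] at h2
  rw [← h2]
  have h3 : ∀ e ∈ S ×ˢ S, (R.filter fun b => I e.1 b ∧ I e.2 b).card ≤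
      (if e.1 = e.2 then (R.filter (I e.1)).card else 0) + 1 := by
    rintro ⟨a, a'⟩ he
    obtain ⟨ha, ha'⟩ := Finset.mem_product.1 he
    by_cases haa : a = a'
    · subst haa
      simp
    · simp only [haa, if_false, zero_add]
      refine Finset.card_le_one.2 fun b hb b' hb' => ?_
      simp only [Finset.mem_filter] at hb hb'
      exact hI a ha a' ha' haa b hb.1 b' hb'.1 hb.2.1 hb.2.2 hb'.2.1 hb'.2.2
  refine (Finset.sum_le_sum h3).trans ?_
  rw [Finset.sum_add_distrib, Finset.sum_const, Finset.card_product, smul_eq_mul, mul_one, ← sq]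
  refine Nat.add_le_add_right ?_ _
  rw [Finset.sum_product, inc]
  refine Finset.sum_le_sum fun a ha => ?_
  rw [Finset.sum_ite_eq, if_pos ha]

lemma inc_sq_le {S : Finset α} {R : Finset β}
    (hI : ∀ a ∈ S, ∀ a' ∈ S, a ≠ a' → ∀ b ∈ R, ∀ b' ∈ R, I a b → I a' b → I a b' → I a' b' →
      b = b') :
    inc I S R ^ 2 ≤ R.card * (inc I S R + S.card ^ 2) := by
  classical
  conv_lhs => rw [inc_comm]
  exact sq_sum_le_card_mul_sum_sq.trans (Nat.mul_le_mul_left _ (sum_sq_card_le hI))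

lemma mul_le_inc {S : Finset α} {R : Finset β} {r : ℕ} [∀ a, DecidablePred (I a)]
    (h : ∀ a ∈ S, r ≤ (R.filter (I a)).card) : r * S.card ≤ inc I S R := by
  rw [mul_comm, ← smul_eq_mul]
  unfold inc
  refine Finset.card_nsmul_le_sum _ _ _ fun a ha => ?_
  exact (h a ha).trans (le_of_eq (by congr))

open Classical in
/-- Many points `w` see the same two points along two different rich lines. -/
lemma exists_pair_of_rich {S : Finset α} {R : Finset β}
    (hI : ∀ a ∈ S, ∀ a' ∈ S, a ≠ a' → ∀ b ∈ R, ∀ b' ∈ R, I a b → I a' b → I a b' → I a' b' →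
      b = b') {r : ℕ} (hr : 4 ≤ r) (hS : S.Nonempty) (hrich : 4 * R.card ≤ r * S.card)
    (hdeg : ∀ a ∈ S, r ≤ (R.filter (I a)).card) :
    ∃ v ∈ S, ∃ v' ∈ S, v ≠ v' ∧ ∃ W ⊆ S, r ^ 4 * S.card ≤ 128 * R.card ^ 2 * W.card ∧
      ∀ w ∈ W, w ≠ v ∧ w ≠ v' ∧ ∃ l ∈ R, ∃ l' ∈ R, l ≠ l' ∧ I w l ∧ I w l' ∧ I v l ∧ I v' l' := by
  set m := S.card with hm
  set n := R.card with hn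
  have hm0 : 0 < m := Finset.card_pos.2 hS
  have hn0 : 0 < n := by
    obtain ⟨a, ha⟩ := hS
    have := (hdeg a ha).trans (Finset.card_filter_le _ _)
    omega
  have hnR : (0 : ℝ) < n := by exact_mod_cast hn0
  have hmR : (0 : ℝ) < m := by exact_mod_cast hm0
  have hrR : (4 : ℝ) ≤ r := by exact_mod_cast hr
  have hrichR : (4 * n : ℝ) ≤ r * m := by exact_mod_cast hrich
  set cnt : β → ℕ := fun b => (S.filter fun a => I a b).card with hcnt
  set R' := R.filter fun b => r * m ≤ 2 * n * cnt b with hR'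
  have hR'R : R' ⊆ R := Finset.filter_subset _ _
  set τ : ℝ := r * m / (4 * n) with hτ
  have hτ1 : 1 ≤ τ := by rw [hτ, le_div_iff₀ (by positivity)]; linarith
  have hcntτ : ∀ b ∈ R', τ ≤ (cnt b : ℝ) - 1 := by
    intro b hb
    have h1 : (r * m : ℝ) ≤ 2 * n * cnt b := by exact_mod_cast (Finset.mem_filter.1 hb).2
    have h2 : τ * 2 ≤ cnt b := by
      rw [hτ, div_mul_eq_mul_div, div_le_iff₀ (by positivity)]
      linarith
    linarith
  set d : α → ℕ := fun a => (R'.filter (I a)).card with hd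
  have hJ : (r * m : ℝ) / 2 ≤ ∑ a ∈ S, (d a : ℝ) := by
    have h1 : r * m ≤ inc I S R := mul_le_inc hdeg
    have h2 : inc I S R ≤ inc I S R' + inc I S (R \ R') := by
      have := inc_union_right I S R' (R \ R')
      rwa [Finset.union_sdiff_of_subset hR'R] at this
    have h3 : (inc I S R' : ℝ) = ∑ a ∈ S, (d a : ℝ) := by
      rw [inc]; push_cast; rfl
    have h4 : (2 * n * inc I S (R \ R') : ℕ) ≤ n * (r * m) := by
      rw [inc_comm, Finset.mul_sum]
      calc _ ≤ (R \ R').card • (r * m) := by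
            refine Finset.sum_le_card_nsmul _ _ _ fun b hb => ?_
            obtain ⟨hb1, hb2⟩ := Finset.mem_sdiff.1 hb
            by_contra hcon
            exact hb2 (Finset.mem_filter.2 ⟨hb1, (not_le.1 hcon).le⟩)
        _ ≤ n * (r * m) := Nat.mul_le_mul_right _ (Finset.card_le_card Finset.sdiff_subset)
    have h5 : 2 * inc I S (R \ R') ≤ r * m :=
      le_of_mul_le_mul_left (by linarith) hn0
    have h6 : (r * m : ℝ) ≤ inc I S R' + inc I S (R \ R') := by exact_mod_cast h1.trans h2
    have h7 : (2 * inc I S (R \ R') : ℝ) ≤ r * m := by exact_mod_cast h5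
    rw [h3] at h6
    linarith
  set good : α → α × α → Prop := fun w v => w ≠ v.1 ∧ w ≠ v.2 ∧
    ∃ l ∈ R, ∃ l' ∈ R, l ≠ l' ∧ I w l ∧ I w l' ∧ I v.1 l ∧ I v.2 l' with hgood
  have hlow : ∀ w ∈ S, ((d w : ℝ) ^ 2 - d w) * τ ^ 2 ≤
      (((S ×ˢ S).filter fun v => good w v).card : ℝ) := by
    intro w hw
    set B := (R'.filter (I w)).offDiag with hB
    have hsub : (B.biUnion fun e => ((S.filter fun a => I a e.1).erase w) ×ˢ
        ((S.filter fun a => I a e.2).erase w)) ⊆ (S ×ˢ S).filter fun v => good w v := by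
      intro v hv
      simp only [hB, Finset.mem_biUnion, Finset.mem_offDiag, Finset.mem_filter, Finset.mem_product,
        Finset.mem_erase] at hv ⊢
      obtain ⟨e, ⟨⟨h1, h2⟩, ⟨h3, h4⟩, h5⟩, ⟨h6, h7, h8⟩, h9, h10, h11⟩ := hv
      exact ⟨⟨h7, h10⟩, Ne.symm h6, Ne.symm h9, e.1, hR'R h1, e.2, hR'R h3, h5, h2, h4, h8, h11⟩
    have hcard := Finset.card_le_card hsub
    rw [Finset.card_biUnion] at hcard
    · have hcardR : (∑ e ∈ B, ((((S.filter fun a => I a e.1).erase w) ×ˢ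
        ((S.filter fun a => I a e.2).erase w)).card : ℝ)) ≤
          (((S ×ˢ S).filter fun v => good w v).card : ℝ) := by exact_mod_cast hcard
      refine le_trans ?_ hcardR
      have hBc : (B.card : ℝ) = (d w : ℝ) ^ 2 - d w := by
        rw [hB, Finset.offDiag_card, Nat.cast_sub (Nat.le_mul_self _)]
        push_cast
        ring
      rw [← hBc, ← nsmul_eq_mul]
      refine Finset.card_nsmul_le_sum _ _ _ fun e he => ?_
      simp only [hB, Finset.mem_offDiag, Finset.mem_filter] at he
      obtain ⟨⟨h1, h2⟩, ⟨h3, h4⟩, h5⟩ := he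
      have aux : ∀ b ∈ R', I w b → τ ≤ (((S.filter fun a => I a b).erase w).card : ℝ) := by
        intro b hb hwb
        have hmem : w ∈ S.filter fun a => I a b := Finset.mem_filter.2 ⟨hw, hwb⟩
        rw [Finset.card_erase_of_mem hmem, Nat.cast_sub (Finset.card_pos.2 ⟨w, hmem⟩)]
        exact_mod_cast hcntτ b hb
      rw [Finset.card_product, sq]
      push_cast
      exact mul_le_mul (aux _ h1 h2) (aux _ h3 h4) (by linarith) (Nat.cast_nonneg _)
    · intro e he e' he' hee
      rw [Function.onFun, Finset.disjoint_left]
      intro v hv hv'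
      simp only [hB, Finset.coe_offDiag, Set.mem_offDiag, Finset.mem_coe, Finset.mem_filter,
        Finset.mem_product, Finset.mem_erase] at he he' hv hv'
      refine hee (Prod.ext ?_ ?_)
      · exact hI w hw v.1 hv.1.2.1 hv.1.1.symm _ (hR'R he.1.1) _ (hR'R he'.1.1) he.1.2 hv.1.2.2
          he'.1.2 hv'.1.2.2
      · exact hI w hw v.2 hv.2.2.1 hv.2.1.symm _ (hR'R he.2.1.1) _ (hR'R he'.2.1.1) he.2.1.2
          hv.2.2.2 he'.2.1.2 hv'.2.2.2
  have htot : (r : ℝ) ^ 2 * m / 8 * τ ^ 2 ≤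
      ∑ v ∈ S ×ˢ S, ((S.filter fun w => good w v).card : ℝ) := by
    have h1 : ∑ v ∈ S ×ˢ S, ((S.filter fun w => good w v).card : ℝ) =
        ∑ w ∈ S, (((S ×ˢ S).filter fun v => good w v).card : ℝ) := by
      have := Finset.sum_card_bipartiteAbove_eq_sum_card_bipartiteBelow (s := S) (t := S ×ˢ S) good
      simp only [Finset.bipartiteAbove, Finset.bipartiteBelow] at this
      exact_mod_cast this.symm
    rw [h1]
    refine le_trans ?_ (Finset.sum_le_sum hlow)
    rw [← Finset.sum_mul, Finset.sum_sub_distrib]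
    refine mul_le_mul_of_nonneg_right ?_ (sq_nonneg _)
    have h2 : (∑ a ∈ S, (d a : ℝ)) ^ 2 ≤ m * ∑ a ∈ S, (d a : ℝ) ^ 2 := sq_sum_le_card_mul_sum_sq
    set X := ∑ a ∈ S, (d a : ℝ)
    set Y := ∑ a ∈ S, (d a : ℝ) ^ 2
    have h3 : m * (r ^ 2 * m / 8) ≤ X ^ 2 - m * X := by
      have h4 : (m * r / 4 : ℝ) ≤ X - m := by nlinarith
      nlinarith
    exact le_of_mul_le_mul_left (by linarith) hmR
  obtain ⟨v, hv, hvW⟩ : ∃ v ∈ S ×ˢ S,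
      (r : ℝ) ^ 4 * m ≤ 128 * n ^ 2 * ((S.filter fun w => good w v).card : ℝ) := by
    by_contra! hcon
    have h1 : ∑ v ∈ S ×ˢ S, (128 * (n : ℝ) ^ 2 * ((S.filter fun w => good w v).card : ℝ)) <
        ∑ v ∈ S ×ˢ S, (r : ℝ) ^ 4 * m := Finset.sum_lt_sum_of_nonempty (hS.product hS) hcon
    rw [← Finset.mul_sum, Finset.sum_const, Finset.card_product, nsmul_eq_mul] at h1
    have h2 : 128 * (n : ℝ) ^ 2 * ((r : ℝ) ^ 2 * m / 8 * τ ^ 2) = (m * m : ℕ) * ((r : ℝ) ^ 4 * m) := by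
      rw [hτ]
      push_cast
      field_simp
      norm_num
    have h3 := mul_le_mul_of_nonneg_left htot (by positivity : (0 : ℝ) ≤ 128 * n ^ 2)
    linarith
  obtain ⟨hv1, hv2⟩ := Finset.mem_product.1 hv
  have hvW' : r ^ 4 * m ≤ 128 * n ^ 2 * (S.filter fun w => good w v).card := by exact_mod_cast hvW
  refine ⟨v.1, hv1, v.2, hv2, ?_, S.filter fun w => good w v, Finset.filter_subset _ _, hvW',
    fun w hw => (Finset.mem_filter.1 hw).2⟩
  intro hvv
  have hpos : 0 < (S.filter fun w => good w v).card := by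
    rcases Nat.eq_zero_or_pos (S.filter fun w => good w v).card with h0 | h0
    · rw [h0, mul_zero] at hvW'
      have : 0 < r ^ 4 * m := by positivity
      omega
    · exact h0
  obtain ⟨w, hw⟩ := Finset.card_pos.1 hpos
  obtain ⟨hwS, h1, h2, l, hl, l', hl', hll, h3, h4, h5, h6⟩ := Finset.mem_filter.1 hw
  exact hll (hI w hwS v.1 hv1 h1 l hl l' hl' h3 h5 h4 (hvv ▸ h6))

end LinearSpace

section Lines

/-- `l` is a line in the plane `F²`. -/
def IsLine {F : Type*} [Field F] (l : Set (F × F)) : Prop :=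
  ∃ a b c : F, (a ≠ 0 ∨ b ≠ 0) ∧ ∀ w, w ∈ l ↔ a * w.1 + b * w.2 + c = 0

variable {F : Type*} [Field F]

lemma IsLine.subset_of_mem {l l' : Set (F × F)} (hl : IsLine l) (hl' : IsLine l') {v w : F × F}
    (hvw : v ≠ w) (hv : v ∈ l) (hw : w ∈ l) (hv' : v ∈ l') (hw' : w ∈ l') : l ⊆ l' := by
  obtain ⟨a, b, c, hab, h⟩ := hl
  obtain ⟨a', b', c', hab', h'⟩ := hl'
  rw [h] at hv hw
  rw [h'] at hv' hw'
  have hdet : a * b' - a' * b = 0 := by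
    by_contra hne
    apply hvw
    have e1 : a * (v.1 - w.1) + b * (v.2 - w.2) = 0 := by linear_combination hv - hw
    have e2 : a' * (v.1 - w.1) + b' * (v.2 - w.2) = 0 := by linear_combination hv' - hw'
    refine Prod.ext (mul_left_cancel₀ hne ?_) (mul_left_cancel₀ hne ?_)
    · linear_combination b' * e1 - b * e2
    · linear_combination a * e2 - a' * e1
  intro x hx
  rw [h] at hx
  rw [h']
  have e3 : a * (x.1 - v.1) + b * (x.2 - v.2) = 0 := by linear_combination hx - hv
  rcases hab with ha | hb
  · apply mul_left_cancel₀ ha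
    linear_combination a' * e3 + (x.2 - v.2) * hdet + a * hv'
  · apply mul_left_cancel₀ hb
    linear_combination b' * e3 - (x.1 - v.1) * hdet + b * hv'

lemma IsLine.eq_of_mem {l l' : Set (F × F)} (hl : IsLine l) (hl' : IsLine l') {v w : F × F}
    (hvw : v ≠ w) (hv : v ∈ l) (hw : w ∈ l) (hv' : v ∈ l') (hw' : w ∈ l') : l = l' :=
  (hl.subset_of_mem hl' hvw hv hw hv' hw').antisymm (hl'.subset_of_mem hl hvw hv' hw' hv hw)

open Classical in
lemma IsLine.card_filter_mem [Fintype F] {l : Set (F × F)} (hl : IsLine l) :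
    (univ.filter fun w => w ∈ l).card = Fintype.card F := by
  obtain ⟨a, b, c, hab, h⟩ := hl
  rw [← Finset.card_univ]
  symm
  rcases hab with ha | hb
  · refine Finset.card_bij (fun y _ => (-(b * y + c) / a, y)) ?_ ?_ ?_
    · intro y _
      simp only [Finset.mem_filter, Finset.mem_univ, true_and, h]
      field_simp
      ring
    · intro y _ y' _ hy
      exact (Prod.mk.inj hy).2
    · intro w hw
      refine ⟨w.2, Finset.mem_univ _, Prod.ext ?_ rfl⟩
      rw [div_eq_iff ha]
      linear_combination -(h w).1 (Finset.mem_filter.1 hw).2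
  · refine Finset.card_bij (fun x _ => (x, -(a * x + c) / b)) ?_ ?_ ?_
    · intro y _
      simp only [Finset.mem_filter, Finset.mem_univ, true_and, h]
      field_simp
      ring
    · intro y _ y' _ hy
      exact (Prod.mk.inj hy).1
    · intro w hw
      refine ⟨w.1, Finset.mem_univ _, Prod.ext rfl ?_⟩
      rw [div_eq_iff hb]
      linear_combination -(h w).1 (Finset.mem_filter.1 hw).2

open Classical in
/-- Second moment bound for the number of lines through a point. -/
lemma sum_sub_sq_le {p : ℕ} [Fact p.Prime] {L : Finset (Set (ZMod p × ZMod p))}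
    (hL : ∀ l ∈ L, IsLine l) :
    ∑ w : ZMod p × ZMod p, (((L.filter fun l => w ∈ l).card : ℝ) - L.card / p) ^ 2 ≤
      L.card * p := by
  have hp : (0 : ℝ) < p := by exact_mod_cast (Fact.out : p.Prime).pos
  have h1 := sum_sq_card_le (I := fun (l : Set (ZMod p × ZMod p)) w => w ∈ l) (S := L)
    (R := (univ : Finset (ZMod p × ZMod p)))
    (fun l hl l' hl' hll w _ w' _ h1 h2 h3 h4 => by
      by_contra hww
      exact hll ((hL l hl).eq_of_mem (hL l' hl') hww h1 h3 h2 h4))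
  have h2 : inc (fun (l : Set (ZMod p × ZMod p)) w => w ∈ l) L univ = L.card * p := by
    rw [inc, ← smul_eq_mul]
    refine Finset.sum_const_nat fun l hl => ?_
    have := (hL l hl).card_filter_mem
    rwa [ZMod.card] at this
  have h3 : inc (fun (l : Set (ZMod p × ZMod p)) w => w ∈ l) L univ =
      ∑ w : ZMod p × ZMod p, (L.filter fun l => w ∈ l).card := inc_comm _ _ _
  rw [h3] at h1 h2
  have h4 : (∑ w : ZMod p × ZMod p, ((L.filter fun l => w ∈ l).card : ℝ) ^ 2) ≤
      ∑ w : ZMod p × ZMod p, ((L.filter fun l => w ∈ l).card : ℝ) + (L.card : ℝ) ^ 2 := by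
    exact_mod_cast h1
  set D : ZMod p × ZMod p → ℝ := fun w => ((L.filter fun l => w ∈ l).card : ℝ) with hD
  have h5 : ∑ w, D w = L.card * p := by
    simp only [hD]
    exact_mod_cast h2
  change ∑ w, D w ^ 2 ≤ ∑ w, D w + (L.card : ℝ) ^ 2 at h4
  change ∑ w, (D w - L.card / p) ^ 2 ≤ _
  have h7 : ∑ w, (D w - L.card / p) ^ 2 =
      ∑ w, D w ^ 2 - 2 * (L.card / p) * ∑ w, D w + p ^ 2 * (L.card / p : ℝ) ^ 2 := by
    simp only [sub_sq, Finset.sum_add_distrib, Finset.sum_sub_distrib, Finset.sum_const,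
      Finset.card_univ, Fintype.card_prod, ZMod.card, nsmul_eq_mul, Finset.mul_sum]
    push_cast
    congr 1
    · congr 1
      exact Finset.sum_congr rfl fun w _ => by ring
    · ring
  have h9 : 2 * (L.card / p : ℝ) * (L.card * p) = 2 * L.card ^ 2 := by field_simp
  have h10 : p ^ 2 * (L.card / p : ℝ) ^ 2 = L.card ^ 2 := by field_simp
  rw [h7, h10, h5, h9]
  linarith

end Lines

section Projective

variable {p : ℕ} [Fact p.Prime]

open Classical in
/-- A projective transformation sends two pencils of lines to the coordinate directions. -/
lemma exists_grid {L : Finset (Set (ZMod p × ZMod p))} (hL : ∀ l ∈ L, IsLine l)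
    {W : Finset (ZMod p × ZMod p)} {v v' : ZMod p × ZMod p} (hvv : v ≠ v') {r k : ℕ}
    (hr : ∀ w ∈ W, r ≤ (L.filter fun l => w ∈ l).card)
    (hk : ∀ w ∈ W, (L.filter fun l => w ∈ l).card ≤ k)
    (hv : (L.filter fun l => v ∈ l).card ≤ k) (hv' : (L.filter fun l => v' ∈ l).card ≤ k)
    (hW : ∀ w ∈ W, w ≠ v ∧ w ≠ v' ∧ ∃ l ∈ L, ∃ l' ∈ L, l ≠ l' ∧ w ∈ l ∧ w ∈ l' ∧ v ∈ l ∧ v' ∈ l') :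
    ∃ P M : Finset (ZMod p × ZMod p), M.card ≤ L.card ∧ (P.image Prod.fst).card ≤ k ∧
      (P.image Prod.snd).card ≤ k ∧ (∀ z ∈ P, (M.filter (OnGraph z)).card ≤ k) ∧
      (r - 1) * W.card ≤ inc OnGraph P M := by
  obtain ⟨e1, e2, he⟩ : ∃ e1 e2 : ZMod p, (v'.1 - v.1) * e2 - (v'.2 - v.2) * e1 = 1 := by
    by_cases h1 : v'.1 - v.1 = 0
    · have h2 : v'.2 - v.2 ≠ 0 := by
        intro h2
        exact hvv (Prod.ext (sub_eq_zero.1 h1).symm (sub_eq_zero.1 h2).symm)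
      exact ⟨-1 / (v'.2 - v.2), 0, by field_simp; ring⟩
    · exact ⟨0, 1 / (v'.1 - v.1), by field_simp; ring⟩
  set f : ZMod p × ZMod p → ZMod p := fun w => (w.1 - v.1) * e2 - (w.2 - v.2) * e1 with hf
  set lam : ZMod p × ZMod p → ZMod p := fun w =>
    (v'.1 - v.1) * (w.2 - v.2) - (v'.2 - v.2) * (w.1 - v.1) with hlam
  choose! a b c hab hmem using hL
  set A : Set (ZMod p × ZMod p) → ZMod p := fun l => a l * v'.1 + b l * v'.2 + c l with hA
  set B : Set (ZMod p × ZMod p) → ZMod p := fun l => a l * v.1 + b l * v.2 + c l with hB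
  set G : Set (ZMod p × ZMod p) → ZMod p := fun l => a l * e1 + b l * e2 with hG
  have hAmem : ∀ l ∈ L, v' ∈ l ↔ A l = 0 := fun l hl => hmem l hl v'
  have hBmem : ∀ l ∈ L, v ∈ l ↔ B l = 0 := fun l hl => hmem l hl v
  have hmem' : ∀ l ∈ L, ∀ w, w ∈ l ↔ A l * f w + B l * (1 - f w) + G l * lam w = 0 := by
    intro l hl w
    rw [hmem l hl w]
    have : a l * w.1 + b l * w.2 + c l = A l * f w + B l * (1 - f w) + G l * lam w := by
      simp only [hA, hB, hG, hf, hlam]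
      linear_combination (-(a l * (w.1 - v.1)) - b l * (w.2 - v.2)) * he
    rw [this]
  have hnz : ∀ l ∈ L, ¬ (A l = 0 ∧ B l = 0 ∧ G l = 0) := by
    rintro l hl ⟨h1, h2, h3⟩
    simp only [hA, hB, hG] at h1 h2 h3
    rcases hab l hl with ha | hb
    · apply ha
      linear_combination (-a l) * he + e2 * (h1 - h2) - (v'.2 - v.2) * h3
    · apply hb
      linear_combination (-b l) * he - e1 * (h1 - h2) + (v'.1 - v.1) * h3
  have hrec : ∀ w w' : ZMod p × ZMod p, f w = f w' → lam w = lam w' → w = w' := by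
    intro w w' h1 h2
    simp only [hf, hlam] at h1 h2
    refine Prod.ext ?_ ?_
    · linear_combination (-(w.1 - w'.1)) * he + (v'.1 - v.1) * h1 + e1 * h2
    · linear_combination (-(w.2 - w'.2)) * he + (v'.2 - v.2) * h1 + e2 * h2
  have hfv : f v = 0 := by simp [hf]
  have hfv' : f v' = 1 := by simp only [hf]; linear_combination he
  have hlv : lam v = 0 := by simp [hlam]
  have hlv' : lam v' = 0 := by simp only [hlam]; ring
  have hlam0 : ∀ w ∈ W, lam w ≠ 0 := by
    intro w hw h0
    obtain ⟨h1, h2, l, hl, l', hl', hll, h3, h4, h5, h6⟩ := hW w hw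
    rw [hmem' l hl, (hBmem l hl).1 h5, h0] at h3
    have hfw : f w ≠ 0 := fun h => h1 (hrec w v (h.trans hfv.symm) (h0.trans hlv.symm))
    have hA0 : A l = 0 := by
      have : A l * f w = 0 := by linear_combination h3
      exact (mul_eq_zero.1 this).resolve_right hfw
    have hwl : w ∈ l := by
      rw [hmem' l hl, (hBmem l hl).1 h5, h0, hA0]; ring
    exact hll (IsLine.eq_of_mem ⟨a l, b l, c l, hab l hl, hmem l hl⟩
      ⟨a l', b l', c l', hab l' hl', hmem l' hl'⟩ h2 hwl ((hAmem l hl).2 hA0) h4 h6)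
  set X : ZMod p × ZMod p → ZMod p × ZMod p := fun w => (f w / lam w, (1 - f w) / lam w) with hX
  have hXinj : Set.InjOn X W := by
    intro w hw w' hw' h
    have h0 := hlam0 w hw
    have h0' := hlam0 w' hw'
    obtain ⟨h1, h2⟩ := Prod.mk.inj h
    rw [div_eq_div_iff h0 h0'] at h1 h2
    have h3 : lam w = lam w' := by linear_combination -h1 - h2
    exact hrec w w' (mul_right_cancel₀ h0' (by rw [h1, h3])) h3
  set ψ : Set (ZMod p × ZMod p) → ZMod p × ZMod p := fun l => (-(A l / B l), -(G l / B l)) with hψ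
  have hgraph : ∀ w ∈ W, ∀ l ∈ L, v ∉ l → (OnGraph (X w) (ψ l) ↔ w ∈ l) := by
    intro w hw l hl hvl
    have hB0 : B l ≠ 0 := fun h => hvl ((hBmem l hl).2 h)
    have h0 := hlam0 w hw
    rw [hmem' l hl, OnGraph]
    simp only [hX, hψ]
    rw [← sub_eq_zero]
    have : -(A l / B l) * (f w / lam w) + -(G l / B l) - (1 - f w) / lam w =
        -(A l * f w + B l * (1 - f w) + G l * lam w) / (B l * lam w) := by
      field_simp
      ring
    rw [this, div_eq_zero_iff, neg_eq_zero]
    simp [hB0, h0]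
  have hψinj : Set.InjOn ψ (L.filter fun l => v ∉ l) := by
    intro l hl l' hl' h
    obtain ⟨hl, hvl⟩ := Finset.mem_filter.1 (Finset.mem_coe.1 hl)
    obtain ⟨hl', hvl'⟩ := Finset.mem_filter.1 (Finset.mem_coe.1 hl')
    have hB0 : B l ≠ 0 := fun h => hvl ((hBmem l hl).2 h)
    have hB0' : B l' ≠ 0 := fun h => hvl' ((hBmem l' hl').2 h)
    obtain ⟨h1, h2⟩ := Prod.mk.inj h
    rw [neg_inj, div_eq_div_iff hB0 hB0'] at h1 h2
    ext w
    rw [hmem' l hl, hmem' l' hl']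
    constructor
    · intro h
      refine mul_left_cancel₀ hB0 ?_
      linear_combination B l' * h - f w * h1 - lam w * h2
    · intro h
      refine mul_left_cancel₀ hB0' ?_
      linear_combination B l * h + f w * h1 + lam w * h2
  refine ⟨W.image X, (L.filter fun l => v ∉ l).image ψ, ?_, ?_, ?_, ?_, ?_⟩
  · exact Finset.card_image_le.trans (Finset.card_filter_le _ _)
  · refine le_trans ?_ hv
    refine le_trans (Finset.card_le_card (t := (L.filter fun l => v ∈ l).image
      fun l => -(G l / A l)) ?_) Finset.card_image_le
    intro x hx
    obtain ⟨z, hz, rfl⟩ := Finset.mem_image.1 hx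
    obtain ⟨w, hw, rfl⟩ := Finset.mem_image.1 hz
    obtain ⟨h1, h2, l, hl, l', hl', hll, h3, h4, h5, h6⟩ := hW w hw
    refine Finset.mem_image.2 ⟨l, Finset.mem_filter.2 ⟨hl, h5⟩, ?_⟩
    have h0 := hlam0 w hw
    rw [hmem' l hl, (hBmem l hl).1 h5] at h3
    have hA0 : A l ≠ 0 := by
      intro hA0
      rw [hA0] at h3
      refine hnz l hl ⟨hA0, (hBmem l hl).1 h5, (mul_eq_zero.1 ?_).resolve_right h0⟩
      linear_combination h3
    simp only [hX]
    rw [← neg_div, div_eq_div_iff hA0 h0]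
    linear_combination -h3
  · refine le_trans ?_ hv'
    refine le_trans (Finset.card_le_card (t := (L.filter fun l => v' ∈ l).image
      fun l => -(G l / B l)) ?_) Finset.card_image_le
    intro x hx
    obtain ⟨z, hz, rfl⟩ := Finset.mem_image.1 hx
    obtain ⟨w, hw, rfl⟩ := Finset.mem_image.1 hz
    obtain ⟨h1, h2, l, hl, l', hl', hll, h3, h4, h5, h6⟩ := hW w hw
    refine Finset.mem_image.2 ⟨l', Finset.mem_filter.2 ⟨hl', h6⟩, ?_⟩
    have h0 := hlam0 w hw
    rw [hmem' l' hl', (hAmem l' hl').1 h6] at h4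
    have hB0 : B l' ≠ 0 := by
      intro hB0
      rw [hB0] at h4
      refine hnz l' hl' ⟨(hAmem l' hl').1 h6, hB0, (mul_eq_zero.1 ?_).resolve_right h0⟩
      linear_combination h4
    simp only [hX]
    rw [← neg_div, div_eq_div_iff hB0 h0]
    linear_combination -h4
  · intro z hz
    obtain ⟨w, hw, rfl⟩ := Finset.mem_image.1 hz
    refine le_trans ?_ (hk w hw)
    refine le_trans (Finset.card_le_card (t := (L.filter fun l => w ∈ l).image ψ) ?_)
      Finset.card_image_le
    intro m hm
    obtain ⟨hm, hg⟩ := Finset.mem_filter.1 hm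
    obtain ⟨l, hl, rfl⟩ := Finset.mem_image.1 hm
    obtain ⟨hl, hvl⟩ := Finset.mem_filter.1 hl
    exact Finset.mem_image_of_mem _ (Finset.mem_filter.2 ⟨hl, (hgraph w hw l hl hvl).1 hg⟩)
  · rw [← Finset.card_image_of_injOn hXinj]
    refine mul_le_inc fun z hz => ?_
    obtain ⟨w, hw, rfl⟩ := Finset.mem_image.1 hz
    have h1 : ((L.filter fun l => v ∉ l).filter fun l => w ∈ l).card ≤
        (((L.filter fun l => v ∉ l).image ψ).filter (OnGraph (X w))).card := by
      refine Finset.card_le_card_of_injOn ψ ?_ (hψinj.mono (by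
        exact_mod_cast Finset.filter_subset _ _))
      intro l hl
      obtain ⟨hl, hwl⟩ := Finset.mem_filter.1 (Finset.mem_coe.1 hl)
      refine Finset.mem_coe.2 (Finset.mem_filter.2 ⟨Finset.mem_image_of_mem _ hl, ?_⟩)
      obtain ⟨hl, hvl⟩ := Finset.mem_filter.1 hl
      exact (hgraph w hw l hl hvl).2 hwl
    refine le_trans ?_ h1
    have h2 : ((L.filter fun l => w ∈ l).filter fun l => v ∈ l).card ≤ 1 := by
      refine Finset.card_le_one.2 fun l hl l' hl' => ?_
      simp only [Finset.mem_filter] at hl hl'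
      exact IsLine.eq_of_mem ⟨a l, b l, c l, hab l hl.1.1, hmem l hl.1.1⟩
        ⟨a l', b l', c l', hab l' hl'.1.1, hmem l' hl'.1.1⟩ (hW w hw).1 hl.1.2 hl.2 hl'.1.2 hl'.2
    have h3 := Finset.card_filter_add_card_filter_not (s := L.filter fun l => w ∈ l) (fun l => v ∈ l)
    have h4 := hr w hw
    have h5 : ((L.filter fun l => w ∈ l).filter fun l => v ∉ l).card =
      ((L.filter fun l => v ∉ l).filter fun l => w ∈ l).card := by rw [Finset.filter_comm]
    omega

end Projective

section RichPoints

variable {p : ℕ} [Fact p.Prime]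

open Classical in
/-- The main range of the bound for the number of rich points. -/
lemma pow_le_of_grid {P M : Finset (ZMod p × ZMod p)} {n r m : ℕ} (hr : 2 ≤ r)
    (hM : M.card ≤ n) (hA : (P.image Prod.fst).card ≤ 2 * r) (hB : (P.image Prod.snd).card ≤ 2 * r)
    (hdeg : ∀ z ∈ P, (M.filter (OnGraph z)).card ≤ 2 * r) (hm : (r - 1) * m ≤ inc OnGraph P M)
    (hn : 1 ≤ n) (hrn : r ^ 2 ≤ 2 * n) (hp : 54 * r * n < p ^ 2) :
    (m : ℝ) ^ 4 ≤ 2 ^ 40 * 972 ^ 16 * r * (n : ℝ) ^ 3 := by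
  have hrR : (2 : ℝ) ≤ r := by exact_mod_cast hr
  have hnR : (1 : ℝ) ≤ n := by exact_mod_cast hn
  obtain ⟨κ, hκ, hκ4⟩ : ∃ κ : ℝ, 0 ≤ κ ∧ κ ^ 4 = (2 * r : ℕ) :=
    ⟨((2 * r : ℕ) : ℝ) ^ ((4 : ℝ)⁻¹), by positivity, by
      exact_mod_cast Real.rpow_inv_natCast_pow (n := 4) (Nat.cast_nonneg (2 * r)) (by norm_num)⟩
  obtain ⟨ν, hν, hν4⟩ : ∃ ν : ℝ, 0 ≤ ν ∧ ν ^ 4 = 2 * r * n :=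
    ⟨(2 * r * n : ℝ) ^ ((4 : ℝ)⁻¹), by positivity, by
      exact_mod_cast Real.rpow_inv_natCast_pow (n := 4) (by positivity : (0 : ℝ) ≤ 2 * r * n)
        (by norm_num)⟩
  have hν1 : 1 ≤ ν := by
    refine (pow_le_pow_iff_left₀ zero_le_one hν (by norm_num : 4 ≠ 0)).1 ?_
    rw [hν4]
    nlinarith
  have hMR : (M.card : ℝ) ≤ n := by exact_mod_cast hM
  have hpR : (54 * r * n : ℝ) < p ^ 2 := by exact_mod_cast hp
  have key := inc_onGraph_sq_le (p := p) hA hdeg hκ hκ4 hν1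
    (by rw [hν4]; push_cast; gcongr) (by rw [hν4]; linarith)
  have hκν : κ ^ 3 ≤ 2 * ν := by
    refine (pow_le_pow_iff_left₀ (by positivity) (by positivity) (by norm_num : 4 ≠ 0)).1 ?_
    have h1 : (κ ^ 3) ^ 4 = (κ ^ 4) ^ 3 := by ring
    rw [h1, hκ4, mul_pow, hν4]
    push_cast
    have : (r : ℝ) ^ 2 ≤ 2 * n := by exact_mod_cast hrn
    nlinarith
  have h2 : ν ^ 6 + κ ^ 3 * ν ^ 5 ≤ 3 * ν ^ 6 := by
    have := mul_le_mul_of_nonneg_right hκν (by positivity : 0 ≤ ν ^ 5)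
    nlinarith
  have hBR : ((P.image Prod.snd).card : ℝ) ≤ 2 * r := by exact_mod_cast hB
  have h3 : (inc OnGraph P M : ℝ) ^ 2 ≤ 2 * r * (36 * 972 ^ 8 * (3 * ν ^ 6)) :=
    key.trans (mul_le_mul hBR (by gcongr) (by positivity) (by positivity))
  have h4 : (r * m : ℝ) ≤ 2 * inc OnGraph P M := by
    have h5 : r * m ≤ 2 * ((r - 1) * m) := by
      rw [← mul_assoc]
      exact Nat.mul_le_mul_right _ (by omega)
    exact_mod_cast h5.trans (Nat.mul_le_mul_left 2 hm)
  have h6 : (r * m : ℝ) ^ 4 ≤ 16 * (2 * r * (36 * 972 ^ 8 * (3 * ν ^ 6))) ^ 2 := by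
    calc (r * m : ℝ) ^ 4 ≤ (2 * inc OnGraph P M) ^ 4 := pow_le_pow_left₀ (by positivity) h4 4
      _ = 16 * ((inc OnGraph P M : ℝ) ^ 2) ^ 2 := by ring
      _ ≤ _ := by gcongr
  have h7 : 16 * (2 * r * (36 * 972 ^ 8 * (3 * ν ^ 6))) ^ 2 =
      (r : ℝ) ^ 4 * (16 * (2 * 36 * 972 ^ 8 * 3) ^ 2 * 8 * (r * (n : ℝ) ^ 3)) := by
    have : (ν ^ 6) ^ 2 = (2 * r * n) ^ 3 := by rw [← hν4]; ring
    calc 16 * (2 * r * (36 * 972 ^ 8 * (3 * ν ^ 6))) ^ 2 =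
        16 * (2 * r * (36 * 972 ^ 8 * 3)) ^ 2 * (ν ^ 6) ^ 2 := by ring
      _ = _ := by rw [this]; ring
  rw [h7, mul_pow] at h6
  have h8 := le_of_mul_le_mul_left h6 (by positivity)
  refine h8.trans ?_
  have h9 : (0 : ℝ) ≤ r * (n : ℝ) ^ 3 := by positivity
  calc _ = (16 * (2 * 36 * 3) ^ 2 * 8) * (972 ^ 16 * (r * (n : ℝ) ^ 3)) := by ring
    _ ≤ 2 ^ 40 * (972 ^ 16 * (r * (n : ℝ) ^ 3)) := by gcongr ; norm_num
    _ = _ := by ring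

open Classical in
/-- Bound for the number of points incident with about `r` lines of a given family. -/
theorem card_rich_points_le {L : Finset (Set (ZMod p × ZMod p))} (hL : ∀ l ∈ L, IsLine l)
    {P : Finset (ZMod p × ZMod p)} {r : ℕ} (hr : 2 ≤ r) (hrp : 2 * L.card ≤ r * p)
    (hP : ∀ w ∈ P, r ≤ (L.filter fun l => w ∈ l).card ∧ (L.filter fun l => w ∈ l).card ≤ 2 * r) :
    r * P.card ≤ 4 * L.card ∨
      (P.card : ℝ) ^ 4 * (r : ℝ) ^ 15 ≤ 2 ^ 80 * 972 ^ 16 * (L.card : ℝ) ^ 11 := by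
  refine or_iff_not_imp_left.2 fun hbig => ?_
  rw [not_le] at hbig
  set m := P.card with hm
  set n := L.card with hn
  set I : ZMod p × ZMod p → Set (ZMod p × ZMod p) → Prop := fun w l => w ∈ l with hI
  have hlin : ∀ w ∈ P, ∀ w' ∈ P, w ≠ w' → ∀ l ∈ L, ∀ l' ∈ L, I w l → I w' l → I w l' → I w' l' →
      l = l' := fun w _ w' _ hww l hl l' hl' h1 h2 h3 h4 =>
    (hL l hl).eq_of_mem (hL l' hl') hww h1 h2 h3 h4
  have hJ : r * m ≤ inc I P L := mul_le_inc fun w hw => (hP w hw).1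
  have hPne : P.Nonempty := by
    rw [← Finset.card_pos, ← hm]
    rcases Nat.eq_zero_or_pos m with h | h
    · rw [h] at hbig; omega
    · exact h
  have hm0 : 0 < m := Finset.card_pos.2 hPne
  have hn0 : 1 ≤ n := by
    obtain ⟨w, hw⟩ := hPne
    have := (hP w hw).1.trans (Finset.card_filter_le _ _)
    omega
  have hrR : (2 : ℝ) ≤ r := by exact_mod_cast hr
  have hnR : (1 : ℝ) ≤ n := by exact_mod_cast hn0
  have hmR : (0 : ℝ) < m := by exact_mod_cast hm0
  have hbigR : (4 * n : ℝ) < r * m := by exact_mod_cast hbig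
  have hJR : (r * m : ℝ) ≤ inc I P L := by exact_mod_cast hJ
  have hr2 : (r : ℝ) ^ 2 ≤ 2 * n := by
    have h1 : (inc I P L : ℝ) ^ 2 ≤ n * (inc I P L + (m : ℝ) ^ 2) := by
      exact_mod_cast inc_sq_le hlin
    set J : ℝ := (inc I P L : ℝ)
    have h2 : J * (J - n) ≤ n * (m : ℝ) ^ 2 := by nlinarith
    have h3 : (r * m : ℝ) * (r * m / 2) ≤ J * (J - n) :=
      mul_le_mul hJR (by linarith) (by positivity) (by linarith)
    have h4 : (m : ℝ) ^ 2 * (r : ℝ) ^ 2 ≤ (m : ℝ) ^ 2 * (2 * n) := by nlinarith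
    exact le_of_mul_le_mul_left h4 (by positivity)
  have hmr : (m : ℝ) * (r : ℝ) ^ 2 ≤ 2 * (n : ℝ) ^ 2 := by
    have h1 : (inc I P L : ℝ) ^ 2 ≤ m * (inc I P L + (n : ℝ) ^ 2) := by
      have := inc_sq_le (I := fun l w => I w l) (S := L) (R := P)
        (fun l hl l' hl' hll w hw w' hw' h1 h2 h3 h4 => by
          by_contra hww
          exact hll (hlin w hw w' hw' hww l hl l' hl' h1 h3 h2 h4))
      have e : inc (fun l w => I w l) L P = inc I P L := (inc_comm I P L).symm
      rw [e] at this
      exact_mod_cast this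
    set J : ℝ := (inc I P L : ℝ)
    have h2 : J * (J - m) ≤ m * (n : ℝ) ^ 2 := by nlinarith
    have h3 : (r * m : ℝ) * (r * m / 2) ≤ J * (J - m) :=
      mul_le_mul hJR (by nlinarith) (by positivity) (by linarith)
    have h4 : m * (m * (r : ℝ) ^ 2) ≤ m * (2 * (n : ℝ) ^ 2) := by nlinarith
    exact le_of_mul_le_mul_left h4 hmR
  have hsplit : (m : ℝ) ^ 4 * (r : ℝ) ^ 15 = (m * (r : ℝ) ^ 2) ^ 4 * (r : ℝ) ^ 7 := by ring
  rcases le_total ((r : ℝ) ^ 7) (16 ^ 7 * (n : ℝ) ^ 3) with hr7 | hr7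
  · rw [hsplit]
    calc (m * (r : ℝ) ^ 2) ^ 4 * (r : ℝ) ^ 7 ≤ (2 * (n : ℝ) ^ 2) ^ 4 * (16 ^ 7 * (n : ℝ) ^ 3) :=
          mul_le_mul (pow_le_pow_left₀ (by positivity) hmr 4) hr7 (by positivity) (by positivity)
      _ = (2 ^ 4 * 16 ^ 7) * (n : ℝ) ^ 11 := by ring
      _ ≤ _ := by gcongr <;> norm_num
  rcases le_or_gt (p ^ 2 : ℝ) (54 * r * n) with hpr | hpr
  · have hp0 : (0 : ℝ) < p := by exact_mod_cast (Fact.out : p.Prime).pos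
    have h1 : (m : ℝ) * (r : ℝ) ^ 2 ≤ 4 * (n * p) := by
      have h2 := sum_sub_sq_le hL
      have h3 : ∑ w ∈ P, (((L.filter fun l => w ∈ l).card : ℝ) - n / p) ^ 2 ≤ n * p :=
        (Finset.sum_le_sum_of_subset_of_nonneg (Finset.subset_univ P)
          fun _ _ _ => sq_nonneg _).trans h2
      have h4 : P.card • ((r : ℝ) ^ 2 / 4) ≤
          ∑ w ∈ P, (((L.filter fun l => w ∈ l).card : ℝ) - n / p) ^ 2 := by
        refine Finset.card_nsmul_le_sum _ _ _ fun w hw => ?_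
        have h5 : (r : ℝ) ≤ (L.filter fun l => w ∈ l).card := by exact_mod_cast (hP w hw).1
        have h6 : (n / p : ℝ) ≤ r / 2 := by
          rw [div_le_div_iff₀ hp0 two_pos]
          have : (2 * n : ℝ) ≤ r * p := by exact_mod_cast hrp
          linarith
        have h7 : (r / 2 : ℝ) ≤ ((L.filter fun l => w ∈ l).card : ℝ) - n / p := by linarith
        calc (r : ℝ) ^ 2 / 4 = (r / 2) ^ 2 := by ring
          _ ≤ _ := pow_le_pow_left₀ (by positivity) h7 2
      rw [nsmul_eq_mul, ← hm] at h4
      linarith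
    rw [hsplit]
    calc (m * (r : ℝ) ^ 2) ^ 4 * (r : ℝ) ^ 7 ≤ (4 * (n * p)) ^ 4 * (r : ℝ) ^ 7 := by gcongr
      _ = 256 * (n : ℝ) ^ 4 * ((p : ℝ) ^ 2) ^ 2 * (r : ℝ) ^ 7 := by ring
      _ ≤ 256 * (n : ℝ) ^ 4 * (54 * r * n) ^ 2 * (r : ℝ) ^ 7 := by gcongr
      _ = 256 * 54 ^ 2 * (n : ℝ) ^ 6 * ((r : ℝ) ^ 9 * 1) := by ring
      _ ≤ 256 * 54 ^ 2 * (n : ℝ) ^ 6 * ((r : ℝ) ^ 9 * r) := by gcongr; linarith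
      _ = 256 * 54 ^ 2 * (n : ℝ) ^ 6 * ((r : ℝ) ^ 2) ^ 5 := by ring
      _ ≤ 256 * 54 ^ 2 * (n : ℝ) ^ 6 * (2 * n) ^ 5 := by gcongr
      _ = 256 * 54 ^ 2 * 2 ^ 5 * (n : ℝ) ^ 11 := by ring
      _ ≤ _ := by gcongr <;> norm_num
  have hr4 : 4 ≤ r := by
    have h1 : (16 : ℝ) ^ 7 ≤ (r : ℝ) ^ 7 := by
      refine le_trans ?_ hr7
      have : (1 : ℝ) ≤ (n : ℝ) ^ 3 := one_le_pow₀ hnR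
      linarith
    have h2 := (pow_le_pow_iff_left₀ (by norm_num) (by positivity) (by norm_num : 7 ≠ 0)).1 h1
    have h3 : 16 ≤ r := by exact_mod_cast h2
    omega
  obtain ⟨v, hv, v', hv', hvv, W, hWP, hWc, hW⟩ := exists_pair_of_rich hlin hr4 hPne hbig.le
    (fun w hw => (hP w hw).1)
  obtain ⟨P', M, hM, hA, hB, hdeg, hinc⟩ := exists_grid hL hvv
    (fun w hw => (hP w (hWP hw)).1) (fun w hw => (hP w (hWP hw)).2) (hP v hv).2 (hP v' hv').2 hW
  have key := pow_le_of_grid hr hM hA hB hdeg hinc hn0 (by exact_mod_cast hr2)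
    (by exact_mod_cast hpr)
  have hWcR : (r : ℝ) ^ 4 * m ≤ 128 * (n : ℝ) ^ 2 * W.card := by exact_mod_cast hWc
  have h1 : (r : ℝ) * ((m : ℝ) ^ 4 * (r : ℝ) ^ 15) ≤
      r * (2 ^ 80 * 972 ^ 16 * (n : ℝ) ^ 11) := by
    calc (r : ℝ) * ((m : ℝ) ^ 4 * (r : ℝ) ^ 15) = ((r : ℝ) ^ 4 * m) ^ 4 := by ring
      _ ≤ (128 * (n : ℝ) ^ 2 * W.card) ^ 4 := by gcongr
      _ = 128 ^ 4 * (n : ℝ) ^ 8 * (W.card : ℝ) ^ 4 := by ring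
      _ ≤ 128 ^ 4 * (n : ℝ) ^ 8 * (2 ^ 40 * 972 ^ 16 * r * (n : ℝ) ^ 3) := by gcongr
      _ = r * ((128 ^ 4 * 2 ^ 40) * (972 ^ 16 * (n : ℝ) ^ 11)) := by ring
      _ ≤ r * (2 ^ 80 * (972 ^ 16 * (n : ℝ) ^ 11)) := by gcongr ; norm_num
      _ = _ := by ring
  exact le_of_mul_le_mul_left h1 (by positivity)

end RichPoints

section Dyadic

/-- A dyadic sum dominated by an increasing and a decreasing geometric progression. -/
lemma exists_sum_le_of_le_geom {a b : ℝ} (ha : 0 < a) (hb : 0 < b) :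
    ∃ C : ℝ, 0 < C ∧ ∀ (s : Finset ℕ) (f : ℕ → ℝ) (A B : ℝ), 0 < A → 0 < B →
      (∀ i ∈ s, f i ≤ A * (2 : ℝ) ^ (a * i)) → (∀ i ∈ s, f i ≤ B * (2 : ℝ) ^ (-(b * i))) →
      ∑ i ∈ s, f i ≤ C * (A ^ (b / (a + b)) * B ^ (a / (a + b))) := by
  set α : ℝ := 2 ^ a with hα
  set β : ℝ := 2 ^ (-b) with hβ
  have hα1 : 1 < α := Real.one_lt_rpow (by norm_num) ha
  have hβ0 : 0 < β := by positivity
  have hβ1 : β < 1 := Real.rpow_lt_one_of_one_lt_of_neg (by norm_num) (by linarith)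
  have hαi : ∀ i : ℕ, (2 : ℝ) ^ (a * i) = α ^ i := fun i => by
    rw [hα, Real.rpow_mul_natCast (by norm_num)]
  have hβi : ∀ i : ℕ, (2 : ℝ) ^ (-(b * i)) = β ^ i := fun i => by
    rw [hβ, ← neg_mul, Real.rpow_mul_natCast (by norm_num)]
  refine ⟨α / (α - 1) + 1 / (1 - β), by
    have : 0 < α - 1 := by linarith
    have : 0 < 1 - β := by linarith
    positivity, fun s f A B hA hB h1 h2 => ?_⟩
  set x : ℝ := (B / A) ^ (1 / (a + b)) with hx
  have hab : 0 < a + b := by linarith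
  have hx0 : 0 < x := by positivity
  have hsum : a / (a + b) = 1 - b / (a + b) := by field_simp; ring
  have eA : A * x ^ a = A ^ (b / (a + b)) * B ^ (a / (a + b)) := by
    rw [hx, ← Real.rpow_mul (by positivity), one_div_mul_eq_div, Real.div_rpow hB.le hA.le, hsum,
      Real.rpow_sub hA, Real.rpow_one]
    field_simp
  have eB : B * x ^ (-b) = A ^ (b / (a + b)) * B ^ (a / (a + b)) := by
    rw [hx, ← Real.rpow_mul (by positivity), mul_neg, one_div_mul_eq_div, Real.rpow_neg
      (by positivity), Real.div_rpow hB.le hA.le, hsum, Real.rpow_sub hB, Real.rpow_one]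
    field_simp
  obtain ⟨k, hk1, hk2⟩ : ∃ k : ℕ, α ^ k - 1 ≤ α * x ^ a ∧ β ^ k ≤ x ^ (-b) := by
    rcases le_total 1 x with h | h
    · obtain ⟨k, hk1, hk2⟩ := exists_nat_pow_near h (by norm_num : (1 : ℝ) < 2)
      refine ⟨k + 1, ?_, ?_⟩
      · have : α ^ k ≤ x ^ a := by
          rw [← hαi, mul_comm, Real.rpow_natCast_mul (by norm_num)]
          exact Real.rpow_le_rpow (by positivity) hk1 ha.le
        rw [pow_succ']
        nlinarith
      · rw [← hβi, ← mul_neg_one, mul_comm b, mul_assoc, Real.rpow_natCast_mul (by norm_num),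
          mul_neg_one]
        exact Real.rpow_le_rpow_of_nonpos hx0 hk2.le (by linarith)
    · refine ⟨0, ?_, ?_⟩
      · rw [pow_zero, sub_self]; positivity
      · rw [pow_zero]
        exact Real.one_le_rpow_of_pos_of_le_one_of_nonpos hx0 h (by linarith)
  have hlow : ∑ i ∈ s.filter (· < k), f i ≤ A * ((α ^ k - 1) / (α - 1)) := by
    rw [← geom_sum_eq hα1.ne', Finset.mul_sum]
    calc ∑ i ∈ s.filter (· < k), f i ≤ ∑ i ∈ s.filter (· < k), A * α ^ i :=
          Finset.sum_le_sum fun i hi => by rw [← hαi]; exact h1 i (Finset.mem_filter.1 hi).1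
      _ ≤ _ := by
          refine Finset.sum_le_sum_of_subset_of_nonneg (fun i hi => ?_) fun _ _ _ => by positivity
          exact Finset.mem_range.2 (Finset.mem_filter.1 hi).2
  have hhigh : ∑ i ∈ s.filter (fun i => ¬ i < k), f i ≤ B * (β ^ k / (1 - β)) := by
    calc ∑ i ∈ s.filter (fun i => ¬ i < k), f i ≤
        ∑ i ∈ s.filter (fun i => ¬ i < k), B * β ^ i :=
          Finset.sum_le_sum fun i hi => by rw [← hβi]; exact h2 i (Finset.mem_filter.1 hi).1
      _ ≤ ∑ i ∈ Finset.Ico k (s.sup id + 1), B * β ^ i := by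
          refine Finset.sum_le_sum_of_subset_of_nonneg (fun i hi => ?_) fun _ _ _ => by positivity
          obtain ⟨his, hik⟩ := Finset.mem_filter.1 hi
          exact Finset.mem_Ico.2 ⟨not_lt.1 hik, Nat.lt_succ_of_le (Finset.le_sup (f := id) his)⟩
      _ ≤ _ := by
          rw [← Finset.mul_sum]
          exact mul_le_mul_of_nonneg_left (geom_sum_Ico_le_of_lt_one hβ0.le hβ1) hB.le
  rw [← Finset.sum_filter_add_sum_filter_not s (· < k)]
  have h3 : A * ((α ^ k - 1) / (α - 1)) ≤ α / (α - 1) * (A * x ^ a) := by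
    have : (0 : ℝ) < α - 1 := by linarith
    calc A * ((α ^ k - 1) / (α - 1)) ≤ A * ((α * x ^ a) / (α - 1)) := by gcongr
      _ = _ := by ring
  have h4 : B * (β ^ k / (1 - β)) ≤ 1 / (1 - β) * (B * x ^ (-b)) := by
    have : (0 : ℝ) < 1 - β := by linarith
    calc B * (β ^ k / (1 - β)) ≤ B * (x ^ (-b) / (1 - β)) := by gcongr
      _ = _ := by ring
  rw [eA] at h3
  rw [eB] at h4
  rw [add_mul]
  linarith

lemma exists_sum_le_rpow : ∃ C : ℝ, 0 < C ∧ ∀ (κ N n : ℝ) (s : Finset ℕ) (f : ℕ → ℝ), 0 < κ →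
    0 < N → 0 < n → (∀ i ∈ s, 0 ≤ f i) → (∀ i ∈ s, f i ≤ 2 ^ i * N) →
    (∀ i ∈ s, f i ^ 4 * (2 ^ i) ^ 11 ≤ κ * n ^ 11) →
    ∑ i ∈ s, f i ≤ C * κ ^ (1 / 15 : ℝ) * (N * n) ^ (11 / 15 : ℝ) := by
  obtain ⟨C, hC, hgeom⟩ := exists_sum_le_of_le_geom (a := 1) (b := 11 / 4) one_pos (by norm_num)
  refine ⟨C, hC, fun κ N n s f hκ hN hn hf h1 h2 => ?_⟩
  have h3 := hgeom s f N ((κ * n ^ 11) ^ (1 / 4 : ℝ)) hN (by positivity) ?_ ?_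
  · refine h3.trans (le_of_eq ?_)
    rw [← Real.rpow_mul (by positivity), Real.mul_rpow hκ.le (by positivity),
      ← Real.rpow_natCast n 11, ← Real.rpow_mul hn.le, Real.mul_rpow hN.le hn.le]
    norm_num
    ring
  · intro i hi
    rw [one_mul, Real.rpow_natCast, mul_comm]
    exact h1 i hi
  · intro i hi
    rw [Real.rpow_neg (by norm_num), ← div_eq_mul_inv, le_div_iff₀ (by positivity), one_div]
    have h4 : ((2 : ℝ) ^ (11 / 4 * i : ℝ)) ^ 4 = (2 ^ i) ^ 11 := by
      rw [← Real.rpow_mul_natCast (by norm_num), ← pow_mul, ← Real.rpow_natCast]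
      congr 1
      push_cast
      ring
    have h5 := hf i hi
    refine (Real.le_rpow_inv_iff_of_pos (by positivity) (by positivity) (by norm_num)).2 ?_
    rw [show (4 : ℝ) = ((4 : ℕ) : ℝ) by norm_num, Real.rpow_natCast, mul_pow]
    have h6 := h2 i hi
    rw [← h4] at h6
    exact_mod_cast h6

end Dyadic

section IncidenceBound

lemma natLog_le {N : ℕ} (hN : 1 ≤ N) : (Nat.log 2 N : ℝ) ≤ Real.log N / Real.log 2 := by
  rw [le_div_iff₀ (Real.log_pos one_lt_two), ← Real.log_pow]
  refine Real.log_le_log (by positivity) ?_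
  exact_mod_cast Nat.pow_log_le_self 2 (by omega)

lemma half_lt_log_two : (1 / 2 : ℝ) < Real.log 2 := by
  have := Real.log_two_gt_d9
  linarith

set_option maxHeartbeats 1000000 in
open Classical in
/-- An upper bound for the number of incidences between points and lines. -/
theorem exists_inc_le : ∃ C : ℝ, 0 < C ∧ ∀ (p : ℕ) [Fact p.Prime]
    (L : Finset (Set (ZMod p × ZMod p))) (E : Finset (ZMod p × ZMod p)), (∀ l ∈ L, IsLine l) →
    2 ≤ E.card → (inc (fun w (l : Set (ZMod p × ZMod p)) => w ∈ l) E L : ℝ) ≤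
      C * (E.card + L.card * E.card / p + (E.card * L.card : ℝ) ^ (11 / 15 : ℝ) +
        L.card * Real.log E.card) := by
  obtain ⟨C₀, hC₀, hgeom⟩ := exists_sum_le_rpow
  obtain ⟨κ, hκ⟩ : ∃ κ : ℝ, κ = 2 ^ 80 * 972 ^ 16 := ⟨_, rfl⟩
  have hκ0 : 0 < κ := by rw [hκ]; positivity
  refine ⟨100 + 2 * C₀ * κ ^ (1 / 15 : ℝ), by positivity, fun p _ L E hL hE => ?_⟩
  set N := E.card with hN
  set n := L.card with hn
  have hp : (0 : ℝ) < p := by exact_mod_cast (Fact.out : p.Prime).pos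
  rcases Nat.eq_zero_or_pos n with hn0 | hn0
  · have h0 : inc (fun w (l : Set (ZMod p × ZMod p)) => w ∈ l) E L = 0 := by
      have := inc_le_mul (fun w (l : Set (ZMod p × ZMod p)) => w ∈ l) E L
      rw [← hn, hn0, mul_zero] at this
      omega
    rw [h0, hn0]
    have : 0 ≤ Real.log N := Real.log_natCast_nonneg N
    push_cast
    positivity
  have hNR : (2 : ℝ) ≤ N := by exact_mod_cast hE
  have hnR : (1 : ℝ) ≤ n := by exact_mod_cast hn0
  have hlin : ∀ w ∈ E, ∀ w' ∈ E, w ≠ w' → ∀ l ∈ L, ∀ l' ∈ L, w ∈ l → w' ∈ l → w ∈ l' → w' ∈ l' →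
      l = l' := fun w _ w' _ hww l hl l' hl' h1 h2 h3 h4 =>
    (hL l hl).eq_of_mem (hL l' hl') hww h1 h2 h3 h4
  set deg : ZMod p × ZMod p → ℕ := fun w => (L.filter fun l => w ∈ l).card with hdeg
  set H := E.filter fun w => 2 * N ≤ deg w with hH
  have hHsum : ∑ w ∈ H, (deg w : ℝ) ≤ 2 * n := by
    have hHE : H ⊆ E := Finset.filter_subset _ _
    have h1 : (inc (fun w (l : Set (ZMod p × ZMod p)) => w ∈ l) H L : ℝ) ^ 2 ≤
        n * (inc (fun w (l : Set (ZMod p × ZMod p)) => w ∈ l) H L + (H.card : ℝ) ^ 2) := by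
      exact_mod_cast inc_sq_le fun w hw w' hw' => hlin w (hHE hw) w' (hHE hw')
    have h2 : 2 * N * H.card ≤ inc (fun w (l : Set (ZMod p × ZMod p)) => w ∈ l) H L :=
      mul_le_inc fun w hw => (Finset.mem_filter.1 hw).2
    have h3 : H.card ≤ N := Finset.card_le_card hHE
    have h4 : (inc (fun w (l : Set (ZMod p × ZMod p)) => w ∈ l) H L : ℝ) =
        ∑ w ∈ H, (deg w : ℝ) := by rw [inc]; push_cast; rfl
    rw [← h4]
    have h5 : 2 * H.card ^ 2 ≤ inc (fun w (l : Set (ZMod p × ZMod p)) => w ∈ l) H L :=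
      le_trans (by nlinarith) h2
    have h6 : 2 * (H.card : ℝ) ^ 2 ≤ inc (fun w (l : Set (ZMod p × ZMod p)) => w ∈ l) H L := by
      exact_mod_cast h5
    set J : ℝ := (inc (fun w (l : Set (ZMod p × ZMod p)) => w ∈ l) H L : ℝ)
    by_contra hcon
    rw [not_le] at hcon
    nlinarith
  set K := Nat.log 2 (2 * N) + 1 with hK
  set s := (Finset.range K).filter fun i => 1 ≤ i ∧ 2 * n ≤ 2 ^ i * p with hs
  set D : ℕ → Finset (ZMod p × ZMod p) := fun i =>
    E.filter fun w => 2 ^ i ≤ deg w ∧ deg w < 2 ^ (i + 1) with hD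
  set f : ℕ → ℝ := fun i => 2 ^ i * (D i).card with hf
  have hpt : ∀ w ∈ E, (deg w : ℝ) ≤ 1 + 4 * n / p + (if 2 * N ≤ deg w then (deg w : ℝ) else 0) +
      ∑ i ∈ s, (if 2 ^ i ≤ deg w ∧ deg w < 2 ^ (i + 1) then (2 * 2 ^ i : ℝ) else 0) := by
    intro w hw
    have hS0 : 0 ≤ ∑ i ∈ s, (if 2 ^ i ≤ deg w ∧ deg w < 2 ^ (i + 1) then (2 * 2 ^ i : ℝ) else 0) :=
      Finset.sum_nonneg fun i _ => by split_ifs <;> positivity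
    have hnp : (0 : ℝ) ≤ 4 * n / p := by positivity
    by_cases h2N : 2 * N ≤ deg w
    · rw [if_pos h2N]; linarith
    rw [if_neg h2N]
    rcases Nat.lt_or_ge (deg w) 2 with h1 | h1
    · have : (deg w : ℝ) ≤ 1 := by exact_mod_cast Nat.lt_succ_iff.1 h1
      linarith
    set i := Nat.log 2 (deg w) with hi
    have hi1 : 2 ^ i ≤ deg w := Nat.pow_log_le_self 2 (by omega)
    have hi2 : deg w < 2 ^ (i + 1) := Nat.lt_pow_succ_log_self one_lt_two _
    have hi3 : (deg w : ℝ) ≤ 2 * 2 ^ i := by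
      have : deg w ≤ 2 * 2 ^ i := by rw [← pow_succ']; exact hi2.le
      exact_mod_cast this
    by_cases hip : 2 * n ≤ 2 ^ i * p
    · have his : i ∈ s := by
        refine Finset.mem_filter.2 ⟨Finset.mem_range.2 ?_, ?_, hip⟩
        · exact Nat.lt_succ_of_le (Nat.log_mono_right (by omega))
        · exact Nat.log_pos one_lt_two h1
      have := Finset.single_le_sum (f := fun i =>
        (if 2 ^ i ≤ deg w ∧ deg w < 2 ^ (i + 1) then (2 * 2 ^ i : ℝ) else 0))
        (fun i _ => by split_ifs <;> positivity) his
      simp only [hi1, hi2, and_self, if_true] at this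
      linarith
    · have h3 : (2 ^ i * p : ℝ) ≤ 2 * n := by exact_mod_cast (not_le.1 hip).le
      have h4 : (2 * 2 ^ i : ℝ) ≤ 4 * n / p := by
        rw [le_div_iff₀ hp]; linarith
      linarith
  have htotal : (inc (fun w (l : Set (ZMod p × ZMod p)) => w ∈ l) E L : ℝ) ≤
      N + 4 * (n * N / p) + 2 * n + 2 * ∑ i ∈ s, f i := by
    have h1 : (inc (fun w (l : Set (ZMod p × ZMod p)) => w ∈ l) E L : ℝ) = ∑ w ∈ E, (deg w : ℝ) := by
      rw [inc]; push_cast; rfl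
    rw [h1]
    refine (Finset.sum_le_sum hpt).trans ?_
    rw [Finset.sum_add_distrib, Finset.sum_add_distrib, Finset.sum_const, ← Finset.sum_filter,
      Finset.sum_comm, nsmul_eq_mul]
    have h2 : ∑ i ∈ s, ∑ w ∈ E, (if 2 ^ i ≤ deg w ∧ deg w < 2 ^ (i + 1) then (2 * 2 ^ i : ℝ) else 0)
        = 2 * ∑ i ∈ s, f i := by
      rw [Finset.mul_sum]
      refine Finset.sum_congr rfl fun i _ => ?_
      rw [← Finset.sum_filter, Finset.sum_const, nsmul_eq_mul]
      simp only [hf, hD]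
      ring
    rw [h2]
    have h3 : (E.card : ℝ) * (1 + 4 * n / p) = N + 4 * (n * N / p) := by rw [← hN]; ring
    linarith
  have hsplit : ∑ i ∈ s, f i ≤ K * (4 * n) + C₀ * κ ^ (1 / 15 : ℝ) * (N * n : ℝ) ^ (11 / 15 : ℝ) := by
    rw [← Finset.sum_filter_add_sum_filter_not s fun i => f i ≤ 4 * n]
    refine add_le_add ?_ ?_
    · calc ∑ i ∈ s.filter fun i => f i ≤ 4 * n, f i ≤ (s.filter fun i => f i ≤ 4 * n).card • (4 * n : ℝ) :=
            Finset.sum_le_card_nsmul _ _ _ fun i hi => (Finset.mem_filter.1 hi).2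
        _ ≤ K * (4 * n) := by
            rw [nsmul_eq_mul]
            have h1 : (s.filter fun i => f i ≤ 4 * n).card ≤ K := by
              refine (Finset.card_filter_le _ _).trans ((Finset.card_filter_le _ _).trans ?_)
              rw [Finset.card_range]
            have h2 : ((s.filter fun i => f i ≤ 4 * n).card : ℝ) ≤ K := by exact_mod_cast h1
            gcongr
    · refine hgeom κ N n _ f hκ0 (by linarith) (by linarith) ?_ ?_ ?_
      · intro i _
        simp only [hf]; positivity
      · intro i hi
        simp only [hf]
        have : ((D i).card : ℝ) ≤ N := by exact_mod_cast Finset.card_filter_le _ _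
        gcongr
      · intro i hi
        obtain ⟨his, hi4⟩ := Finset.mem_filter.1 hi
        obtain ⟨-, hi1, hip⟩ := Finset.mem_filter.1 his
        have h2 := card_rich_points_le hL (P := D i) (r := 2 ^ i)
          (by calc 2 = 2 ^ 1 := rfl
                _ ≤ 2 ^ i := Nat.pow_le_pow_right two_pos hi1) hip
          (fun w hw => by
            obtain ⟨-, h1, h2⟩ := Finset.mem_filter.1 hw
            exact ⟨h1, by rw [← pow_succ']; exact h2.le⟩)
        rcases h2 with h2 | h2
        · refine absurd ?_ hi4
          simp only [hf]
          exact_mod_cast h2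
        · rw [hκ]
          refine le_trans (le_of_eq ?_) h2
          simp only [hf]
          push_cast
          ring
  have hKlog : (K : ℝ) ≤ 6 * Real.log N := by
    have h1 : K = Nat.log 2 N + 2 := by
      rw [hK, mul_comm, Nat.log_mul_base one_lt_two (by omega)]
    have h2 := natLog_le (N := N) (by omega)
    have h3 := Real.log_le_log (by norm_num) hNR
    have h4 : Real.log N / Real.log 2 ≤ 2 * Real.log N := by
      rw [div_le_iff₀ (by linarith [half_lt_log_two])]
      nlinarith [half_lt_log_two]
    rw [h1]
    push_cast
    linarith [half_lt_log_two]
  have hlog : 1 ≤ 2 * Real.log N := by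
    have := Real.log_le_log (by norm_num) hNR
    linarith [half_lt_log_two]
  have hc : 0 < C₀ * κ ^ (1 / 15 : ℝ) := by positivity
  set c' := C₀ * κ ^ (1 / 15 : ℝ)
  set U := (N * n : ℝ) ^ (11 / 15 : ℝ) with hU
  have hU0 : 0 ≤ U := by positivity
  have hV0 : 0 ≤ (n * N / p : ℝ) := by positivity
  have h1 : (K : ℝ) * (4 * n) ≤ 6 * Real.log N * (4 * n) := by gcongr
  have h2 : (n : ℝ) ≤ 2 * (n * Real.log N) := by nlinarith
  have h3 : 0 ≤ n * Real.log N := by linarith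
  have h4 : (inc (fun w (l : Set (ZMod p × ZMod p)) => w ∈ l) E L : ℝ) ≤
    N + 4 * (n * N / p) + 2 * c' * U + 52 * (n * Real.log N) := by linarith
  refine h4.trans ?_
  have h5 : 0 ≤ 2 * c' * (N + n * N / p + n * Real.log N) := by positivity
  rw [mul_assoc 2 C₀]
  change _ ≤ (100 + 2 * c') * _
  nlinarith
end IncidenceBound

section WeightedSum

/-- A finite set of lines in `F_p²` has at most `2 p²` elements. -/
lemma card_le_of_isLine {p : ℕ} [Fact p.Prime] {L : Finset (Set (ZMod p × ZMod p))}
    (hL : ∀ l ∈ L, IsLine l) : L.card ≤ 2 * p ^ 2 := by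
  classical
  let g : Bool × ZMod p × ZMod p → Set (ZMod p × ZMod p) := fun q =>
    if q.1 then {w | w.1 + q.2.1 * w.2 + q.2.2 = 0} else {w | q.2.1 * w.1 + w.2 + q.2.2 = 0}
  have hsub : L ⊆ Finset.univ.image g := by
    intro l hl
    obtain ⟨a, b, c, hab, h⟩ := hL l hl
    rw [Finset.mem_image]
    rcases hab with ha | hb
    · refine ⟨(true, b / a, c / a), Finset.mem_univ _, ?_⟩
      ext w
      simp only [g, if_true, Set.mem_ofPred_eq]
      rw [h w, ← mul_right_inj' ha (b := w.1 + b / a * w.2 + c / a), mul_zero]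
      have : a * (w.1 + b / a * w.2 + c / a) = a * w.1 + b * w.2 + c := by field_simp
      rw [this]
    · refine ⟨(false, a / b, c / b), Finset.mem_univ _, ?_⟩
      ext w
      simp only [g, Bool.false_eq_true, if_false, Set.mem_ofPred_eq]
      rw [h w, ← mul_right_inj' hb (b := a / b * w.1 + w.2 + c / b), mul_zero]
      have : b * (a / b * w.1 + w.2 + c / b) = a * w.1 + b * w.2 + c := by field_simp
      rw [this]
  refine (Finset.card_le_card hsub).trans (Finset.card_image_le.trans ?_)
  rw [Finset.card_univ, Fintype.card_prod, Fintype.card_prod, Fintype.card_bool, ZMod.card, sq]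

/-- Dyadic level sets of a weight: each is bounded in terms of the first two moments. -/
lemma exists_sum_dyadic_le : ∃ C : ℝ, 0 < C ∧ ∀ (s : Finset ℕ) (n : ℕ → ℝ) (W Q : ℝ), 0 < W →
    0 < Q → (∀ j ∈ s, 0 ≤ n j) → (∀ j ∈ s, 2 ^ j * n j ≤ W) → (∀ j ∈ s, 4 ^ j * n j ≤ Q) →
    ∑ j ∈ s, 2 ^ j * n j ^ (11 / 15 : ℝ) ≤ C * (W ^ (7 / 15 : ℝ) * Q ^ (4 / 15 : ℝ)) := by
  obtain ⟨C, hC, h⟩ := exists_sum_le_of_le_geom (a := 4 / 15) (b := 7 / 15) (by norm_num)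
    (by norm_num)
  refine ⟨C, hC, fun s n W Q hW hQ hn h1 h2 => ?_⟩
  have key := h s (fun j => 2 ^ j * n j ^ (11 / 15 : ℝ)) (W ^ (11 / 15 : ℝ)) (Q ^ (11 / 15 : ℝ))
    (by positivity) (by positivity) ?_ ?_
  · refine key.trans (le_of_eq ?_)
    rw [← Real.rpow_mul hW.le, ← Real.rpow_mul hQ.le]
    norm_num
  · intro j hj
    have h3 : n j ≤ W * (2 : ℝ) ^ (-(j : ℝ)) := by
      rw [Real.rpow_neg (by norm_num), Real.rpow_natCast, ← div_eq_mul_inv,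
        le_div_iff₀ (by positivity), mul_comm]
      exact h1 j hj
    have h4 := Real.rpow_le_rpow (hn j hj) h3 (by norm_num : (0 : ℝ) ≤ 11 / 15)
    rw [Real.mul_rpow hW.le (by positivity), ← Real.rpow_mul (by norm_num)] at h4
    calc (2 : ℝ) ^ j * n j ^ (11 / 15 : ℝ)
        ≤ (2 : ℝ) ^ (j : ℝ) * (W ^ (11 / 15 : ℝ) * 2 ^ (-(j : ℝ) * (11 / 15))) := by
          rw [Real.rpow_natCast]
          gcongr
      _ = W ^ (11 / 15 : ℝ) * (2 ^ (j : ℝ) * 2 ^ (-(j : ℝ) * (11 / 15))) := by ring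
      _ = _ := by
          rw [← Real.rpow_add (by norm_num)]
          congr 2
          ring
  · intro j hj
    have h3 : n j ≤ Q * (2 : ℝ) ^ (-(2 * j : ℝ)) := by
      rw [Real.rpow_neg (by norm_num), Real.rpow_mul (by norm_num), Real.rpow_natCast,
        ← div_eq_mul_inv, le_div_iff₀ (by positivity), mul_comm]
      have := h2 j hj
      norm_num
      exact this
    have h4 := Real.rpow_le_rpow (hn j hj) h3 (by norm_num : (0 : ℝ) ≤ 11 / 15)
    rw [Real.mul_rpow hQ.le (by positivity), ← Real.rpow_mul (by norm_num)] at h4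
    calc (2 : ℝ) ^ j * n j ^ (11 / 15 : ℝ)
        ≤ (2 : ℝ) ^ (j : ℝ) * (Q ^ (11 / 15 : ℝ) * 2 ^ (-(2 * j : ℝ) * (11 / 15))) := by
          rw [Real.rpow_natCast]
          gcongr
      _ = Q ^ (11 / 15 : ℝ) * (2 ^ (j : ℝ) * 2 ^ (-(2 * j : ℝ) * (11 / 15))) := by ring
      _ = _ := by
          rw [← Real.rpow_add (by norm_num)]
          congr 2
          ring

lemma mul_div_le_rpow {N p W Q : ℝ} (hN : 0 < N) (hp : 0 < p) (hW : 0 < W) (hQ : 0 < Q)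
    (hNp : N ≤ p ^ (7 / 4 : ℝ)) (hWN : W ≤ N ^ 2) (hWQ : W ^ 2 ≤ 2 * p ^ 2 * Q) :
    W * N / p ≤ 2 * (N ^ (5 / 3 : ℝ) * Q ^ (4 / 15 : ℝ)) := by
  have h1 : W ^ (7 / 15 : ℝ) ≤ N ^ (14 / 15 : ℝ) := by
    refine (Real.rpow_le_rpow hW.le hWN (by norm_num)).trans (le_of_eq ?_)
    rw [← Real.rpow_natCast N 2, ← Real.rpow_mul hN.le]
    norm_num
  have h2 : W ^ (8 / 15 : ℝ) ≤ 2 * p ^ (8 / 15 : ℝ) * Q ^ (4 / 15 : ℝ) := by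
    have h := Real.rpow_le_rpow (by positivity) hWQ (by norm_num : (0 : ℝ) ≤ 4 / 15)
    rw [← Real.rpow_natCast W 2, ← Real.rpow_mul hW.le, Real.mul_rpow (by positivity) hQ.le,
      Real.mul_rpow (by norm_num) (by positivity), ← Real.rpow_natCast p 2,
      ← Real.rpow_mul hp.le] at h
    norm_num at h
    refine h.trans ?_
    have : (2 : ℝ) ^ (4 / 15 : ℝ) ≤ 2 ^ (1 : ℝ) :=
      Real.rpow_le_rpow_of_exponent_le (by norm_num) (by norm_num)
    rw [Real.rpow_one] at this
    gcongr
  have h3 : N ^ (4 / 15 : ℝ) ≤ p ^ (7 / 15 : ℝ) := by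
    refine (Real.rpow_le_rpow hN.le hNp (by norm_num)).trans (le_of_eq ?_)
    rw [← Real.rpow_mul hp.le]
    norm_num
  have hWe : W = W ^ (7 / 15 : ℝ) * W ^ (8 / 15 : ℝ) := by
    rw [← Real.rpow_add hW]; norm_num
  have hpe : p = p ^ (7 / 15 : ℝ) * p ^ (8 / 15 : ℝ) := by
    rw [← Real.rpow_add hp]; norm_num
  have hNe : N ^ (14 / 15 : ℝ) * N = N ^ (5 / 3 : ℝ) * N ^ (4 / 15 : ℝ) := by
    rw [← Real.rpow_add hN, ← Real.rpow_add_one hN.ne']; norm_num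
  rw [div_le_iff₀ hp]
  calc W * N = W ^ (7 / 15 : ℝ) * W ^ (8 / 15 : ℝ) * N := by rw [← hWe]
    _ ≤ N ^ (14 / 15 : ℝ) * (2 * p ^ (8 / 15 : ℝ) * Q ^ (4 / 15 : ℝ)) * N := by gcongr
    _ = 2 * (N ^ (14 / 15 : ℝ) * N) * p ^ (8 / 15 : ℝ) * Q ^ (4 / 15 : ℝ) := by ring
    _ = 2 * (N ^ (5 / 3 : ℝ) * N ^ (4 / 15 : ℝ)) * p ^ (8 / 15 : ℝ) * Q ^ (4 / 15 : ℝ) := by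
        rw [hNe]
    _ ≤ 2 * (N ^ (5 / 3 : ℝ) * p ^ (7 / 15 : ℝ)) * p ^ (8 / 15 : ℝ) * Q ^ (4 / 15 : ℝ) := by
        gcongr
    _ = 2 * (N ^ (5 / 3 : ℝ) * Q ^ (4 / 15 : ℝ)) * (p ^ (7 / 15 : ℝ) * p ^ (8 / 15 : ℝ)) := by ring
    _ = _ := by rw [← hpe]

lemma rpow_mul_rpow_le {N W Q : ℝ} (hN : 0 < N) (hW : 0 < W) (hQ : 0 < Q) (hWN : W ≤ N ^ 2) :
    N ^ (11 / 15 : ℝ) * (W ^ (7 / 15 : ℝ) * Q ^ (4 / 15 : ℝ)) ≤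
      N ^ (5 / 3 : ℝ) * Q ^ (4 / 15 : ℝ) := by
  have h1 : W ^ (7 / 15 : ℝ) ≤ N ^ (14 / 15 : ℝ) := by
    refine (Real.rpow_le_rpow hW.le hWN (by norm_num)).trans (le_of_eq ?_)
    rw [← Real.rpow_natCast N 2, ← Real.rpow_mul hN.le]
    norm_num
  calc N ^ (11 / 15 : ℝ) * (W ^ (7 / 15 : ℝ) * Q ^ (4 / 15 : ℝ))
      ≤ N ^ (11 / 15 : ℝ) * (N ^ (14 / 15 : ℝ) * Q ^ (4 / 15 : ℝ)) := by gcongr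
    _ = (N ^ (11 / 15 : ℝ) * N ^ (14 / 15 : ℝ)) * Q ^ (4 / 15 : ℝ) := by ring
    _ = _ := by rw [← Real.rpow_add hN]; norm_num

/-- The weights `w` on the dyadic level sets `⌊log₂ w⌋ = j`, weighed against a function `g`. -/
lemma sum_mul_le_sum_dyadic {α : Type*} (L : Finset α) (w g : α → ℕ) {N : ℕ}
    (hw : ∀ l ∈ L, 1 ≤ w l ∧ w l ≤ N) :
    ∑ l ∈ L, w l * g l ≤ ∑ j ∈ Finset.range (Nat.log 2 N + 1),
      2 ^ (j + 1) * ∑ l ∈ L.filter fun l => Nat.log 2 (w l) = j, g l := by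
  have hmaps : ∀ l ∈ L, Nat.log 2 (w l) ∈ Finset.range (Nat.log 2 N + 1) := fun l hl =>
    Finset.mem_range.2 (Nat.lt_succ_of_le (Nat.log_mono_right (hw l hl).2))
  rw [← Finset.sum_fiberwise_of_maps_to hmaps]
  refine Finset.sum_le_sum fun j _ => ?_
  rw [Finset.mul_sum]
  refine Finset.sum_le_sum fun l hl => Nat.mul_le_mul_right _ ?_
  obtain ⟨-, hj⟩ := Finset.mem_filter.1 hl
  rw [← hj]
  exact (Nat.lt_pow_succ_log_self one_lt_two _).le

lemma sum_pow_mul_card_le {α : Type*} (L : Finset α) (w : α → ℕ) {N : ℕ} (k : ℕ)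
    (hw : ∀ l ∈ L, 1 ≤ w l ∧ w l ≤ N) :
    ∑ j ∈ Finset.range (Nat.log 2 N + 1),
      (2 ^ j) ^ k * (L.filter fun l => Nat.log 2 (w l) = j).card ≤ ∑ l ∈ L, w l ^ k := by
  have hmaps : ∀ l ∈ L, Nat.log 2 (w l) ∈ Finset.range (Nat.log 2 N + 1) := fun l hl =>
    Finset.mem_range.2 (Nat.lt_succ_of_le (Nat.log_mono_right (hw l hl).2))
  rw [← Finset.sum_fiberwise_of_maps_to hmaps]
  refine Finset.sum_le_sum fun j _ => ?_
  rw [mul_comm, ← smul_eq_mul]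
  refine Finset.card_nsmul_le_sum _ _ _ fun l hl => ?_
  obtain ⟨hlL, hj⟩ := Finset.mem_filter.1 hl
  refine Nat.pow_le_pow_left ?_ k
  rw [← hj]
  exact Nat.pow_log_le_self 2 (by have := (hw l hlL).1; omega)

set_option maxHeartbeats 1000000 in
open Classical in
/-- A weighted incidence bound for lines with multiplicities. -/
theorem exists_weighted_inc_le : ∃ C : ℝ, 0 < C ∧ ∀ (p : ℕ) [Fact p.Prime]
    (L : Finset (Set (ZMod p × ZMod p))) (E : Finset (ZMod p × ZMod p))
    (w : Set (ZMod p × ZMod p) → ℕ) (Q : ℕ), (∀ l ∈ L, IsLine l) → 2 ≤ E.card →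
    (E.card : ℝ) ≤ (p : ℝ) ^ (7 / 4 : ℝ) → (∀ l ∈ L, 1 ≤ w l ∧ w l ≤ E.card) →
    ∑ l ∈ L, w l ≤ E.card ^ 2 → ∑ l ∈ L, w l ^ 2 ≤ Q →
    ((∑ l ∈ L, w l * (E.filter fun x => x ∈ l).card : ℕ) : ℝ) ≤
      C * ((E.card : ℝ) ^ 2 * Real.log E.card + (E.card : ℝ) ^ (5 / 3 : ℝ) * (Q : ℝ) ^ (4 / 15 : ℝ)) := by
  obtain ⟨C₁, hC₁, hinc⟩ := exists_inc_le
  obtain ⟨C₂, hC₂, hdy⟩ := exists_sum_dyadic_le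
  refine ⟨2 * C₁ * (5 + 2 + C₂), by positivity, fun p _ L E w Q hL hE hEp hw hW hQ => ?_⟩
  have hp : (0 : ℝ) < p := by exact_mod_cast (Fact.out : p.Prime).pos
  have hNR : (2 : ℝ) ≤ E.card := by exact_mod_cast hE
  have hN0 : (0 : ℝ) < E.card := by linarith
  have hlog : 1 ≤ 2 * Real.log E.card := by
    have := Real.log_le_log (by norm_num) hNR
    linarith [half_lt_log_two]
  rcases L.eq_empty_or_nonempty with rfl | hne
  · rw [Finset.sum_empty, Nat.cast_zero]
    have : 0 ≤ Real.log E.card := by linarith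
    positivity
  set D : ℕ → Finset (Set (ZMod p × ZMod p)) := fun j => L.filter fun l => Nat.log 2 (w l) = j with hD
  set s := Finset.range (Nat.log 2 E.card + 1) with hs
  obtain ⟨W, hWdef⟩ : ∃ W : ℝ, W = ((∑ l ∈ L, w l : ℕ) : ℝ) := ⟨_, rfl⟩
  have hLW : L.card ≤ ∑ l ∈ L, w l := by
    rw [Finset.card_eq_sum_ones]
    exact Finset.sum_le_sum fun l hl => (hw l hl).1
  have hWpos : 0 < ∑ l ∈ L, w l := lt_of_lt_of_le hne.card_pos hLW
  have hW0 : 0 < W := by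
    rw [hWdef]
    exact_mod_cast hWpos
  have hQpos : 0 < Q := by
    refine lt_of_lt_of_le hWpos (le_trans (Finset.sum_le_sum fun l _ => ?_) hQ)
    exact Nat.le_self_pow two_ne_zero _
  have hQ0 : (0 : ℝ) < Q := by exact_mod_cast hQpos
  have hWN : W ≤ (E.card : ℝ) ^ 2 := by
    rw [hWdef]
    exact_mod_cast hW
  have hWQ : W ^ 2 ≤ 2 * (p : ℝ) ^ 2 * Q := by
    have h1 : (∑ l ∈ L, w l) ^ 2 ≤ 2 * p ^ 2 * Q :=
      (sq_sum_le_card_mul_sum_sq (s := L) (f := w)).trans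
        (Nat.mul_le_mul (card_le_of_isLine hL) hQ)
    rw [hWdef]
    exact_mod_cast h1
  have hm1 : ∑ j ∈ s, (2 : ℝ) ^ j * (D j).card ≤ W := by
    have := sum_pow_mul_card_le L w 1 hw
    simp only [pow_one] at this
    rw [hWdef]
    exact_mod_cast this
  have hm2 : ∑ j ∈ s, (4 : ℝ) ^ j * (D j).card ≤ Q := by
    have h1 := (sum_pow_mul_card_le L w 2 hw).trans hQ
    have h2 : ∀ j : ℕ, (2 ^ j) ^ 2 = 4 ^ j := fun j => by       rw [← pow_mul, mul_comm, pow_mul]; norm_num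
    simp only [h2] at h1
    exact_mod_cast h1
  have hdy' := hdy s (fun j => ((D j).card : ℝ)) W Q hW0 hQ0 (fun _ _ => by positivity)
    (fun j hj => (Finset.single_le_sum (f := fun j => (2 : ℝ) ^ j * (D j).card)
      (fun _ _ => by positivity) hj).trans hm1)
    (fun j hj => (Finset.single_le_sum (f := fun j => (4 : ℝ) ^ j * (D j).card)
      (fun _ _ => by positivity) hj).trans hm2)
  have hstep : ∀ j ∈ s, (2 : ℝ) ^ (j + 1) * (∑ l ∈ D j, (E.filter fun x => x ∈ l).card : ℕ) ≤
      2 * C₁ * (E.card * 2 ^ j + E.card / p * (2 ^ j * (D j).card) +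
        (E.card : ℝ) ^ (11 / 15 : ℝ) * (2 ^ j * ((D j).card : ℝ) ^ (11 / 15 : ℝ)) +
        Real.log E.card * (2 ^ j * (D j).card)) := by
    intro j _
    have h1 := hinc p (D j) E (fun l hl => hL l (Finset.filter_subset _ _ hl)) hE
    have h2 : inc (fun w (l : Set (ZMod p × ZMod p)) => w ∈ l) E (D j) =
        ∑ l ∈ D j, (E.filter fun x => x ∈ l).card := by
      rw [inc_comm]
    rw [h2, Real.mul_rpow (by positivity) (by positivity)] at h1
    calc (2 : ℝ) ^ (j + 1) * (∑ l ∈ D j, (E.filter fun x => x ∈ l).card : ℕ)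
        ≤ (2 : ℝ) ^ (j + 1) * (C₁ * (E.card + (D j).card * E.card / p +
          (E.card : ℝ) ^ (11 / 15 : ℝ) * ((D j).card : ℝ) ^ (11 / 15 : ℝ) +
          (D j).card * Real.log E.card)) := mul_le_mul_of_nonneg_left h1 (by positivity)
      _ = _ := by rw [pow_succ]; ring
  have hgeo : ∑ j ∈ s, (2 : ℝ) ^ j ≤ 2 * E.card := by
    have h1 : ∑ j ∈ s, 2 ^ j = 2 ^ (Nat.log 2 E.card + 1) - 1 := by
      rw [hs]; exact Nat.geomSum_eq le_rfl _ |>.trans (by norm_num)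
    have h2 : ∑ j ∈ s, 2 ^ j ≤ 2 * E.card := by
      have := Nat.pow_log_le_self 2 (x := E.card) (by omega)
      rw [h1, pow_succ]
      omega
    exact_mod_cast h2
  have htot : ((∑ l ∈ L, w l * (E.filter fun x => x ∈ l).card : ℕ) : ℝ) ≤
      2 * C₁ * (E.card * (2 * E.card) + E.card / p * W +
        (E.card : ℝ) ^ (11 / 15 : ℝ) * (C₂ * (W ^ (7 / 15 : ℝ) * (Q : ℝ) ^ (4 / 15 : ℝ))) +
        Real.log E.card * W) := by
    have h1 := sum_mul_le_sum_dyadic L w (fun l => (E.filter fun x => x ∈ l).card) hw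
    have h2 : ((∑ l ∈ L, w l * (E.filter fun x => x ∈ l).card : ℕ) : ℝ) ≤
        ∑ j ∈ s, (2 : ℝ) ^ (j + 1) * (∑ l ∈ D j, (E.filter fun x => x ∈ l).card : ℕ) := by
      exact_mod_cast h1
    refine h2.trans ((Finset.sum_le_sum hstep).trans ?_)
    rw [← Finset.mul_sum, Finset.sum_add_distrib, Finset.sum_add_distrib, Finset.sum_add_distrib,
      ← Finset.mul_sum, ← Finset.mul_sum, ← Finset.mul_sum, ← Finset.mul_sum]
    have : 0 ≤ Real.log E.card := by linarith
    gcongr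
  have hA := mul_div_le_rpow hN0 hp hW0 hQ0 hEp hWN hWQ
  have hB := rpow_mul_rpow_le hN0 hW0 hQ0 hWN
  set X := (E.card : ℝ) ^ (5 / 3 : ℝ) * (Q : ℝ) ^ (4 / 15 : ℝ) with hX
  set Y := (E.card : ℝ) ^ 2 * Real.log E.card with hY
  have hX0 : 0 ≤ X := by positivity
  have hNN : (E.card : ℝ) ^ 2 ≤ 2 * Y := by
    rw [hY]; nlinarith [sq_nonneg (E.card : ℝ)]
  have hY0 : 0 ≤ Y := by nlinarith [sq_nonneg (E.card : ℝ)]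
  refine htot.trans ?_
  rw [mul_assoc (2 * C₁)]
  refine mul_le_mul_of_nonneg_left ?_ (by positivity)
  have e1 : (E.card : ℝ) * (2 * E.card) ≤ 4 * Y := by nlinarith
  have e2 : (E.card : ℝ) / p * W ≤ 2 * X := by
    refine le_trans (le_of_eq ?_) hA
    ring
  have e3 : (E.card : ℝ) ^ (11 / 15 : ℝ) * (C₂ * (W ^ (7 / 15 : ℝ) * (Q : ℝ) ^ (4 / 15 : ℝ))) ≤
      C₂ * X := by
    calc _ = C₂ * ((E.card : ℝ) ^ (11 / 15 : ℝ) * (W ^ (7 / 15 : ℝ) * (Q : ℝ) ^ (4 / 15 : ℝ))) := by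
          ring
      _ ≤ _ := by gcongr
  have e4 : Real.log E.card * W ≤ Y := by
    rw [hY, mul_comm]
    have : 0 ≤ Real.log E.card := by linarith
    gcongr
  have e5 : 0 ≤ C₂ * Y := by positivity
  nlinarith

end WeightedSum

section Isosceles

variable {p : ℕ} [Fact p.Prime]

lemma mem_bisector {a b x : Pt p} : x ∈ bisector a b ↔
    2 * (b.1 - a.1) * x.1 + 2 * (b.2 - a.2) * x.2 +
      (a.1 ^ 2 + a.2 ^ 2 - b.1 ^ 2 - b.2 ^ 2) = 0 := by
  rw [bisector, Set.mem_ofPred_eq, dist2, dist2, ← sub_eq_zero]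
  constructor <;> intro h <;> linear_combination h

lemma isLine_bisector (h2 : (2 : ZMod p) ≠ 0) {a b : Pt p} (hab : dist2 a b ≠ 0) :
    IsLine (bisector a b) := by
  refine ⟨_, _, _, ?_, fun w => mem_bisector⟩
  by_contra! h
  obtain ⟨h3, h4⟩ := h
  refine hab ?_
  have h5 := (mul_eq_zero.1 h3).resolve_left h2
  have h6 := (mul_eq_zero.1 h4).resolve_left h2
  rw [dist2]
  linear_combination (-(a.1 - b.1)) * h5 - (a.2 - b.2) * h6

/-- A perpendicular bisector and one endpoint determine the other endpoint. -/
lemma eq_of_bisector_eq (h2 : (2 : ZMod p) ≠ 0) {a b b' : Pt p} (hab' : dist2 a b' ≠ 0)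
    (h : bisector a b = bisector a b') : b = b' := by
  obtain ⟨a₁, a₂⟩ := a
  obtain ⟨b₁, b₂⟩ := b
  obtain ⟨d₁, d₂⟩ := b'
  have key : ∀ x : Pt p, x ∈ bisector (a₁, a₂) (b₁, b₂) → x ∈ bisector (a₁, a₂) (d₁, d₂) :=
    fun x hx => h ▸ hx
  obtain ⟨t, ht⟩ : ∃ t : ZMod p, 2 * t = 1 := ⟨2⁻¹, mul_inv_cancel₀ h2⟩
  have m₁ := key (t * (a₁ + b₁), t * (a₂ + b₂)) (mem_bisector.2 (by
    linear_combination (b₁ ^ 2 - a₁ ^ 2 + b₂ ^ 2 - a₂ ^ 2) * ht))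
  have m₂ := key (t * (a₁ + b₁) - (b₂ - a₂), t * (a₂ + b₂) + (b₁ - a₁)) (mem_bisector.2 (by
    linear_combination (b₁ ^ 2 - a₁ ^ 2 + b₂ ^ 2 - a₂ ^ 2) * ht))
  rw [mem_bisector] at m₁ m₂
  simp only at m₁ m₂
  have hdot : (d₁ - a₁) * (b₁ - d₁) + (d₂ - a₂) * (b₂ - d₂) = 0 := by
    linear_combination m₁ - ((d₁ - a₁) * (a₁ + b₁) + (d₂ - a₂) * (a₂ + b₂)) * ht
  have hcross : (d₁ - a₁) * (b₂ - d₂) - (d₂ - a₂) * (b₁ - d₁) = 0 := by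
    refine (mul_eq_zero.1 (?_ : (2 : ZMod p) * _ = 0)).resolve_left h2
    linear_combination m₁ - m₂
  have hD : (d₁ - a₁) ^ 2 + (d₂ - a₂) ^ 2 ≠ 0 := by
    intro h0
    exact hab' (by rw [dist2]; linear_combination h0)
  have e₁ : b₁ - d₁ = 0 := by
    refine (mul_eq_zero.1 (?_ : ((d₁ - a₁) ^ 2 + (d₂ - a₂) ^ 2) * _ = 0)).resolve_left hD
    linear_combination (d₁ - a₁) * hdot - (d₂ - a₂) * hcross
  have e₂ : b₂ - d₂ = 0 := by
    refine (mul_eq_zero.1 (?_ : ((d₁ - a₁) ^ 2 + (d₂ - a₂) ^ 2) * _ = 0)).resolve_left hD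
    linear_combination (d₂ - a₂) * hdot + (d₁ - a₁) * hcross
  rw [sub_eq_zero.1 e₁, sub_eq_zero.1 e₂]

/-- The base of an isosceles triangle with nonzero legs is not isotropic. -/
lemma dist2_ne_zero_of_isosceles (h2 : (2 : ZMod p) ≠ 0) {a b c : Pt p} (hab : a ≠ b)
    (h : dist2 a c = dist2 b c) (h0 : dist2 a c ≠ 0) : dist2 a b ≠ 0 := by
  obtain ⟨a₁, a₂⟩ := a
  obtain ⟨b₁, b₂⟩ := b
  obtain ⟨c₁, c₂⟩ := c
  simp only [dist2] at *
  intro hd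
  have hdot : (c₁ - a₁) * (b₁ - a₁) + (c₂ - a₂) * (b₂ - a₂) = 0 := by
    refine (mul_eq_zero.1 (?_ : (2 : ZMod p) * _ = 0)).resolve_left h2
    linear_combination hd + h
  have e₁ : b₁ - a₁ = 0 := by
    refine pow_eq_zero_iff two_ne_zero |>.1
      ((mul_eq_zero.1 (?_ : ((a₁ - c₁) ^ 2 + (a₂ - c₂) ^ 2) * _ = 0)).resolve_left h0)
    linear_combination ((c₁ - a₁) * (b₁ - a₁) - (c₂ - a₂) * (b₂ - a₂)) * hdot +
      (c₂ - a₂) ^ 2 * hd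
  have e₂ : b₂ - a₂ = 0 := by
    refine pow_eq_zero_iff two_ne_zero |>.1
      ((mul_eq_zero.1 (?_ : ((a₁ - c₁) ^ 2 + (a₂ - c₂) ^ 2) * _ = 0)).resolve_left h0)
    linear_combination ((c₂ - a₂) * (b₂ - a₂) - (c₁ - a₁) * (b₁ - a₁)) * hdot +
      (c₁ - a₁) ^ 2 * hd
  exact hab (by rw [sub_eq_zero.1 e₁, sub_eq_zero.1 e₂])

/-- The pairs of points of `E` at nonzero distance. -/
def nonisotropicPairs (E : Finset (Pt p)) : Finset (Pt p × Pt p) :=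
  (E ×ˢ E).filter fun q => dist2 q.1 q.2 ≠ 0

open Classical in
/-- The perpendicular bisectors determined by `E`. -/
noncomputable def bisectors (E : Finset (Pt p)) : Finset (Set (Pt p)) :=
  (nonisotropicPairs E).image fun q => bisector q.1 q.2

open Classical in
/-- The number of pairs of points of `E` with a given perpendicular bisector. -/
noncomputable def bisectorWeight (E : Finset (Pt p)) (l : Set (Pt p)) : ℕ :=
  ((nonisotropicPairs E).filter fun q => bisector q.1 q.2 = l).card

lemma sum_bisectorWeight_mul (E : Finset (Pt p)) (f : Set (Pt p) → ℕ) :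
    ∑ l ∈ bisectors E, bisectorWeight E l * f l =
      ∑ q ∈ nonisotropicPairs E, f (bisector q.1 q.2) := by
  classical
  rw [Finset.sum_comp f fun q : Pt p × Pt p => bisector q.1 q.2, bisectors]
  refine Finset.sum_congr (by congr!) fun l _ => ?_
  rw [bisectorWeight, smul_eq_mul]

lemma sum_bisectorWeight_le (E : Finset (Pt p)) :
    ∑ l ∈ bisectors E, bisectorWeight E l ≤ E.card ^ 2 := by
  have h := sum_bisectorWeight_mul E fun _ => 1
  simp only [mul_one] at h
  rw [h, ← Finset.card_eq_sum_ones, sq, ← Finset.card_product]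
  exact Finset.card_filter_le _ _

lemma sum_bisectorWeight_sq_le (E : Finset (Pt p)) :
    ∑ l ∈ bisectors E, bisectorWeight E l ^ 2 ≤ Qcount E := by
  classical
  have h := sum_bisectorWeight_mul E (bisectorWeight E)
  simp only [← sq] at h
  rw [h]
  simp only [bisectorWeight]
  rw [← Finset.card_sigma]
  have hinj : Function.Injective (fun x : (Σ _ : Pt p × Pt p, Pt p × Pt p) =>
      ((x.1.1, x.1.2, x.2.1, x.2.2) : Pt p × Pt p × Pt p × Pt p)) := by
    rintro ⟨⟨a, b⟩, c, d⟩ ⟨⟨a', b'⟩, c', d'⟩ hx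
    simp only [Prod.mk.injEq] at hx
    obtain ⟨rfl, rfl, rfl, rfl⟩ := hx
    rfl
  rw [← Finset.card_image_of_injective _ hinj, ← Set.ncard_coe_finset, Qcount]
  refine Set.ncard_le_ncard ?_ (Set.toFinite _)
  intro q hq
  obtain ⟨⟨⟨a, b⟩, c, d⟩, hx, rfl⟩ := Finset.mem_image.1 (Finset.mem_coe.1 hq)
  obtain ⟨h1, h2⟩ := Finset.mem_sigma.1 hx
  obtain ⟨h2, h3⟩ := Finset.mem_filter.1 h2
  obtain ⟨h1, h4⟩ := Finset.mem_filter.1 h1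
  obtain ⟨h2, h5⟩ := Finset.mem_filter.1 h2
  rw [Finset.mem_product] at h1 h2
  exact ⟨h1.1, h1.2, h2.1, h2.2, h4, h5, h3.symm⟩

lemma bisectorWeight_le (h2 : (2 : ZMod p) ≠ 0) (E : Finset (Pt p)) (l : Set (Pt p)) :
    bisectorWeight E l ≤ E.card := by
  refine Finset.card_le_card_of_injOn Prod.fst ?_ ?_
  · intro q hq
    have h1 := Finset.mem_filter.1 (Finset.mem_filter.1 (Finset.mem_coe.1 hq)).1
    exact (Finset.mem_product.1 h1.1).1
  · rintro ⟨a, b⟩ hq ⟨a', b'⟩ hq' haa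
    obtain ⟨h1, h3⟩ := Finset.mem_filter.1 (Finset.mem_coe.1 hq)
    obtain ⟨h1', h3'⟩ := Finset.mem_filter.1 (Finset.mem_coe.1 hq')
    simp only at haa h3 h3'
    subst haa
    rw [eq_of_bisector_eq h2 (Finset.mem_filter.1 h1').2 (h3.trans h3'.symm)]

lemma one_le_bisectorWeight {E : Finset (Pt p)} {l : Set (Pt p)} (hl : l ∈ bisectors E) :
    1 ≤ bisectorWeight E l := by
  classical
  obtain ⟨q, hq, rfl⟩ := Finset.mem_image.1 hl
  exact Finset.card_pos.2 ⟨q, Finset.mem_filter.2 ⟨hq, rfl⟩⟩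

open Classical in
lemma triCount_le (h2 : (2 : ZMod p) ≠ 0) (E : Finset (Pt p)) :
    triCount E ≤ E.card ^ 2 +
      ∑ l ∈ bisectors E, bisectorWeight E l * (E.filter fun x => x ∈ l).card := by
  rw [sum_bisectorWeight_mul E fun l => (E.filter fun x => x ∈ l).card, ← Finset.card_sigma, sq,
    ← Finset.card_product]
  refine (Finset.card_le_card (t := (E ×ˢ E).image (fun q => ((q.1, q.1, q.2) : Pt p × Pt p × Pt p)) ∪
    ((nonisotropicPairs E).sigma fun q => E.filter fun x => x ∈ bisector q.1 q.2).image
      (fun x : (Σ _ : Pt p × Pt p, Pt p) => ((x.1.1, x.1.2, x.2) : Pt p × Pt p × Pt p))) ?_).trans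
    ((Finset.card_union_le _ _).trans (Nat.add_le_add Finset.card_image_le Finset.card_image_le))
  rintro ⟨a, b, c⟩ hq
  obtain ⟨h1, h3, h4⟩ := Finset.mem_filter.1 hq
  simp only [Finset.mem_product] at h1 h3 h4
  obtain ⟨ha, hb, hc⟩ := h1
  rw [Finset.mem_union]
  by_cases hab : a = b
  · subst hab
    exact Or.inl (Finset.mem_image.2 ⟨(a, c), Finset.mem_product.2 ⟨ha, hc⟩, rfl⟩)
  · refine Or.inr (Finset.mem_image.2 ⟨⟨(a, b), c⟩, Finset.mem_sigma.2 ⟨?_, ?_⟩, rfl⟩)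
    · exact Finset.mem_filter.2 ⟨Finset.mem_product.2 ⟨ha, hb⟩,
        dist2_ne_zero_of_isosceles h2 hab h3 h4⟩
    · refine Finset.mem_filter.2 ⟨hc, ?_⟩
      rw [bisector, Set.mem_ofPred_eq]
      simp only [dist2] at h3 ⊢
      linear_combination h3

lemma triCount_eq_zero {E : Finset (Pt p)} (hE : E.card ≤ 1) : triCount E = 0 := by
  rw [triCount, Finset.card_eq_zero, Finset.filter_eq_empty_iff]
  rintro ⟨a, b, c⟩ hq ⟨-, h⟩
  simp only [Finset.mem_product] at hq
  have := Finset.card_le_one.1 hE a hq.1 c hq.2.2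
  simp [this, dist2] at h

end Isosceles

/-- (Lund–Petridis) There exist absolute constants `C, c > 0` such that for every prime `p`
and every `E ⊆ 𝔽_p²` with `|E| ≤ c·p^{8/5}`,
`T(E) ≤ C·(|E|²·log|E| + |E|^{5/3}·Q(E)^{4/15})`. -/
theorem lund_petridis_isosceles :
    ∃ C c : ℝ, 0 < C ∧ 0 < c ∧
      ∀ (p : ℕ) [Fact p.Prime],
        ∀ E : Finset (Pt p), (E.card : ℝ) ≤ c * (p : ℝ) ^ ((8 : ℝ) / 5) →
          (triCount E : ℝ) ≤
            C * ((E.card : ℝ) ^ 2 * Real.log (E.card : ℝ)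
              + (E.card : ℝ) ^ ((5 : ℝ) / 3) * (Qcount E : ℝ) ^ ((4 : ℝ) / 15)) := by
  obtain ⟨C, hC, h⟩ := exists_weighted_inc_le
  refine ⟨C + 2, 1 / 4, by positivity, by norm_num, fun p _ E hE => ?_⟩
  have hlog0 : 0 ≤ Real.log E.card := Real.log_natCast_nonneg _
  have hX : (0 : ℝ) ≤ (E.card : ℝ) ^ ((5 : ℝ) / 3) * (Qcount E : ℝ) ^ ((4 : ℝ) / 15) := by positivity
  have hY : (0 : ℝ) ≤ (E.card : ℝ) ^ 2 * Real.log E.card := by positivity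
  rcases Nat.lt_or_ge E.card 2 with h1 | h1
  · rw [triCount_eq_zero (by omega), Nat.cast_zero]
    positivity
  have hNR : (2 : ℝ) ≤ E.card := by exact_mod_cast h1
  have hp1 : (1 : ℝ) ≤ p := by exact_mod_cast (Fact.out : p.Prime).one_lt.le
  have hp2 : p ≠ 2 := by
    rintro rfl
    have h3 : ((2 : ℕ) : ℝ) ^ ((8 : ℝ) / 5) ≤ ((2 : ℕ) : ℝ) ^ (2 : ℝ) :=
      Real.rpow_le_rpow_of_exponent_le (by norm_num) (by norm_num)
    norm_num at h3 hE
    linarith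
  have h2 : (2 : ZMod p) ≠ 0 := by
    intro h0
    have h3 : ((2 : ℕ) : ZMod p) = 0 := by exact_mod_cast h0
    rw [ZMod.natCast_eq_zero_iff] at h3
    exact hp2 ((Nat.prime_dvd_prime_iff_eq Fact.out Nat.prime_two).1 h3)
  have hEp : (E.card : ℝ) ≤ (p : ℝ) ^ (7 / 4 : ℝ) := by
    have h3 : (p : ℝ) ^ ((8 : ℝ) / 5) ≤ (p : ℝ) ^ (7 / 4 : ℝ) :=
      Real.rpow_le_rpow_of_exponent_le hp1 (by norm_num)
    have h4 : (0 : ℝ) ≤ (p : ℝ) ^ ((8 : ℝ) / 5) := by positivity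
    linarith
  have hmain := h p (bisectors E) E (bisectorWeight E) (Qcount E)
    (fun l hl => by
      classical
      obtain ⟨q, hq, rfl⟩ := Finset.mem_image.1 hl
      exact isLine_bisector h2 (Finset.mem_filter.1 hq).2) h1 hEp
    (fun l hl => ⟨one_le_bisectorWeight hl, bisectorWeight_le h2 E l⟩)
    (sum_bisectorWeight_le E) (sum_bisectorWeight_sq_le E)
  have htri : (triCount E : ℝ) ≤ ((_ + _ : ℕ) : ℝ) := Nat.cast_le.2 (triCount_le h2 E)
  rw [Nat.cast_add, Nat.cast_pow] at htri
  have hlog : 1 ≤ 2 * Real.log E.card := by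
    have := Real.log_le_log (by norm_num) hNR
    linarith [half_lt_log_two]
  nlinarith [sq_nonneg (E.card : ℝ)]

end FpDist
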